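/- arXiv:2307.14836 — 7 statements merged into one kernel-verified Lean document; each statement's English description precedes it below -/
import Mathlib

section
/- Let J be an N×N GOE random matrix, let λ_1 ≤ … ≤ λ_N be the eigenvalues of J/√N, and let u be a random unit vector uniformly distributed on the unit sphere of ℝ^N and independent of the λ_i. Then sup_{α ∈ [-1,1]} | sup_{σ ∈ ℝ^N, |σ|=1, σ·u = α} Σ_{i=1}^N λ_i σ_i² − √(2(1-α²)) | converges to 0 in probability as N → ∞. -/
open MeasureTheory ProbabilityTheory Filter Matrix

/-- A GOE random matrix: symmetric, with independent centered Gaussian entries `J i j` for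
`i ≤ j`, of variance `1` on the diagonal and `1/2` off the diagonal. -/
def IsGOE {N : ℕ} {Ω : Type*} [MeasurableSpace Ω] (P : Measure Ω)
    (J : Ω → Matrix (Fin N) (Fin N) ℝ) : Prop :=
  (∀ ω, (J ω).IsSymm) ∧
  (∀ i j : Fin N, Measurable fun ω => J ω i j) ∧
  iIndepFun
    (fun p : {p : Fin N × Fin N // p.1 ≤ p.2} => fun ω => J ω p.1.1 p.1.2) P ∧
  ∀ i j : Fin N, i ≤ j →
    Measure.map (fun ω => J ω i j) P = gaussianReal 0 (if i = j then 1 else 1 / 2)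

/-- `u` is a random vector uniformly distributed on the unit sphere of `ℝ^N`:
it takes values in the sphere and its law is invariant under every orthogonal matrix. -/
def IsUniformOnSphere {N : ℕ} {Ω : Type*} [MeasurableSpace Ω] (P : Measure Ω)
    (u : Ω → Fin N → ℝ) : Prop :=
  Measurable u ∧ (∀ ω, ∑ i, u ω i ^ 2 = 1) ∧
  ∀ O : Matrix.orthogonalGroup (Fin N) ℝ,
    Measure.map (fun ω => (O : Matrix (Fin N) (Fin N) ℝ) *ᵥ u ω) P = Measure.map u P

namespace GOEaux

lemma hP_of_goe {n : ℕ} {Ω : Type*} [MeasurableSpace Ω] {P : Measure Ω}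
    [IsProbabilityMeasure P]
    {J : Ω → Matrix (Fin n) (Fin n) ℝ} (h : IsGOE P J) (i j : Fin n) :
    HasGaussianLaw (fun ω => J ω i j) P ∧ P[fun ω => J ω i j] = 0 ∧
      Var[fun ω => J ω i j; P] = (if i = j then 1 else 1 / 2) := by
  wlog hij : i ≤ j generalizing i j
  · have := this j i (le_of_not_ge hij)
    have e : (fun ω => J ω i j) = fun ω => J ω j i := by
      funext ω; exact (h.1 ω).apply j i
    rw [e]; simpa [eq_comm] using this
  have hl := h.2.2.2 i j hij
  have hm := h.2.1 i j
  refine ⟨⟨by rw [hl]; infer_instance⟩, ?_, ?_⟩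
  · have := integral_map (μ := P) hm.aemeasurable (f := fun x : ℝ => x) (by fun_prop)
    rw [hl, integral_id_gaussianReal] at this
    exact this.symm
  · have := variance_map (μ := P) (X := fun x : ℝ => x) (Y := fun ω => J ω i j)
      (by fun_prop) hm.aemeasurable
    rw [hl, variance_fun_id_gaussianReal] at this
    have e : ((fun x : ℝ => x) ∘ fun ω => J ω i j) = fun ω => J ω i j := rfl
    rw [e] at this
    rw [← this]
    split_ifs <;> simp

lemma goe_cov {n : ℕ} {Ω : Type*} [MeasurableSpace Ω] {P : Measure Ω}
    [IsProbabilityMeasure P]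
    {J : Ω → Matrix (Fin n) (Fin n) ℝ} (h : IsGOE P J) (i j k l : Fin n) :
    cov[fun ω => J ω i j, fun ω => J ω k l; P] =
      ((if i = k then 1 else 0) * (if j = l then 1 else 0)
        + (if i = l then 1 else 0) * (if j = k then 1 else 0)) / 2 := by
  wlog hij : i ≤ j generalizing i j
  · have := this j i (le_of_not_ge hij)
    have e : (fun ω => J ω i j) = fun ω => J ω j i := by
      funext ω; exact (h.1 ω).apply j i
    rw [e, this]; ring
  wlog hkl : k ≤ l generalizing k l
  · have := this l k (le_of_not_ge hkl)
    have e : (fun ω => J ω k l) = fun ω => J ω l k := by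
      funext ω; exact (h.1 ω).apply l k
    rw [e, this]; ring
  by_cases hpq : i = k ∧ j = l
  · obtain ⟨rfl, rfl⟩ := hpq
    rw [covariance_self (h.2.1 i j).aemeasurable, (hP_of_goe h i j).2.2]
    by_cases hh : i = j
    · simp [hh]
    · have hh' : ¬ j = i := fun e => hh e.symm
      simp [hh, hh']
  · have hi := h.2.2.1.indepFun (i := ⟨(i, j), hij⟩) (j := ⟨(k, l), hkl⟩)
      (by intro e; simp at e; exact hpq e)
    have h0 := hi.covariance_eq_zero (hP_of_goe h i j).1.memLp_two (hP_of_goe h k l).1.memLp_two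
    rw [h0]
    have h1 : (if i = k then (1:ℝ) else 0) * (if j = l then 1 else 0) = 0 := by
      by_cases a : i = k
      · have : j ≠ l := fun b => hpq ⟨a, b⟩
        simp [this]
      · simp [a]
    have h2 : (if i = l then (1:ℝ) else 0) * (if j = k then 1 else 0) = 0 := by
      by_cases a : i = l
      · have : j ≠ k := fun b => hpq ⟨le_antisymm (b ▸ hij) (a ▸ hkl), le_antisymm (by
          rw [b]; exact hkl) (by rw [← a]; exact hij)⟩
        simp [this]
      · simp [a]
    rw [h1, h2]; simp

/-- sorting a pair -/
def srt {n : ℕ} (a b : Fin n) : {p : Fin n × Fin n // p.1 ≤ p.2} :=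
  ⟨(min a b, max a b), min_le_max⟩

lemma srt_eq {n : ℕ} {M : Matrix (Fin n) (Fin n) ℝ} (h : M.IsSymm) (a b : Fin n) :
    M (srt a b).1.1 (srt a b).1.2 = M a b := by
  rcases le_total a b with hab | hab
  · simp [srt, hab]
  · simp [srt, hab]; exact h.apply b a |>.symm ▸ rfl

lemma goe_conj {n : ℕ} {Ω : Type*} [MeasurableSpace Ω] {P : Measure Ω}
    [IsProbabilityMeasure P]
    {J : Ω → Matrix (Fin n) (Fin n) ℝ} (h : IsGOE P J) (O : Matrix (Fin n) (Fin n) ℝ)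
    (hO : O * Oᵀ = 1) : IsGOE P (fun ω => O * J ω * Oᵀ) := by
  have hOO : ∀ i k, ∑ a, O i a * O k a = if i = k then 1 else 0 := by
    intro i k
    have := congrFun (congrFun hO i) k
    rw [Matrix.mul_apply] at this
    simpa [Matrix.one_apply] using this
  have hent : ∀ ω i j, (O * J ω * Oᵀ) i j
      = ∑ p : Fin n × Fin n, (O i p.1 * O j p.2) * J ω p.1 p.2 := by
    intro ω i j
    rw [Fintype.sum_prod_type_right]
    simp only [Matrix.mul_apply, Matrix.transpose_apply, Finset.sum_mul]
    refine Finset.sum_congr rfl fun a _ => Finset.sum_congr rfl fun b _ => by ring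
  have hmem : ∀ i j, ∀ p : Fin n × Fin n,
      MemLp (fun ω => (O i p.1 * O j p.2) * J ω p.1 p.2) 2 P := fun i j p =>
    ((hP_of_goe h p.1 p.2).1.memLp_two).const_mul _
  have hcov : ∀ i j k l, cov[fun ω => (O * J ω * Oᵀ) i j, fun ω => (O * J ω * Oᵀ) k l; P] =
      ((if i = k then 1 else 0) * (if j = l then 1 else 0)
        + (if i = l then 1 else 0) * (if j = k then 1 else 0)) / 2 := by
    intro i j k l
    simp_rw [hent]
    rw [covariance_fun_sum_fun_sum (hmem i j) (hmem k l)]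
    simp_rw [covariance_const_mul_left, covariance_const_mul_right, goe_cov h]
    simp_rw [Fintype.sum_prod_type]
    rw [← hOO i k, ← hOO j l, ← hOO i l, ← hOO j k]
    simp_rw [add_div, mul_add, Finset.sum_add_distrib]
    simp only [mul_ite, ite_mul, mul_one, one_mul, mul_zero, zero_mul, ite_div, zero_div,
      Finset.sum_ite_eq, Finset.mem_univ, if_true, Finset.sum_const_zero]
    simp_rw [Finset.sum_mul_sum, Finset.sum_div]
    congr 1
    · refine Finset.sum_congr rfl fun a _ => Finset.sum_congr rfl fun b _ => ?_
      ring
    · refine Finset.sum_congr rfl fun a _ => Finset.sum_congr rfl fun b _ => ?_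
      simp
      ring
  have hG0 := iIndepFun.hasGaussianLaw
    (fun p : {p : Fin n × Fin n // p.1 ≤ p.2} => (hP_of_goe h p.1.1 p.1.2).1) h.2.2.1
  let L : ({p : Fin n × Fin n // p.1 ≤ p.2} → ℝ) →L[ℝ] ({p : Fin n × Fin n // p.1 ≤ p.2} → ℝ) :=
    ContinuousLinearMap.pi fun q => ∑ p : Fin n × Fin n,
      (O q.1.1 p.1 * O q.1.2 p.2) • ContinuousLinearMap.proj (srt p.1 p.2)
  have hG := hG0.map_fun L
  have hLe : (fun ω => L fun p : {p : Fin n × Fin n // p.1 ≤ p.2} => J ω p.1.1 p.1.2) =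
      fun ω (p : {p : Fin n × Fin n // p.1 ≤ p.2}) => (O * J ω * Oᵀ) p.1.1 p.1.2 := by
    funext ω q
    simp only [L, ContinuousLinearMap.pi_apply, ContinuousLinearMap.sum_apply,
      ContinuousLinearMap.smul_apply, ContinuousLinearMap.proj_apply, smul_eq_mul, hent]
    refine Finset.sum_congr rfl fun p _ => ?_
    rw [srt_eq (h.1 ω)]
  rw [hLe] at hG
  have hmeas : ∀ i j : Fin n, Measurable fun ω => (O * J ω * Oᵀ) i j := by
    intro i j
    simp_rw [hent]
    exact Finset.measurable_sum _ fun p _ => (h.2.1 _ _).const_mul _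
  refine ⟨fun ω => ?_, hmeas, ?_, ?_⟩
  · have := h.1 ω
    unfold Matrix.IsSymm at this
    change (O * J ω * Oᵀ)ᵀ = O * J ω * Oᵀ
    rw [Matrix.transpose_mul, Matrix.transpose_mul, this, Matrix.transpose_transpose,
      Matrix.mul_assoc]
  · refine hG.iIndepFun_of_covariance_eq_zero fun p q hpq => ?_
    rw [hcov]
    have hne : ¬ (p.1.1 = q.1.1 ∧ p.1.2 = q.1.2) := fun e =>
      hpq (Subtype.ext (Prod.ext e.1 e.2))
    have hp := p.2
    have hq := q.2
    have hne2 : ¬ (p.1.1 = q.1.2 ∧ p.1.2 = q.1.1) := fun e => by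
      apply hne
      constructor
      · exact le_antisymm (e.2 ▸ hp) (by rw [e.1]; exact hq)
      · exact le_antisymm (by rw [e.2]; exact hq) (by rw [← e.1]; exact hp)
    simp only [mul_ite, ite_mul, one_mul, mul_one, zero_mul, mul_zero]
    by_cases a : p.1.1 = q.1.1 <;> by_cases b : p.1.2 = q.1.2 <;>
      by_cases c : p.1.1 = q.1.2 <;> by_cases d : p.1.2 = q.1.1 <;> simp_all
  · intro i j hij
    have hg1 : HasGaussianLaw (fun ω => (O * J ω * Oᵀ) i j) P :=
      hG.eval (X := fun (p : {p : Fin n × Fin n // p.1 ≤ p.2}) ω => (O * J ω * Oᵀ) p.1.1 p.1.2)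
        ⟨(i, j), hij⟩
    rw [hg1.map_eq_gaussianReal]
    congr 1
    · simp_rw [hent]
      rw [integral_finset_sum _ fun p _ => (hmem i j p).integrable (by norm_num)]
      refine Finset.sum_eq_zero fun p _ => ?_
      rw [integral_const_mul, (hP_of_goe h p.1 p.2).2.1, mul_zero]
    · rw [← covariance_self (hmeas i j).aemeasurable, hcov]
      by_cases a : i = j
      · subst a; simp
      · have a' : ¬ j = i := fun e => a e.symm
        simp only [a, a', if_true, if_false]
        ext
        simp

end GOEaux
namespace GOEaux

/-- direction of a vector, with a default -/
noncomputable def wdir {n : ℕ} (b : Fin (n + 1) → ℝ) : Fin (n + 1) → ℝ :=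
  open Classical in
  if ∑ i, b i ^ 2 = 0 then Pi.single 0 1 else fun i => b i / √(∑ i, b i ^ 2)

lemma single_unit (n : ℕ) : ∑ i, (Pi.single 0 1 : Fin (n + 1) → ℝ) i ^ 2 = 1 := by
  rw [Finset.sum_eq_single 0]
  · simp
  · intro b _ hb; simp [hb]
  · simp

lemma wdir_unit {n : ℕ} (b : Fin (n + 1) → ℝ) : ∑ i, wdir b i ^ 2 = 1 := by
  unfold wdir
  split_ifs with h
  · exact single_unit n
  · simp_rw [div_pow]
    rw [← Finset.sum_div, Real.sq_sqrt (Finset.sum_nonneg fun i _ => sq_nonneg _), div_self h]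

lemma wdir_mul {n : ℕ} (b : Fin (n + 1) → ℝ) (i) : b i = √(∑ i, b i ^ 2) * wdir b i := by
  unfold wdir
  split_ifs with h
  · rw [h]
    have := (Finset.sum_eq_zero_iff_of_nonneg (fun i _ => sq_nonneg (b i))).1 h i (Finset.mem_univ _)
    simpa using this
  · have : √(∑ i, b i ^ 2) ≠ 0 := by
      rw [Real.sqrt_ne_zero (Finset.sum_nonneg fun i _ => sq_nonneg _)]; exact h
    field_simp

lemma wdir_meas {n : ℕ} : Measurable (wdir : (Fin (n + 1) → ℝ) → Fin (n + 1) → ℝ) := by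
  classical
  have hm : Measurable fun b : Fin (n + 1) → ℝ => ∑ i, b i ^ 2 := by fun_prop
  have : (wdir : (Fin (n + 1) → ℝ) → Fin (n + 1) → ℝ) = fun b => if ∑ i, b i ^ 2 = 0 then
    Pi.single 0 1 else fun i => b i / √(∑ i, b i ^ 2) := by
    funext b; unfold wdir; congr
  rw [this]
  refine Measurable.ite (hm (measurableSet_singleton 0)) measurable_const ?_
  refine measurable_pi_lambda _ fun i => ?_
  fun_prop

lemma householder {n : ℕ} (v : Fin (n + 1) → ℝ) (hv : ∑ i, v i ^ 2 = 1) :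
    ∃ O : Matrix (Fin (n + 1)) (Fin (n + 1)) ℝ, O * Oᵀ = 1 ∧ Oᵀ * O = 1 ∧
      Oᵀ *ᵥ v = Pi.single 0 1 := by
  set e : Fin (n + 1) → ℝ := Pi.single 0 1 with he
  set w : Fin (n + 1) → ℝ := v - e with hw
  have hvv : v ⬝ᵥ v = 1 := by
    rw [← hv]; simp [dotProduct, sq]
  have hee : e ⬝ᵥ e = 1 := by simp [he]
  have hev : e ⬝ᵥ v = v 0 := by simp [he]
  have hve : v ⬝ᵥ e = v 0 := by simp [he]
  have hww : w ⬝ᵥ w = 2 - 2 * v 0 := by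
    rw [hw, sub_dotProduct, dotProduct_sub, dotProduct_sub, hvv, hee, hev, hve]; ring
  have hwv : w ⬝ᵥ v = 1 - v 0 := by
    rw [hw, sub_dotProduct, hvv, hev]
  let O : Matrix (Fin (n + 1)) (Fin (n + 1)) ℝ := 1 - (2 / (w ⬝ᵥ w)) • vecMulVec w w
  have hOT : Oᵀ = O := by
    simp [O, transpose_vecMulVec]
  have hOO : O * O = 1 := by
    have h1 : vecMulVec w w * vecMulVec w w = (w ⬝ᵥ w) • vecMulVec w w := by
      rw [vecMulVec_mul_vecMulVec]
      ext i j; simp [vecMulVec_apply]; try ring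
    simp only [O, sub_mul, mul_sub, one_mul, mul_one, smul_mul_assoc, mul_smul_comm, h1, smul_smul]
    by_cases h0 : w ⬝ᵥ w = 0
    · simp [h0]
    · have : 2 / w ⬝ᵥ w * (2 / w ⬝ᵥ w * w ⬝ᵥ w) = 2 / w ⬝ᵥ w + 2 / w ⬝ᵥ w := by
        field_simp; ring
      rw [smul_sub, smul_smul, this, add_smul]; abel
  refine ⟨O, by rw [hOT, hOO], by rw [hOT, hOO], ?_⟩
  rw [hOT]
  simp only [O, sub_mulVec, one_mulVec, smul_mulVec, vecMulVec_mulVec, hwv]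
  by_cases h0 : w ⬝ᵥ w = 0
  · have : w = 0 := dotProduct_self_eq_zero.1 h0
    have hve : v = e := by rwa [hw, sub_eq_zero] at this
    simp [h0, hve]
  · have h2 : 2 / w ⬝ᵥ w * (1 - v 0) = 1 := by
      rw [hww] at h0 ⊢
      rw [div_mul_eq_mul_div, div_eq_one_iff_eq h0]
      ring
    funext i
    have : (2 / w ⬝ᵥ w) * (w i * (1 - v 0)) = w i := by
      rw [mul_comm (w i), ← mul_assoc, h2, one_mul]
    simp [this]
    simp [hw]

lemma goe_minor {n : ℕ} {Ω : Type*} [MeasurableSpace Ω] {P : Measure Ω}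
    {J : Ω → Matrix (Fin (n + 1)) (Fin (n + 1)) ℝ} (h : IsGOE P J) :
    IsGOE P (fun ω => (J ω).submatrix Fin.succ Fin.succ) := by
  refine ⟨fun ω => (h.1 ω).submatrix _, fun i j => h.2.1 _ _, ?_, fun i j hij => ?_⟩
  · let g : {p : Fin n × Fin n // p.1 ≤ p.2} →
        {p : Fin (n + 1) × Fin (n + 1) // p.1 ≤ p.2} :=
      fun p => ⟨(p.1.1.succ, p.1.2.succ), Fin.succ_le_succ_iff.2 p.2⟩
    have hg : g.Injective := by
      intro p q hpq
      simp only [g, Subtype.mk.injEq, Prod.mk.injEq, Fin.succ_inj] at hpq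
      exact Subtype.ext (Prod.ext hpq.1 hpq.2)
    exact h.2.2.1.precomp hg
  · have := h.2.2.2 i.succ j.succ (Fin.succ_le_succ_iff.2 hij)
    simpa using this

lemma goe_indep {n : ℕ} {Ω : Type*} [MeasurableSpace Ω] {P : Measure Ω}
    {J : Ω → Matrix (Fin (n + 1)) (Fin (n + 1)) ℝ} (h : IsGOE P J) :
    IndepFun (fun ω (i : Fin n) => J ω 0 i.succ)
      (fun ω (i j : Fin n) => J ω i.succ j.succ) P := by
  classical
  let S : Finset {p : Fin (n + 1) × Fin (n + 1) // p.1 ≤ p.2} :=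
    Finset.univ.filter fun p => p.1.1 = 0
  let T : Finset {p : Fin (n + 1) × Fin (n + 1) // p.1 ≤ p.2} :=
    Finset.univ.filter fun p => ¬ p.1.1 = 0
  have hST : Disjoint S T := Finset.disjoint_filter_filter_not _ _ _
  have hI := h.2.2.1.indepFun_finset S T hST (fun p => h.2.1 _ _)
  let φ : (S → ℝ) → Fin n → ℝ := fun f i => f ⟨⟨(0, i.succ), Fin.zero_le _⟩, by simp [S]⟩
  let ψ : (T → ℝ) → Fin n → Fin n → ℝ := fun f i j =>
    f ⟨srt i.succ j.succ, by
      simp only [T, srt, Finset.mem_filter, Finset.mem_univ, true_and]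
      rcases le_total i.succ j.succ with hh | hh
      · simp [min_eq_left hh]
      · simp [min_eq_right hh]⟩
  have hφ : Measurable φ := measurable_pi_lambda _ fun i => measurable_pi_apply _
  have hψ : Measurable ψ := measurable_pi_lambda _ fun i => measurable_pi_lambda _ fun j =>
    measurable_pi_apply _
  have := hI.comp hφ hψ
  convert this using 1
  · rfl
  funext ω i j
  exact (srt_eq (h.1 ω) i.succ j.succ).symm

lemma step {n : ℕ} {Ω : Type*} [MeasurableSpace Ω] {P : Measure Ω} [IsProbabilityMeasure P]
    (S : Matrix (Fin (n + 1)) (Fin (n + 1)) ℝ → (Fin (n + 1) → ℝ) → Prop)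
    (T : Matrix (Fin (n + 2)) (Fin (n + 2)) ℝ → (Fin (n + 2) → ℝ) → Prop)
    (hS : MeasurableSet {p : (Fin (n + 1) → Fin (n + 1) → ℝ) × (Fin (n + 1) → ℝ) |
      S (Matrix.of p.1) p.2})
    (hT : ∀ O : Matrix (Fin (n + 2)) (Fin (n + 2)) ℝ, O * Oᵀ = 1 → ∀ M v,
      T (Oᵀ * M * O) (Oᵀ *ᵥ v) → T M v)
    (A : ℝ) (Bs : Set (Fin (n + 1) → ℝ))
    (hdet : ∀ M : Matrix (Fin (n + 2)) (Fin (n + 2)) ℝ, M.IsSymm → |M 0 0| ≤ A →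
      (fun i : Fin (n + 1) => M 0 i.succ) ∈ Bs →
      S (M.submatrix Fin.succ Fin.succ) (wdir fun i : Fin (n + 1) => M 0 i.succ) →
      T M (Pi.single 0 1))
    (pA pB pS : ENNReal)
    (hpA : ∀ J : Ω → Matrix (Fin (n + 2)) (Fin (n + 2)) ℝ, IsGOE P J →
      P {ω | ¬ |J ω 0 0| ≤ A} ≤ pA)
    (hpB : ∀ J : Ω → Matrix (Fin (n + 2)) (Fin (n + 2)) ℝ, IsGOE P J →
      P {ω | (fun i : Fin (n + 1) => J ω 0 i.succ) ∉ Bs} ≤ pB)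
    (hpS : ∀ J : Ω → Matrix (Fin (n + 1)) (Fin (n + 1)) ℝ, IsGOE P J →
      ∀ v : Fin (n + 1) → ℝ, ∑ i, v i ^ 2 = 1 → P {ω | ¬ S (J ω) v} ≤ pS)
    (J : Ω → Matrix (Fin (n + 2)) (Fin (n + 2)) ℝ) (hJ : IsGOE P J)
    (v : Fin (n + 2) → ℝ) (hv : ∑ i, v i ^ 2 = 1) :
    P {ω | ¬ T (J ω) v} ≤ pA + pB + pS := by
  obtain ⟨O, hO1, hO2, hOv⟩ := householder v hv
  have hJ1 : IsGOE P (fun ω => Oᵀ * J ω * Oᵀᵀ) :=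
    goe_conj hJ Oᵀ (by rw [Matrix.transpose_transpose]; exact hO2)
  rw [Matrix.transpose_transpose] at hJ1
  set J1 := fun ω => Oᵀ * J ω * O with hJ1def
  have hsub : {ω | ¬ T (J ω) v} ⊆ ({ω | ¬ |J1 ω 0 0| ≤ A} ∪
      {ω | (fun i : Fin (n + 1) => J1 ω 0 i.succ) ∉ Bs}) ∪
      {ω | ¬ S ((J1 ω).submatrix Fin.succ Fin.succ)
        (wdir fun i : Fin (n + 1) => J1 ω 0 i.succ)} := by
    intro ω hω
    by_contra hcon
    simp only [Set.mem_union, Set.mem_setOf_eq, not_or, not_not] at hcon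
    apply hω
    apply hT O hO1
    rw [hOv]
    exact hdet _ (hJ1.1 ω) hcon.1.1 hcon.1.2 hcon.2
  refine (measure_mono hsub).trans ((measure_union_le _ _).trans ?_)
  refine add_le_add ((measure_union_le _ _).trans (add_le_add (hpA _ hJ1) (hpB _ hJ1))) ?_
  have hI := goe_indep hJ1
  have hm1 : Measurable (fun ω (i : Fin (n + 1)) => J1 ω 0 i.succ) :=
    measurable_pi_lambda _ fun i => hJ1.2.1 _ _
  have hm2 : Measurable (fun ω (i j : Fin (n + 1)) => J1 ω i.succ j.succ) :=
    measurable_pi_lambda _ fun i => measurable_pi_lambda _ fun j => hJ1.2.1 _ _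
  have hprod := (indepFun_iff_map_prod_eq_prod_map_map hm1.aemeasurable hm2.aemeasurable).1 hI
  let E : Set ((Fin (n + 1) → ℝ) × (Fin (n + 1) → Fin (n + 1) → ℝ)) :=
    {p | ¬ S (Matrix.of p.2) (wdir p.1)}
  have hE : MeasurableSet E := by
    have : Measurable fun p : (Fin (n + 1) → ℝ) × (Fin (n + 1) → Fin (n + 1) → ℝ) =>
      (p.2, wdir p.1) := measurable_snd.prodMk (wdir_meas.comp measurable_fst)
    exact (this hS).compl
  have h1 : {ω | ¬ S ((J1 ω).submatrix Fin.succ Fin.succ)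
        (wdir fun i : Fin (n + 1) => J1 ω 0 i.succ)} =
      (fun ω => ((fun i : Fin (n + 1) => J1 ω 0 i.succ),
        (fun i j : Fin (n + 1) => J1 ω i.succ j.succ))) ⁻¹' E := rfl
  rw [h1, ← Measure.map_apply (hm1.prodMk hm2) hE, hprod, Measure.prod_apply hE]
  haveI : IsProbabilityMeasure (P.map (fun ω (i : Fin (n + 1)) => J1 ω 0 i.succ)) :=
    Measure.isProbabilityMeasure_map hm1.aemeasurable
  calc _ ≤ ∫⁻ _, pS ∂(P.map (fun ω (i : Fin (n + 1)) => J1 ω 0 i.succ)) := by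
        refine lintegral_mono fun b => ?_
        rw [Measure.map_apply hm2 (measurable_prodMk_left hE)]
        exact hpS _ (goe_minor hJ1) (wdir b) (wdir_unit b)
    _ = pS := by simp

end GOEaux
namespace GOEaux

/-- quadratic form -/
def qf {n : ℕ} (M : Matrix (Fin n) (Fin n) ℝ) (σ : Fin n → ℝ) : ℝ :=
  ∑ i, ∑ j, σ i * M i j * σ j

/-- upper bound condition -/
def Uc {n : ℕ} (A B : ℝ) (M : Matrix (Fin n) (Fin n) ℝ) (v : Fin n → ℝ) : Prop :=
  ∀ σ : Fin n → ℝ, qf M σ ≤ A * (∑ i, σ i ^ 2) +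
    B * (√(∑ i, σ i ^ 2) * √(∑ i, σ i ^ 2 - (σ ⬝ᵥ v) ^ 2))

/-- lower bound condition -/
def Lc {n : ℕ} (g : ℝ → ℝ) (M : Matrix (Fin n) (Fin n) ℝ) (v : Fin n → ℝ) : Prop :=
  ∀ α ∈ Set.Icc (-1 : ℝ) 1, ∃ σ : Fin n → ℝ, ∑ i, σ i ^ 2 = 1 ∧ σ ⬝ᵥ v = α ∧ g α ≤ qf M σ

lemma qf_eq {n : ℕ} (M : Matrix (Fin n) (Fin n) ℝ) (σ : Fin n → ℝ) :
    qf M σ = σ ⬝ᵥ (M *ᵥ σ) := by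
  simp [qf, dotProduct, mulVec, Finset.mul_sum, mul_assoc]

lemma sumsq_eq {n : ℕ} (σ : Fin n → ℝ) : ∑ i, σ i ^ 2 = σ ⬝ᵥ σ := by
  simp [dotProduct, sq]

lemma dot_conj {n : ℕ} (O : Matrix (Fin n) (Fin n) ℝ) (hO : O * Oᵀ = 1) (x y : Fin n → ℝ) :
    (Oᵀ *ᵥ x) ⬝ᵥ (Oᵀ *ᵥ y) = x ⬝ᵥ y := by
  rw [dotProduct_comm, dotProduct_mulVec, vecMul_transpose, mulVec_mulVec, hO, one_mulVec,
    dotProduct_comm]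

lemma qf_conj {n : ℕ} (O : Matrix (Fin n) (Fin n) ℝ) (hO : O * Oᵀ = 1)
    (M : Matrix (Fin n) (Fin n) ℝ) (σ : Fin n → ℝ) :
    qf (Oᵀ * M * O) (Oᵀ *ᵥ σ) = qf M σ := by
  rw [qf_eq, qf_eq, mulVec_mulVec, Matrix.mul_assoc, Matrix.mul_assoc, hO, Matrix.mul_one,
    ← mulVec_mulVec, dot_conj O hO]

lemma Uc_conj {n : ℕ} (A B : ℝ) (O : Matrix (Fin n) (Fin n) ℝ) (hO : O * Oᵀ = 1)
    (M : Matrix (Fin n) (Fin n) ℝ) (v : Fin n → ℝ)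
    (h : Uc A B (Oᵀ * M * O) (Oᵀ *ᵥ v)) : Uc A B M v := by
  intro σ
  have := h (Oᵀ *ᵥ σ)
  rw [qf_conj O hO, sumsq_eq, dot_conj O hO, dot_conj O hO, ← sumsq_eq] at this
  exact this

lemma Lc_conj {n : ℕ} (g : ℝ → ℝ) (O : Matrix (Fin n) (Fin n) ℝ) (hO : O * Oᵀ = 1)
    (M : Matrix (Fin n) (Fin n) ℝ) (v : Fin n → ℝ)
    (h : Lc g (Oᵀ * M * O) (Oᵀ *ᵥ v)) : Lc g M v := by
  intro α hα
  obtain ⟨τ, h1, h2, h3⟩ := h α hα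
  have hO' : Oᵀ * O = 1 := mul_eq_one_comm.1 hO
  have hτ : Oᵀ *ᵥ (O *ᵥ τ) = τ := by rw [mulVec_mulVec, hO', one_mulVec]
  refine ⟨O *ᵥ τ, ?_, ?_, ?_⟩
  · rw [sumsq_eq, ← dot_conj O hO, hτ, ← sumsq_eq, h1]
  · rw [← dot_conj O hO, hτ, h2]
  · rw [← qf_conj O hO, hτ]; exact h3

lemma qf_cons {n : ℕ} (M : Matrix (Fin (n + 1)) (Fin (n + 1)) ℝ) (hM : M.IsSymm)
    (σ : Fin (n + 1) → ℝ) :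
    qf M σ = M 0 0 * σ 0 ^ 2 + 2 * σ 0 * ∑ i : Fin n, M 0 i.succ * σ i.succ
      + qf (M.submatrix Fin.succ Fin.succ) (fun i => σ i.succ) := by
  have hs : ∀ i : Fin n, M i.succ 0 = M 0 i.succ := fun i => hM.apply 0 i.succ
  simp only [qf, Fin.sum_univ_succ, hs, submatrix_apply, Finset.sum_add_distrib, Finset.mul_sum]
  have e1 : ∑ x : Fin n, σ x.succ * M 0 x.succ * σ 0
      = ∑ x : Fin n, σ 0 * (M 0 x.succ * σ x.succ) :=
    Finset.sum_congr rfl fun i _ => by ring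
  have e2 : ∑ x : Fin n, σ 0 * M 0 x.succ * σ x.succ
      = ∑ x : Fin n, σ 0 * (M 0 x.succ * σ x.succ) :=
    Finset.sum_congr rfl fun i _ => by ring
  have e3 : ∑ x : Fin n, 2 * σ 0 * (M 0 x.succ * σ x.succ)
      = 2 * ∑ x : Fin n, σ 0 * (M 0 x.succ * σ x.succ) := by
    rw [Finset.mul_sum]; exact Finset.sum_congr rfl fun i _ => by ring
  rw [e1, e2, e3]
  ring

lemma cauchy {n : ℕ} (σ v : Fin n → ℝ) (hv : ∑ i, v i ^ 2 = 1) :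
    (σ ⬝ᵥ v) ^ 2 ≤ ∑ i, σ i ^ 2 := by
  have := Finset.sum_mul_sq_le_sq_mul_sq Finset.univ σ v
  rw [hv, mul_one] at this
  exact this

lemma dot_b {n : ℕ} (b τ : Fin (n + 1) → ℝ) :
    ∑ i, b i * τ i = √(∑ i, b i ^ 2) * (τ ⬝ᵥ wdir b) := by
  rw [dotProduct, Finset.mul_sum]
  refine Finset.sum_congr rfl fun i _ => ?_
  nth_rw 1 [wdir_mul b i]; ring

lemma Uc_det {n : ℕ} (A B : ℝ) (M : Matrix (Fin (n + 2)) (Fin (n + 2)) ℝ) (hM : M.IsSymm)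
    (hA : |M 0 0| ≤ A)
    (hB : (fun i : Fin (n + 1) => M 0 i.succ) ∈ {b : Fin (n + 1) → ℝ | 2 * √(∑ i, b i ^ 2) ≤ B})
    (h : Uc A B (M.submatrix Fin.succ Fin.succ) (wdir fun i : Fin (n + 1) => M 0 i.succ)) :
    Uc A B M (Pi.single 0 1) := by
  intro σ
  rw [qf_cons M hM]
  have h1 := h (fun i => σ i.succ)
  simp only [Set.mem_setOf_eq] at hB
  set b : Fin (n + 1) → ℝ := fun i => M 0 i.succ with hb
  set τ : Fin (n + 1) → ℝ := fun i => σ i.succ with hτ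
  have h2 : ∑ i : Fin (n + 1), M 0 i.succ * σ i.succ = √(∑ i, b i ^ 2) * (τ ⬝ᵥ wdir b) :=
    dot_b b τ
  have h3 := cauchy τ (wdir b) (wdir_unit b)
  rw [h2, Fin.sum_univ_succ (fun i => σ i ^ 2)]
  have h4 : σ ⬝ᵥ (Pi.single 0 1) = σ 0 := by simp
  rw [h4]
  have h5 : ∑ i : Fin (n + 1), σ i.succ ^ 2 = ∑ i, τ i ^ 2 := rfl
  rw [h5]
  set t := ∑ i, τ i ^ 2 with ht
  set β := τ ⬝ᵥ wdir b
  set r := √(∑ i, b i ^ 2)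
  have ht0 : 0 ≤ t := (sq_nonneg _).trans h3
  have hr0 : 0 ≤ r := Real.sqrt_nonneg _
  have h6 : σ 0 ^ 2 + t - σ 0 ^ 2 = t := by ring
  rw [h6]
  have hx : √t ^ 2 = t := Real.sq_sqrt ht0
  have hy : √(t - β ^ 2) ^ 2 = t - β ^ 2 := Real.sq_sqrt (by linarith)
  have hcs : |σ 0| * |β| + √t * √(t - β ^ 2) ≤ √(σ 0 ^ 2 + t) * √t := by
    rw [← Real.sqrt_mul (show 0 ≤ σ 0 ^ 2 + t by positivity) t]
    apply Real.le_sqrt_of_sq_le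
    have e1 : |σ 0| ^ 2 = σ 0 ^ 2 := sq_abs _
    have e2 : |β| ^ 2 = β ^ 2 := sq_abs _
    have key : (σ 0 ^ 2 + t) * t = (|σ 0| ^ 2 + √t ^ 2) * (|β| ^ 2 + √(t - β ^ 2) ^ 2) := by
      rw [e1, e2, hx, hy]; ring
    rw [key]
    nlinarith [sq_nonneg (|σ 0| * √(t - β ^ 2) - √t * |β|)]
  have hM0 : M 0 0 * σ 0 ^ 2 ≤ A * σ 0 ^ 2 :=
    mul_le_mul_of_nonneg_right ((le_abs_self _).trans hA) (sq_nonneg _)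
  have h7 : 2 * σ 0 * (r * β) ≤ B * (|σ 0| * |β|) := by
    have : σ 0 * β ≤ |σ 0| * |β| := by rw [← abs_mul]; exact le_abs_self _
    have h0 : 0 ≤ |σ 0| * |β| := by positivity
    nlinarith
  have hB0 : 0 ≤ B := by linarith
  have h8 := mul_le_mul_of_nonneg_left hcs hB0
  rw [mul_add] at h8
  linarith

lemma Uc_base {A B : ℝ} (hB : 0 ≤ B) (M : Matrix (Fin 1) (Fin 1) ℝ) (v : Fin 1 → ℝ)
    (hA : |M 0 0| ≤ A) : Uc A B M v := by
  intro σ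
  have h0 : 0 ≤ B * (√(∑ i, σ i ^ 2) * √(∑ i, σ i ^ 2 - (σ ⬝ᵥ v) ^ 2)) := by positivity
  have : qf M σ = M 0 0 * σ 0 ^ 2 := by simp [qf]; ring
  have h1 : ∑ i, σ i ^ 2 = σ 0 ^ 2 := by simp
  rw [this]
  have hM0 : M 0 0 * σ 0 ^ 2 ≤ A * σ 0 ^ 2 :=
    mul_le_mul_of_nonneg_right ((le_abs_self _).trans hA) (sq_nonneg _)
  rw [h1] at h0 ⊢
  linarith

lemma exists_sigma {n : ℕ} (v : Fin (n + 2) → ℝ) (hv : ∑ i, v i ^ 2 = 1) (α : ℝ)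
    (hα : α ∈ Set.Icc (-1 : ℝ) 1) : ∃ σ : Fin (n + 2) → ℝ, ∑ i, σ i ^ 2 = 1 ∧ σ ⬝ᵥ v = α := by
  obtain ⟨O, hO1, hO2, hOv⟩ := householder v hv
  have hs : 0 ≤ 1 - α ^ 2 := by nlinarith [hα.1, hα.2]
  let τ : Fin (n + 2) → ℝ := Fin.cons α (Pi.single 0 √(1 - α ^ 2))
  have hτ : Oᵀ *ᵥ (O *ᵥ τ) = τ := by rw [mulVec_mulVec, hO2, one_mulVec]
  refine ⟨O *ᵥ τ, ?_, ?_⟩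
  · rw [sumsq_eq, ← dot_conj O hO1, hτ, ← sumsq_eq, Fin.sum_univ_succ]
    simp only [τ, Fin.cons_zero, Fin.cons_succ]
    rw [Finset.sum_eq_single 0]
    · simp [Real.sq_sqrt hs]
    · intro b _ hb; simp [hb]
    · simp
  · rw [← dot_conj O hO1, hτ, hOv]
    simp [τ]

lemma Lc_base {n : ℕ} {A B : ℝ} (hB : 0 ≤ B) (M : Matrix (Fin (n + 2)) (Fin (n + 2)) ℝ)
    (v : Fin (n + 2) → ℝ) (hv : ∑ i, v i ^ 2 = 1) (h : Uc A B (-M) v) :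
    Lc (fun _ => -(A + B)) M v := by
  intro α hα
  obtain ⟨σ, h1, h2⟩ := exists_sigma v hv α hα
  refine ⟨σ, h1, h2, ?_⟩
  have := h σ
  have e : qf (-M) σ = - qf M σ := by simp [qf]
  rw [e, h1, h2] at this
  have h3 : √(1 - α ^ 2) ≤ 1 := by
    rw [Real.sqrt_le_one]; nlinarith [sq_nonneg α]
  have h4 : B * (√1 * √(1 - α ^ 2)) ≤ B := by
    rw [Real.sqrt_one, one_mul]; nlinarith
  linarith

lemma Lc_det {n : ℕ} (A bm : ℝ) (g g' : ℝ → ℝ)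
    (hg : ∀ α ∈ Set.Icc (-1 : ℝ) 1, ∀ r, bm ≤ r → ∃ β ∈ Set.Icc (-1 : ℝ) 1,
      g' α ≤ -A + 2 * α * √(1 - α ^ 2) * r * β + (1 - α ^ 2) * g β)
    (M : Matrix (Fin (n + 2)) (Fin (n + 2)) ℝ) (hM : M.IsSymm)
    (hA : |M 0 0| ≤ A)
    (hB : (fun i : Fin (n + 1) => M 0 i.succ) ∈ {b : Fin (n + 1) → ℝ | bm ≤ √(∑ i, b i ^ 2)})
    (h : Lc g (M.submatrix Fin.succ Fin.succ) (wdir fun i : Fin (n + 1) => M 0 i.succ)) :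
    Lc g' M (Pi.single 0 1) := by
  intro α hα
  simp only [Set.mem_setOf_eq] at hB
  set b : Fin (n + 1) → ℝ := fun i => M 0 i.succ with hb
  obtain ⟨β, hβ, hgβ⟩ := hg α hα _ hB
  obtain ⟨τ, h1, h2, h3⟩ := h β hβ
  have hs : 0 ≤ 1 - α ^ 2 := by nlinarith [hα.1, hα.2]
  refine ⟨Fin.cons α (fun i => √(1 - α ^ 2) * τ i), ?_, ?_, ?_⟩
  · rw [Fin.sum_univ_succ]
    simp only [Fin.cons_zero, Fin.cons_succ, mul_pow, Real.sq_sqrt hs]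
    rw [← Finset.mul_sum, h1]; ring
  · simp
  · rw [qf_cons M hM]
    simp only [Fin.cons_zero, Fin.cons_succ]
    have e1 : ∑ i : Fin (n + 1), M 0 i.succ * (√(1 - α ^ 2) * τ i)
        = √(1 - α ^ 2) * (√(∑ i, b i ^ 2) * β) := by
      rw [← h2, ← dot_b b τ, Finset.mul_sum]
      exact Finset.sum_congr rfl fun i _ => by simp only [hb]; ring
    have e2 : qf (M.submatrix Fin.succ Fin.succ) (fun i => √(1 - α ^ 2) * τ i)
        = (1 - α ^ 2) * qf (M.submatrix Fin.succ Fin.succ) τ := by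
      simp only [qf, Finset.mul_sum]
      refine Finset.sum_congr rfl fun i _ => Finset.sum_congr rfl fun j _ => ?_
      nth_rw 3 [← Real.sq_sqrt hs]; ring
    rw [e1, e2]
    have h4 : -A ≤ M 0 0 * α ^ 2 := by
      have := abs_le.1 hA
      have h0 : α ^ 2 ≤ 1 := by linarith
      nlinarith [sq_nonneg α]
    have h5 := mul_le_mul_of_nonneg_left h3 hs
    linarith

lemma qf_cont {n : ℕ} : Continuous fun p : ((Fin n → Fin n → ℝ) × (Fin n → ℝ)) =>
    qf (Matrix.of p.1) p.2 := by
  unfold qf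
  simp only [Matrix.of_apply]
  fun_prop

lemma Uc_closed (n : ℕ) (A B : ℝ) :
    IsClosed {p : (Fin n → Fin n → ℝ) × (Fin n → ℝ) | Uc A B (Matrix.of p.1) p.2} := by
  unfold Uc
  simp only [Set.setOf_forall]
  refine isClosed_iInter fun σ => isClosed_le ?_ ?_
  · unfold qf
    simp only [Matrix.of_apply]
    fun_prop
  · unfold dotProduct
    fun_prop

lemma sphere_compact (n : ℕ) : IsCompact {σ : Fin n → ℝ | ∑ i, σ i ^ 2 = 1} := by
  refine (isCompact_Icc (a := fun _ => (-1 : ℝ)) (b := fun _ => (1 : ℝ))).of_isClosed_subset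
    (isClosed_eq (by fun_prop) continuous_const) ?_
  intro σ hσ
  have : ∀ i, σ i ^ 2 ≤ 1 := fun i => by
    rw [← hσ]; exact Finset.single_le_sum (fun j _ => sq_nonneg (σ j)) (Finset.mem_univ i)
  exact ⟨fun i => (abs_le.1 ((sq_le_one_iff_abs_le_one _).1 (this i))).1,
    fun i => (abs_le.1 ((sq_le_one_iff_abs_le_one _).1 (this i))).2⟩

lemma Lc_closed (n : ℕ) (g : ℝ → ℝ) :
    IsClosed {p : (Fin n → Fin n → ℝ) × (Fin n → ℝ) | Lc g (Matrix.of p.1) p.2} := by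
  unfold Lc
  simp only [Set.setOf_forall]
  refine isClosed_iInter fun α => isClosed_iInter fun hα => ?_
  haveI : CompactSpace {σ : Fin n → ℝ | ∑ i, σ i ^ 2 = 1} :=
    isCompact_iff_compactSpace.1 (sphere_compact n)
  let C : Set (((Fin n → Fin n → ℝ) × (Fin n → ℝ)) × {σ : Fin n → ℝ | ∑ i, σ i ^ 2 = 1}) :=
    {q | (q.2 : Fin n → ℝ) ⬝ᵥ q.1.2 = α ∧ g α ≤ qf (Matrix.of q.1.1) q.2}
  have hC : IsClosed C := by
    have e : C = {q | (q.2 : Fin n → ℝ) ⬝ᵥ q.1.2 = α} ∩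
      {q | g α ≤ qf (Matrix.of q.1.1) q.2} := rfl
    rw [e]
    have hsub : Continuous fun q : ((Fin n → Fin n → ℝ) × (Fin n → ℝ)) ×
      {σ : Fin n → ℝ | ∑ i, σ i ^ 2 = 1} => (q.2 : Fin n → ℝ) :=
      continuous_subtype_val.comp continuous_snd
    have hf1 : Continuous fun q : (Fin n → ℝ) × (Fin n → ℝ) => q.1 ⬝ᵥ q.2 := by
      unfold dotProduct; fun_prop
    refine IsClosed.inter (isClosed_eq ?_ continuous_const) (isClosed_le continuous_const ?_)
    · exact hf1.comp (hsub.prodMk (continuous_snd.comp continuous_fst))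
    · exact qf_cont.comp ((continuous_fst.comp continuous_fst).prodMk hsub)
  have := isClosedMap_fst_of_compactSpace C hC
  convert this using 1
  ext p
  constructor
  · rintro ⟨σ, h1, h2, h3⟩
    exact ⟨(p, ⟨σ, h1⟩), ⟨h2, h3⟩, rfl⟩
  · rintro ⟨⟨q, σ, h1⟩, ⟨h2, h3⟩, rfl⟩
    exact ⟨σ, h1, h2, h3⟩

end GOEaux

namespace GOEaux

lemma gsq_mgf (v : NNReal) (hv : v ≠ 0) (t : ℝ) (h : 2 * t * v < 1) :
    Integrable (fun x : ℝ => Real.exp (t * x ^ 2)) (gaussianReal 0 v) ∧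
    ∫ x, Real.exp (t * x ^ 2) ∂(gaussianReal 0 v) = (Real.sqrt (1 - 2 * t * v))⁻¹ := by
  have hv0 : (0:ℝ) < v := by positivity
  set b : ℝ := (1 - 2 * t * v) / (2 * v) with hb
  have hb0 : 0 < b := by
    apply div_pos <;> linarith
  have key : ∀ x : ℝ, gaussianPDFReal 0 v x * Real.exp (t * x ^ 2)
      = (Real.sqrt (2 * Real.pi * v))⁻¹ * Real.exp (-b * x ^ 2) := by
    intro x
    rw [gaussianPDFReal_def, mul_assoc, ← Real.exp_add]
    congr 2
    rw [hb]; field_simp; ring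
  constructor
  · rw [gaussianReal_of_var_ne_zero 0 hv]
    rw [integrable_withDensity_iff_integrable_smul₀' (measurable_gaussianPDF 0 v).aemeasurable
      (ae_of_all _ fun x => gaussianPDF_lt_top)]
    simp only [toReal_gaussianPDF, smul_eq_mul]
    simp_rw [key]
    exact (integrable_exp_neg_mul_sq hb0).const_mul _
  · rw [integral_gaussianReal_eq_integral_smul hv]
    simp only [smul_eq_mul]
    simp_rw [key]
    rw [integral_const_mul, integral_gaussian, ← Real.sqrt_inv, ← Real.sqrt_inv,
      ← Real.sqrt_mul (by positivity)]
    congr 1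
    rw [hb]
    have : 1 - 2 * t * v ≠ 0 := by linarith
    field_simp

set_option linter.unusedSectionVars false

section
variable {Ω : Type*} [MeasurableSpace Ω] {P : Measure Ω} [IsProbabilityMeasure P]

lemma sq_mgf {X : Ω → ℝ} (hX : Measurable X) {v : NNReal} (hv : v ≠ 0)
    (hl : Measure.map X P = gaussianReal 0 v) (t : ℝ) (h : 2 * t * v < 1) :
    Integrable (fun ω => Real.exp (t * X ω ^ 2)) P ∧
    mgf (fun ω => X ω ^ 2) P t = (Real.sqrt (1 - 2 * t * v))⁻¹ := by
  obtain ⟨h1, h2⟩ := gsq_mgf v hv t h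
  rw [← hl] at h1 h2
  constructor
  · exact h1.comp_measurable hX
  · rw [mgf, ← h2, integral_map hX.aemeasurable]
    exact h1.aestronglyMeasurable

lemma sum_mgf {m : ℕ} {X : Fin m → Ω → ℝ} (hX : ∀ i, Measurable (X i)) {v : NNReal} (hv : v ≠ 0)
    (hl : ∀ i, Measure.map (X i) P = gaussianReal 0 v) (hi : iIndepFun X P)
    (t : ℝ) (h : 2 * t * v < 1) :
    Integrable (fun ω => Real.exp (t * ∑ i, X i ω ^ 2)) P ∧
    mgf (fun ω => ∑ i, X i ω ^ 2) P t = ((Real.sqrt (1 - 2 * t * v))⁻¹) ^ m := by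
  have hi2 : iIndepFun (fun i ω => X i ω ^ 2) P :=
    hi.comp (fun _ x => x ^ 2) (fun _ => by fun_prop)
  have e : (fun ω => ∑ i, X i ω ^ 2) = ∑ i, (fun i ω => X i ω ^ 2) i := by
    ext ω; simp
  constructor
  · have := hi2.integrable_exp_mul_sum (t := t) (fun i => by have := hX i; fun_prop) (s := Finset.univ)
      (fun i _ => (sq_mgf (hX i) hv (hl i) t h).1)
    simpa using this
  · rw [e, hi2.mgf_sum (fun i => by have := hX i; fun_prop)]
    rw [Finset.prod_congr rfl (fun i _ => (sq_mgf (hX i) hv (hl i) t h).2)]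
    simp

lemma chern_up {m : ℕ} {X : Fin m → Ω → ℝ} (hX : ∀ i, Measurable (X i)) {v : NNReal} (hv : v ≠ 0)
    (hl : ∀ i, Measure.map (X i) P = gaussianReal 0 v) (hi : iIndepFun X P)
    (t : ℝ) (ht : 0 ≤ t) (h : 2 * t * v < 1) (a : ℝ) :
    P {ω | a ≤ ∑ i, X i ω ^ 2} ≤
      ENNReal.ofReal (Real.exp (-t * a) * ((Real.sqrt (1 - 2 * t * v))⁻¹) ^ m) := by
  obtain ⟨h1, h2⟩ := sum_mgf hX hv hl hi t h
  have := measure_ge_le_exp_mul_mgf a ht h1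
  rw [h2] at this
  exact (ENNReal.le_ofReal_iff_toReal_le (measure_ne_top _ _) (by positivity)).2 this

lemma chern_low {m : ℕ} {X : Fin m → Ω → ℝ} (hX : ∀ i, Measurable (X i)) {v : NNReal} (hv : v ≠ 0)
    (hl : ∀ i, Measure.map (X i) P = gaussianReal 0 v) (hi : iIndepFun X P)
    (t : ℝ) (ht : 0 ≤ t) (a : ℝ) :
    P {ω | ∑ i, X i ω ^ 2 ≤ a} ≤
      ENNReal.ofReal (Real.exp (t * a) * ((Real.sqrt (1 + 2 * t * v))⁻¹) ^ m) := by
  have hn : 2 * (-t) * v < 1 := by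
    have : (0:ℝ) ≤ v := v.2
    nlinarith [mul_nonneg ht this]
  obtain ⟨h1, h2⟩ := sum_mgf hX hv hl hi (-t) hn
  have := measure_le_le_exp_mul_mgf a (by linarith) h1
  rw [h2] at this
  have e : 1 - 2 * (-t) * (v:ℝ) = 1 + 2 * t * v := by ring
  rw [e, neg_neg] at this
  exact (ENNReal.le_ofReal_iff_toReal_le (measure_ne_top _ _) (by positivity)).2 this

lemma goe_row {n : ℕ} {J : Ω → Matrix (Fin (n+1)) (Fin (n+1)) ℝ} (hJ : IsGOE P J) :
    (∀ i : Fin n, Measurable (fun ω => J ω 0 i.succ)) ∧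
    (∀ i : Fin n, Measure.map (fun ω => J ω 0 i.succ) P = gaussianReal 0 (1/2)) ∧
    iIndepFun (fun (i : Fin n) ω => J ω 0 i.succ) P := by
  refine ⟨fun i => hJ.2.1 _ _, fun i => ?_, ?_⟩
  · rw [hJ.2.2.2 _ _ (Fin.zero_le _), if_neg (Fin.succ_ne_zero i).symm]
  · exact hJ.2.2.1.precomp (g := fun i : Fin n => (⟨(0, i.succ), Fin.zero_le _⟩ :
      {p : Fin (n+1) × Fin (n+1) // p.1 ≤ p.2}))
      (fun i j h => by simpa using h)

/-- diagonal bound -/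
lemma pA_bound {n : ℕ} {J : Ω → Matrix (Fin (n+1)) (Fin (n+1)) ℝ} (hJ : IsGOE P J)
    (A : ℝ) (hA : 0 ≤ A) :
    P {ω | ¬ |J ω 0 0| ≤ A} ≤ ENNReal.ofReal (2 * Real.exp (- A ^ 2 / 4)) := by
  have hl : Measure.map (fun ω => J ω 0 0) P = gaussianReal 0 1 := by
    rw [hJ.2.2.2 _ _ le_rfl, if_pos rfl]
  obtain ⟨h1, h2⟩ := sq_mgf (hJ.2.1 0 0) one_ne_zero hl (1/4) (by norm_num)
  have := measure_ge_le_exp_mul_mgf (A ^ 2) (by norm_num) h1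
  rw [h2] at this
  refine le_trans (measure_mono ?_) ((ENNReal.le_ofReal_iff_toReal_le (measure_ne_top _ _)
    (by positivity)).2 (this.trans ?_))
  · intro ω hω
    simp only [Set.mem_ofPred_eq, not_le] at hω ⊢
    rw [← sq_abs (J ω 0 0)]
    gcongr
  · rw [mul_comm]
    have e : -(1/4) * A ^ 2 = -A ^ 2 / 4 := by ring
    rw [e]
    gcongr
    rw [inv_le_comm₀ (by apply Real.sqrt_pos.2; norm_num) (by norm_num)]
    apply Real.le_sqrt_of_sq_le
    norm_num

end

/-- upper bound on row norm -/
lemma pB_bound.{u} (δ : ℝ) (hδ : 0 < δ) (hδ1 : δ < 1) : ∃ ρ : ℝ, 0 < ρ ∧ ρ < 1 ∧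
    ∀ (Ω : Type u) [MeasurableSpace Ω] (P : Measure Ω) [IsProbabilityMeasure P] (N n : ℕ), n ≤ N → ∀ J : Ω → Matrix (Fin (n+1)) (Fin (n+1)) ℝ, IsGOE P J →
      P {ω | (fun i : Fin n => J ω 0 i.succ) ∉ {b : Fin n → ℝ | 2 * Real.sqrt (∑ i, b i ^ 2)
        ≤ Real.sqrt (2 * N) * (1 + δ)}} ≤ ENNReal.ofReal (ρ ^ N) := by
  set t : ℝ := δ / (2 * (1 + δ)) with ht
  have ht0 : 0 < t := by positivity
  have ht1 : t < 1 := by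
    rw [ht, div_lt_one (by positivity)]; linarith
  have hts : t * (1 + δ) = δ / 2 := by rw [ht]; field_simp
  refine ⟨Real.exp (-t * ((1 + δ) / 2)) * (Real.sqrt (1 - t))⁻¹, ?_, ?_, ?_⟩
  · have : 0 < Real.sqrt (1 - t) := Real.sqrt_pos.2 (by linarith)
    positivity
  · have hs : 0 < Real.sqrt (1 - t) := Real.sqrt_pos.2 (by linarith)
    rw [← div_eq_mul_inv, div_lt_one hs]
    apply Real.lt_sqrt_of_sq_lt
    rw [← Real.exp_nat_mul]
    have e : ((2:ℕ):ℝ) * (-t * ((1 + δ) / 2)) = -(δ/2) := by push_cast; rw [← hts]; ring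
    rw [e, Real.exp_neg]
    have h1 : 1 + δ / 2 < Real.exp (δ/2) := by
      have := Real.add_one_lt_exp (x := δ/2) (by positivity); linarith
    have h2 : (Real.exp (δ/2))⁻¹ < (1 + δ/2)⁻¹ := by gcongr
    refine h2.trans_le ?_
    rw [inv_le_iff_one_le_mul₀ (by positivity), ht]
    have : (1 - δ / (2 * (1 + δ))) = (2 + δ) / (2 * (1+δ)) := by field_simp; ring
    rw [this, div_mul_eq_mul_div, le_div_iff₀ (by positivity)]
    nlinarith
  · intro Ω _ P _ N n hn J hJ
    obtain ⟨h1, h2, h3⟩ := goe_row hJ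
    have hc := chern_up h1 (by norm_num) h2 h3 t ht0.le (by push_cast; linarith) (N * ((1+δ)/2))
    refine le_trans (measure_mono ?_) (hc.trans ?_)
    · intro ω hω
      simp only [Set.mem_ofPred_eq, not_le] at hω ⊢
      by_contra hcon
      push Not at hcon
      refine absurd hω (not_lt.2 ?_)
      have : 2 * Real.sqrt (∑ i : Fin n, J ω 0 i.succ ^ 2)
          = Real.sqrt (4 * ∑ i : Fin n, J ω 0 i.succ ^ 2) := by
        rw [Real.sqrt_mul (by norm_num), show (4:ℝ) = 2 ^ 2 by norm_num,
          Real.sqrt_sq (by norm_num)]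
      rw [this]
      apply Real.sqrt_le_iff.2
      refine ⟨by positivity, ?_⟩
      rw [mul_pow, Real.sq_sqrt (by positivity)]
      have : (0:ℝ) ≤ N := by positivity
      nlinarith [mul_nonneg this hδ.le, mul_nonneg this (sq_nonneg δ)]
    · apply ENNReal.ofReal_le_ofReal
      have e : 1 - 2 * t * ((1/2 : NNReal) : ℝ) = 1 - t := by push_cast; ring
      rw [e, mul_pow, ← Real.exp_nat_mul]
      have e2 : -t * ((N:ℝ) * ((1 + δ) / 2)) = N * (-t * ((1 + δ) / 2)) := by ring
      rw [e2]
      gcongr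
      rw [one_le_inv₀ (Real.sqrt_pos.2 (by linarith))]
      apply Real.sqrt_le_one.2; linarith

/-- lower bound on row norm -/
lemma pBl_bound.{u} (δ : ℝ) (hδ : 0 < δ) (hδ1 : δ < 1) (K : ℕ) : ∃ ρ C : ℝ, 0 < ρ ∧ ρ < 1 ∧ 0 ≤ C ∧
    ∀ (Ω : Type u) [MeasurableSpace Ω] (P : Measure Ω) [IsProbabilityMeasure P] (N n : ℕ), N ≤ n + K → ∀ J : Ω → Matrix (Fin (n+1)) (Fin (n+1)) ℝ, IsGOE P J →
      P {ω | (fun i : Fin n => J ω 0 i.succ) ∉ {b : Fin n → ℝ | 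
        Real.sqrt (N / 2) * (1 - δ) ≤ Real.sqrt (∑ i, b i ^ 2)}} ≤ ENNReal.ofReal (C * ρ ^ N) := by
  set t : ℝ := δ / 2 with ht
  have ht0 : 0 < t := by positivity
  have hs : 0 < Real.sqrt (1 + t) := Real.sqrt_pos.2 (by linarith)
  refine ⟨Real.exp (t * ((1 - δ) / 2)) * (Real.sqrt (1 + t))⁻¹, Real.sqrt (1 + t) ^ K, ?_, ?_, ?_, ?_⟩
  · positivity
  · rw [← div_eq_mul_inv, div_lt_one hs]
    apply Real.lt_sqrt_of_sq_lt
    rw [← Real.exp_nat_mul]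
    have e : ((2:ℕ):ℝ) * (t * ((1 - δ) / 2)) = t * (1 - δ) := by push_cast; ring
    rw [e]
    -- exp x ≤ 1/(1-x)
    have hx : t * (1 - δ) < 1 := by nlinarith
    have h1 : 1 - t * (1 - δ) ≤ Real.exp (-(t * (1-δ))) := by
      have := Real.add_one_le_exp (-(t * (1-δ))); linarith
    have h2 : Real.exp (t * (1-δ)) ≤ (1 - t * (1-δ))⁻¹ := by
      rw [le_inv_comm₀ (Real.exp_pos _) (by linarith), ← Real.exp_neg]; exact h1
    refine h2.trans_lt ?_
    rw [inv_lt_iff_one_lt_mul₀ (by linarith)]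
    have : δ = 2 * t := by rw [ht]; ring
    rw [this]
    nlinarith [mul_pos ht0 ht0, mul_pos (mul_pos ht0 ht0) ht0]
  · positivity
  · intro Ω _ P _ N n hn J hJ
    obtain ⟨h1, h2, h3⟩ := goe_row hJ
    have hc := chern_low h1 (by norm_num) h2 h3 t ht0.le (N * ((1-δ)/2))
    refine le_trans (measure_mono ?_) (hc.trans ?_)
    · intro ω hω
      simp only [Set.mem_ofPred_eq, not_le] at hω ⊢
      by_contra hcon
      push Not at hcon
      refine absurd hω (not_lt.2 ?_)
      apply Real.le_sqrt_of_sq_le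
      rw [mul_pow, Real.sq_sqrt (by positivity)]
      have : (0:ℝ) ≤ N := by positivity
      nlinarith [mul_nonneg this hδ.le, mul_nonneg (mul_nonneg this hδ.le) (by linarith : 0 ≤ 1 - δ)]
    · apply ENNReal.ofReal_le_ofReal
      have e : 1 + 2 * t * ((1/2 : NNReal) : ℝ) = 1 + t := by push_cast; ring
      rw [e, mul_pow, ← Real.exp_nat_mul]
      have e2 : t * ((N:ℝ) * ((1 - δ) / 2)) = N * (t * ((1 - δ) / 2)) := by ring
      rw [e2, mul_left_comm (Real.sqrt (1 + t) ^ K)]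
      gcongr
      rw [inv_pow, inv_pow, ← div_eq_mul_inv, le_div_iff₀ (by positivity), 
        inv_mul_le_iff₀ (by positivity), ← pow_add]
      apply pow_le_pow_right₀ _ hn
      apply Real.le_sqrt_of_sq_le; linarith

end GOEaux

namespace GOEaux

lemma goe_neg {n : ℕ} {Ω : Type*} [MeasurableSpace Ω] {P : Measure Ω}
    {J : Ω → Matrix (Fin n) (Fin n) ℝ} (h : IsGOE P J) : IsGOE P (fun ω => - J ω) := by
  refine ⟨fun ω => (h.1 ω).neg, fun i j => (h.2.1 i j).neg, ?_, fun i j hij => ?_⟩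
  · exact h.2.2.1.comp (fun _ x => -x) (fun _ => measurable_neg)
  · have e := Measure.map_map (μ := P) measurable_neg (h.2.1 i j)
    refine (Eq.symm e).trans ?_
    rw [h.2.2.2 i j hij]
    have := gaussianReal_map_neg (μ := 0) (v := if i = j then 1 else 1/2)
    rw [neg_zero] at this
    exact this

lemma Uc_prob {Ω : Type*} [MeasurableSpace Ω] {P : Measure Ω} [IsProbabilityMeasure P]
    (N : ℕ) (A B : ℝ) (hB0 : 0 ≤ B) (pa pb : ENNReal)
    (hpa : ∀ n ≤ N, ∀ J : Ω → Matrix (Fin (n+1)) (Fin (n+1)) ℝ, IsGOE P J →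
      P {ω | ¬ |J ω 0 0| ≤ A} ≤ pa)
    (hpb : ∀ n ≤ N, ∀ J : Ω → Matrix (Fin (n+1)) (Fin (n+1)) ℝ, IsGOE P J →
      P {ω | (fun i : Fin n => J ω 0 i.succ) ∉ {b : Fin n → ℝ | 2 * √(∑ i, b i ^ 2) ≤ B}} ≤ pb)
    (n : ℕ) (hn : n ≤ N) (J : Ω → Matrix (Fin (n+1)) (Fin (n+1)) ℝ) (hJ : IsGOE P J)
    (v : Fin (n+1) → ℝ) (hv : ∑ i, v i ^ 2 = 1) :
    P {ω | ¬ Uc A B (J ω) v} ≤ (n + 1) * (pa + pb) := by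
  induction n with
  | zero =>
    refine le_trans (measure_mono ?_) ((hpa 0 hn J hJ).trans ?_)
    · intro ω hω hc
      exact hω (Uc_base hB0 _ _ hc)
    · simp
  | succ n ih =>
    have := step (P := P) (Uc A B) (Uc A B) (Uc_closed _ A B).measurableSet
      (fun O hO M v h => Uc_conj A B O hO M v h) A {b : Fin (n + 1) → ℝ | 2 * √(∑ i, b i ^ 2) ≤ B}
      (fun M hM hA hB h => Uc_det A B M hM hA hB h) pa pb ((n+1) * (pa + pb))
      (fun J hJ => hpa (n+1) hn J hJ) (fun J hJ => hpb (n+1) hn J hJ)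
      (fun J hJ v hv => ih (by omega) J hJ v hv) J hJ v hv
    refine this.trans (le_of_eq ?_)
    push_cast; ring

noncomputable def hk (A D C : ℝ) (k : ℕ) (α : ℝ) : ℝ :=
  D * √(1 - α ^ 2) * (1 - (1 - α ^ 2) ^ k) - k * A - C * (1 - α ^ 2) ^ k

lemma hk_rec (A D C : ℝ) (hA : 0 ≤ A) (k : ℕ) (α : ℝ) (hα : α ∈ Set.Icc (-1 : ℝ) 1)
    (r : ℝ) (hr : D / 2 ≤ r) :
    hk A D C (k+1) α ≤ -A + 2 * α * √(1 - α ^ 2) * r * α + (1 - α ^ 2) * hk A D C k α := by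
  have h1 : 0 ≤ α ^ 2 * √(1 - α ^ 2) := by positivity
  have h2 := mul_le_mul_of_nonneg_left hr h1
  have h3 : 0 ≤ α ^ 2 * (k * A) := by positivity
  simp only [hk, pow_succ (1 - α ^ 2) k]
  push_cast
  nlinarith

lemma Lc_prob {Ω : Type*} [MeasurableSpace Ω] {P : Measure Ω} [IsProbabilityMeasure P]
    (n : ℕ) (A B D : ℝ) (hA0 : 0 ≤ A) (hB0 : 0 ≤ B) (pa pb pu : ENNReal)
    (hpa : ∀ m, ∀ J : Ω → Matrix (Fin (m+1)) (Fin (m+1)) ℝ, IsGOE P J →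
      P {ω | ¬ |J ω 0 0| ≤ A} ≤ pa)
    (hpb : ∀ m, n + 1 ≤ m → ∀ J : Ω → Matrix (Fin (m+1)) (Fin (m+1)) ℝ, IsGOE P J →
      P {ω | (fun i : Fin m => J ω 0 i.succ) ∉ {b : Fin m → ℝ | D / 2 ≤ √(∑ i, b i ^ 2)}} ≤ pb)
    (hpu : ∀ J : Ω → Matrix (Fin (n+2)) (Fin (n+2)) ℝ, IsGOE P J →
      ∀ v, ∑ i, v i ^ 2 = 1 → P {ω | ¬ Uc A B (J ω) v} ≤ pu)
    (k : ℕ) (J : Ω → Matrix (Fin (n+k+2)) (Fin (n+k+2)) ℝ) (hJ : IsGOE P J)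
    (v : Fin (n+k+2) → ℝ) (hv : ∑ i, v i ^ 2 = 1) :
    P {ω | ¬ Lc (hk A D (A + B) k) (J ω) v} ≤ k * (pa + pb) + pu := by
  induction k with
  | zero =>
    have := hpu _ (goe_neg hJ) v hv
    refine le_trans (measure_mono ?_) (this.trans (by simp))
    intro ω hω hc
    apply hω
    have := Lc_base hB0 (J ω) v hv hc
    have e : hk A D (A + B) 0 = fun _ => -(A+B) := by ext α; simp [hk]
    rw [e]; exact this
  | succ k ih =>
    have := step (P := P) (Lc (hk A D (A + B) k)) (Lc (hk A D (A + B) (k+1)))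
      (Lc_closed _ _).measurableSet
      (fun O hO M v h => Lc_conj _ O hO M v h) A {b : Fin (n + k + 1 + 1) → ℝ | D / 2 ≤ √(∑ i, b i ^ 2)}
      (fun M hM hA hB h => Lc_det A (D/2) _ _ 
        (fun α hα r hr => ⟨α, hα, hk_rec A D (A+B) hA0 k α hα r hr⟩) M hM hA hB h) 
        pa pb (k * (pa + pb) + pu)
      (fun J hJ => hpa _ J hJ) (fun J hJ => hpb _ (by omega) J hJ)
      (fun J hJ v hv => ih J hJ v hv) J hJ v hv
    refine this.trans (le_of_eq ?_)
    push_cast; ring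

lemma hk_low (q w δ : ℝ) (hq : 0 ≤ q) (hw0 : 0 ≤ w) (hw : w ≤ 3/2) (hδ : 0 ≤ δ) (hδ1 : δ ≤ 1/2)
    (k : ℕ) (α : ℝ) (hα : α ∈ Set.Icc (-1 : ℝ) 1) (ρ : ℝ) (hρ : (1 - α ^ 2) ^ k ≤ ρ) :
    q * (w * √(1 - α ^ 2) - (k + 2) * δ - 6 * ρ) ≤
      hk (δ * q) (q * w * (1 - δ)) (δ * q + q * w * (1 + δ)) k α := by
  have hα2 : α ^ 2 ≤ 1 := by nlinarith [hα.1, hα.2]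
  have hs0 : 0 ≤ √(1 - α ^ 2) := by positivity
  have hs1 : √(1 - α ^ 2) ≤ 1 := by apply Real.sqrt_le_one.2; nlinarith
  have hx0 : 0 ≤ (1 - α ^ 2) ^ k := by apply pow_nonneg; linarith
  set s := √(1 - α ^ 2)
  set x := (1 - α ^ 2) ^ k
  have : hk (δ * q) (q * w * (1 - δ)) (δ * q + q * w * (1 + δ)) k α
    = q * (w * (1 - δ) * s * (1 - x) - k * δ - (δ + w * (1 + δ)) * x) := by
    simp only [hk]; ring
  rw [this]
  apply mul_le_mul_of_nonneg_left _ hq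
  have hws : w * s ≤ 3/2 := by nlinarith
  have hws0 : 0 ≤ w * s := by positivity
  have a1 : w * s * δ ≤ 3/2 * δ := by gcongr
  have a2 : w * s * x ≤ 3/2 * x := by gcongr
  have a3 : 0 ≤ w * s * (δ * x) := by positivity
  have a4 : (δ + w * (1 + δ)) * x ≤ (1/2 + 3/2 * (1 + 1/2)) * x := by gcongr
  nlinarith

lemma fin_rec (q w δ η : ℝ) (hq : 0 ≤ q) (hw0 : 0 ≤ w) (hw : w ≤ 3/2) (hδ : 0 ≤ δ) (hδ1 : δ ≤ 1/2)
    (hη : 0 < η) (hη1 : η < 1)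
    (k : ℕ) (α : ℝ) (hα : α ∈ Set.Icc (-1 : ℝ) 1) (r : ℝ) (hr : q * w * (1 - δ) / 2 ≤ r) :
    ∃ β ∈ Set.Icc (-1 : ℝ) 1,
      q * (w * √(1 - α ^ 2) - (3 * η ^ 2 + (k + 3) * δ + 6 * (1 - η ^ 2) ^ k)) ≤
      -(δ * q) + 2 * α * √(1 - α ^ 2) * r * β + (1 - α ^ 2) *
        hk (δ * q) (q * w * (1 - δ)) (δ * q + q * w * (1 + δ)) k β := by
  have hα2 : α ^ 2 ≤ 1 := by nlinarith [hα.1, hα.2]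
  have hη2 : η ^ 2 ≤ 1 := by nlinarith
  have hρ0 : 0 ≤ (1 - η ^ 2) ^ k := by apply pow_nonneg; linarith
  by_cases h : η ≤ |α|
  · refine ⟨α, hα, le_trans ?_ (hk_rec _ _ _ (by positivity) k α hα r hr)⟩
    have h2 : η ^ 2 ≤ α ^ 2 := by rw [← sq_abs α]; gcongr
    refine le_trans ?_ (hk_low q w δ hq hw0 hw hδ hδ1 (k+1) α hα ((1 - η ^ 2) ^ k) ?_)
    · apply mul_le_mul_of_nonneg_left _ hq
      push_cast
      nlinarith [sq_nonneg η]
    · calc (1 - α ^ 2) ^ (k+1) ≤ (1 - α ^ 2) ^ k :=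
          pow_le_pow_of_le_one (by linarith) (by nlinarith) (by omega)
        _ ≤ _ := by gcongr
  · push Not at h
    have hr0 : 0 ≤ r := le_trans (by
      have : 0 ≤ 1 - δ := by linarith
      positivity) hr
    obtain ⟨β, hβ2, hαβ⟩ : ∃ β : ℝ, (β = η ∨ β = -η) ∧ 0 ≤ α * β := by
      rcases le_total 0 α with h0 | h0
      · exact ⟨η, Or.inl rfl, by positivity⟩
      · exact ⟨-η, Or.inr rfl, by nlinarith⟩
    have hβ : β ∈ Set.Icc (-1 : ℝ) 1 := by
      rcases hβ2 with rfl | rfl <;> constructor <;> linarith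
    have hββ : β ^ 2 = η ^ 2 := by rcases hβ2 with rfl | rfl <;> ring
    refine ⟨β, hβ, ?_⟩
    have h1 := hk_low q w δ hq hw0 hw hδ hδ1 k β hβ ((1 - η ^ 2) ^ k) (by rw [hββ])
    have h2 : α ^ 2 ≤ η ^ 2 := by rw [← sq_abs α]; gcongr
    have h3 : 0 ≤ 2 * α * √(1 - α ^ 2) * r * β := by
      have : 0 ≤ 2 * (α * β) * √(1 - α ^ 2) * r := by positivity
      linarith
    have h4 : (1 - α ^ 2) * (q * (w * √(1 - β ^ 2) - (k + 2) * δ - 6 * (1 - η ^ 2) ^ k))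
      ≤ (1 - α ^ 2) * hk (δ * q) (q * w * (1 - δ)) (δ * q + q * w * (1 + δ)) k β :=
      mul_le_mul_of_nonneg_left h1 (by linarith)
    have h5 : 1 - η ^ 2 ≤ √(1 - β ^ 2) := by
      rw [hββ]; apply Real.le_sqrt_of_sq_le; nlinarith [sq_nonneg η]
    have h6 : √(1 - α ^ 2) ≤ 1 := by apply Real.sqrt_le_one.2; nlinarith
    have h7 : q * (w * √(1 - α ^ 2) - (3 * η ^ 2 + (k + 3) * δ + 6 * (1 - η ^ 2) ^ k)) ≤
      -(δ * q) + (1 - α ^ 2) * (q * (w * √(1 - β ^ 2) - (k + 2) * δ - 6 * (1 - η ^ 2) ^ k)) := by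
      have e : -(δ * q) + (1 - α ^ 2) * (q * (w * √(1 - β ^ 2) - (k + 2) * δ - 6 * (1 - η ^ 2) ^ k))
        = q * (-δ + (1 - α ^ 2) * (w * √(1 - β ^ 2) - (k + 2) * δ - 6 * (1 - η ^ 2) ^ k)) := by ring
      rw [e]
      apply mul_le_mul_of_nonneg_left _ hq
      have b1 : w * ((1 - η ^ 2) * (1 - η ^ 2)) ≤ w * ((1 - α ^ 2) * √(1 - β ^ 2)) := by
        apply mul_le_mul_of_nonneg_left _ hw0
        apply mul_le_mul _ h5 (by linarith) (by linarith)
        linarith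
      have b2 : w * √(1 - α ^ 2) ≤ w := by nlinarith
      have b3 : 0 ≤ α ^ 2 * ((k + 2) * δ + 6 * (1 - η ^ 2) ^ k) := by positivity
      have b4 : w * η ^ 2 ≤ 3 / 2 * η ^ 2 := by gcongr
      have b5 : 0 ≤ w * (η ^ 2 * η ^ 2) := by positivity
      nlinarith
    linarith

lemma Lfin_prob {Ω : Type*} [MeasurableSpace Ω] {P : Measure Ω} [IsProbabilityMeasure P]
    (n k : ℕ) (q w δ η : ℝ) (hq : 0 ≤ q) (hw0 : 0 ≤ w) (hw : w ≤ 3/2) (hδ : 0 ≤ δ) (hδ1 : δ ≤ 1/2)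
    (hη : 0 < η) (hη1 : η < 1) (pa pb pu : ENNReal)
    (hpa : ∀ m, ∀ J : Ω → Matrix (Fin (m+1)) (Fin (m+1)) ℝ, IsGOE P J →
      P {ω | ¬ |J ω 0 0| ≤ δ * q} ≤ pa)
    (hpb : ∀ m, n + 1 ≤ m → ∀ J : Ω → Matrix (Fin (m+1)) (Fin (m+1)) ℝ, IsGOE P J →
      P {ω | (fun i : Fin m => J ω 0 i.succ) ∉ {b : Fin m → ℝ | 
        q * w * (1 - δ) / 2 ≤ √(∑ i, b i ^ 2)}} ≤ pb)
    (hpu : ∀ J : Ω → Matrix (Fin (n+2)) (Fin (n+2)) ℝ, IsGOE P J →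
      ∀ v, ∑ i, v i ^ 2 = 1 → P {ω | ¬ Uc (δ * q) (q * w * (1 + δ)) (J ω) v} ≤ pu)
    (J : Ω → Matrix (Fin (n+k+3)) (Fin (n+k+3)) ℝ) (hJ : IsGOE P J)
    (v : Fin (n+k+3) → ℝ) (hv : ∑ i, v i ^ 2 = 1) :
    P {ω | ¬ Lc (fun α => q * (w * √(1 - α ^ 2) - (3 * η ^ 2 + (k + 3) * δ + 6 * (1 - η ^ 2) ^ k)))
      (J ω) v} ≤ (k + 1) * (pa + pb) + pu := by
  have := step (P := P) (Lc (hk (δ * q) (q * w * (1 - δ)) (δ * q + q * w * (1 + δ)) k))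
      (Lc (fun α => q * (w * √(1 - α ^ 2) - (3 * η ^ 2 + (k + 3) * δ + 6 * (1 - η ^ 2) ^ k))))
      (Lc_closed _ _).measurableSet
      (fun O hO M v h => Lc_conj _ O hO M v h) (δ * q)
      {b : Fin (n + k + 1 + 1) → ℝ | q * w * (1 - δ) / 2 ≤ √(∑ i, b i ^ 2)}
      (fun M hM hA hB h => Lc_det (δ * q) _ _ _ 
        (fun α hα r hr => fin_rec q w δ η hq hw0 hw hδ hδ1 hη hη1 k α hα r hr) M hM hA hB h) 
        pa pb (k * (pa + pb) + pu)
      (fun J hJ => hpa _ J hJ) (fun J hJ => hpb _ (by omega) J hJ)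
      (fun J hJ v hv => Lc_prob n (δ * q) (q * w * (1 + δ)) (q * w * (1 - δ)) (by positivity)
        (by positivity) pa pb pu hpa hpb hpu k J hJ v hv) J hJ v hv
  refine this.trans (le_of_eq ?_)
  ring

end GOEaux

namespace GOEaux

lemma tend_aux (k : ℕ) (C r : ℝ) (h0 : 0 ≤ r) (h1 : r < 1) :
    Tendsto (fun N : ℕ => (2 * (N:ℝ) + k + 1) * (C * r ^ N)) atTop (nhds 0) := by
  have a := tendsto_self_mul_const_pow_of_lt_one h0 h1
  have b := tendsto_pow_atTop_nhds_zero_of_lt_one h0 h1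
  have := (a.const_mul (2 * C)).add (b.const_mul ((k + 1) * C))
  simp only [mul_zero, add_zero] at this
  refine this.congr (fun N => ?_)
  ring

theorem main_prob.{u} (ε : ℝ) (hε : 0 < ε) : ∃ δ > 0, δ ≤ ε ∧ ∃ p : ℕ → ENNReal,
    Tendsto p atTop (nhds 0) ∧ ∀ᶠ N : ℕ in atTop,
      ∀ (Ω : Type u) [MeasurableSpace Ω] (P : Measure Ω) [IsProbabilityMeasure P]
        (J : Ω → Matrix (Fin N) (Fin N) ℝ), IsGOE P J → ∀ v, ∑ i, v i ^ 2 = 1 →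
        P {ω | ¬ (Uc (δ * √N) (√N * √2 * (1 + δ)) (J ω) v ∧
          Lc (fun α => √N * (√2 * √(1 - α ^ 2) - ε)) (J ω) v)} ≤ p N := by
  set η : ℝ := min (1/2) (ε / 9) with hη
  have hη0 : 0 < η := by positivity
  have hη1 : η ≤ 1/2 := min_le_left _ _
  have hη2 : η ≤ ε / 9 := min_le_right _ _
  have hη3 : 0 < η ^ 2 := by positivity
  obtain ⟨k, hk⟩ := exists_pow_lt_of_lt_one (show 0 < ε / 18 by positivity)
    (show 1 - η ^ 2 < 1 by linarith)
  set δ : ℝ := min (1/2) (min ε (ε / (3 * (k + 3)))) with hδ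
  have hδ0 : 0 < δ := by positivity
  have hδ1 : δ ≤ 1/2 := min_le_left _ _
  have hδ2 : δ ≤ ε := (min_le_right _ _).trans (min_le_left _ _)
  have hδ3 : δ ≤ ε / (3 * (k + 3)) := (min_le_right _ _).trans (min_le_right _ _)
  have hδ4 : (k + 3) * δ ≤ ε / 3 := by
    rw [le_div_iff₀ (by positivity)] at hδ3; linarith
  obtain ⟨ρ, hρ0, hρ1, hpb⟩ := pB_bound.{u} δ hδ0 (by linarith)
  obtain ⟨ρ', C, hρ'0, hρ'1, hC, hpb'⟩ := pBl_bound.{u} δ hδ0 (by linarith) (k + 2)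
  set r : ℝ := Real.exp (- δ ^ 2 / 4) with hr
  have hr1 : r < 1 := by
    rw [hr, Real.exp_lt_one_iff]; nlinarith
  refine ⟨δ, hδ0, hδ2, fun N => ENNReal.ofReal ((2 * (N:ℝ) + k + 1) *
    (2 * r ^ N + 1 * ρ ^ N + C * ρ' ^ N)), ?_, ?_⟩
  · rw [← ENNReal.ofReal_zero]
    apply ENNReal.tendsto_ofReal
    have := ((tend_aux k 2 r (Real.exp_pos _).le hr1).add (tend_aux k 1 ρ hρ0.le hρ1)).add
      (tend_aux k C ρ' hρ'0.le hρ'1)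
    simp only [add_zero] at this
    refine this.congr (fun N => ?_)
    ring
  filter_upwards [eventually_ge_atTop (k + 3)] with N hN
  intro Ω _ P _ J hJ v hv
  obtain ⟨n, hNd⟩ : ∃ n, N = n + k + 3 := ⟨N - (k + 3), by omega⟩
  have hq : (0:ℝ) ≤ √N := by positivity
  have hw0 : (0:ℝ) ≤ √2 := by positivity
  have hw : √(2:ℝ) ≤ 3/2 := by
    apply Real.sqrt_le_iff.2; norm_num
  have e1 : √N * √2 * (1 + δ) = √(2 * N) * (1 + δ) := by
    rw [Real.sqrt_mul (by norm_num)]; ring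
  have e2 : √N * √2 * (1 - δ) / 2 = √(N / 2) * (1 - δ) := by
    rw [Real.sqrt_div' _ (by norm_num)]
    have h2 : √(2:ℝ) * √2 = 2 := Real.mul_self_sqrt (by norm_num)
    have h3 : √(2:ℝ) ≠ 0 := by positivity
    field_simp
    rw [sq, h2]
    ring
  set pa : ENNReal := ENNReal.ofReal (2 * r ^ N) with hpa
  set pb : ENNReal := ENNReal.ofReal (ρ ^ N) with hpbd
  set pc : ENNReal := ENNReal.ofReal (C * ρ' ^ N) with hpc
  have Ha : ∀ m, ∀ J : Ω → Matrix (Fin (m+1)) (Fin (m+1)) ℝ, IsGOE P J →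
      P {ω | ¬ |J ω 0 0| ≤ δ * √N} ≤ pa := by
    intro m J hJ
    refine (pA_bound hJ _ (by positivity)).trans (le_of_eq ?_)
    rw [hpa, hr, ← Real.exp_nat_mul, mul_pow, Real.sq_sqrt (by positivity)]
    congr 3; ring
  have Hb : ∀ m ≤ N, ∀ J : Ω → Matrix (Fin (m+1)) (Fin (m+1)) ℝ, IsGOE P J →
      P {ω | (fun i : Fin m => J ω 0 i.succ) ∉ {b : Fin m → ℝ | 2 * √(∑ i, b i ^ 2) ≤
        √N * √2 * (1 + δ)}} ≤ pb := by
    intro m hm J hJ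
    rw [e1]
    exact hpb Ω P N m hm J hJ
  have Hc : ∀ m, n + 1 ≤ m → ∀ J : Ω → Matrix (Fin (m+1)) (Fin (m+1)) ℝ, IsGOE P J →
      P {ω | (fun i : Fin m => J ω 0 i.succ) ∉ {b : Fin m → ℝ | 
        √N * √2 * (1 - δ) / 2 ≤ √(∑ i, b i ^ 2)}} ≤ pc := by
    intro m hm J hJ
    rw [e2]
    exact hpb' Ω P N m (by omega) J hJ
  have HU := Uc_prob (P := P) N (δ * √N) (√N * √2 * (1 + δ)) (by positivity) pa pb
    (fun m _ => Ha m) Hb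
  have H1 : ∀ N', N' = n + k + 3 → ∀ J : Ω → Matrix (Fin N') (Fin N') ℝ, IsGOE P J → ∀ v,
      ∑ i, v i ^ 2 = 1 → P {ω | ¬ Uc (δ * √N) (√N * √2 * (1 + δ)) (J ω) v} ≤ 
      ((n + k + 2 : ℕ) + 1 : ENNReal) * (pa + pb) := by
    rintro N' rfl J hJ v hv
    exact HU (n + k + 2) (by omega) J hJ v hv
  have H2 : ∀ N', N' = n + k + 3 → ∀ J : Ω → Matrix (Fin N') (Fin N') ℝ, IsGOE P J → ∀ v,
      ∑ i, v i ^ 2 = 1 → P {ω | ¬ Lc (fun α => √N * (√2 * √(1 - α ^ 2) -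
      (3 * η ^ 2 + (k + 3) * δ + 6 * (1 - η ^ 2) ^ k))) (J ω) v} ≤ ((k + 1) * (pa + pc) +
        (((n + 1 : ℕ) : ENNReal) + 1) * (pa + pb)) := by
    rintro N' rfl J hJ v hv
    exact Lfin_prob (P := P) n k (√N) (√2) δ η hq hw0 hw hδ0.le hδ1 hη0 (by linarith) pa pc _
      Ha Hc (fun J hJ v hv => HU (n+1) (by omega) J hJ v hv) J hJ v hv
  have hsub : {ω | ¬ (Uc (δ * √N) (√N * √2 * (1 + δ)) (J ω) v ∧
          Lc (fun α => √N * (√2 * √(1 - α ^ 2) - ε)) (J ω) v)} ⊆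
     {ω | ¬ Uc (δ * √N) (√N * √2 * (1 + δ)) (J ω) v} ∪
     {ω | ¬ Lc (fun α => √N * (√2 * √(1 - α ^ 2) -
      (3 * η ^ 2 + (k + 3) * δ + 6 * (1 - η ^ 2) ^ k))) (J ω) v} := by
    intro ω hω
    by_contra hc
    simp only [Set.mem_union, Set.mem_ofPred_eq, not_or, not_not] at hc
    refine hω ⟨hc.1, fun α hα => ?_⟩
    obtain ⟨σ, s1, s2, s3⟩ := hc.2 α hα
    refine ⟨σ, s1, s2, le_trans ?_ s3⟩
    have : 3 * η ^ 2 + (k + 3) * δ + 6 * (1 - η ^ 2) ^ k ≤ ε := by nlinarith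
    exact mul_le_mul_of_nonneg_left (by linarith) hq
  refine (measure_mono hsub).trans ((measure_union_le _ _).trans ((add_le_add (H1 N hNd J hJ v hv) (H2 N hNd J hJ v hv)).trans ?_))
  have c1 : pa + pb ≤ pa + pb + pc := le_self_add
  have c2 : pa + pc ≤ pa + pb + pc := by gcongr; exact le_self_add
  have c3 : ENNReal.ofReal ((2 * (N:ℝ) + k + 1) *
    (2 * r ^ N + 1 * ρ ^ N + C * ρ' ^ N)) = (2 * N + k + 1) * (pa + pb + pc) := by
    have : 0 ≤ r := (Real.exp_pos _).le
    rw [ENNReal.ofReal_mul (by positivity), ENNReal.ofReal_add (by positivity) (by positivity),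
      ENNReal.ofReal_add (by positivity) (by positivity), one_mul]
    congr 1
    · rw [ENNReal.ofReal_mul (by norm_num)]
      simp
    · rw [ENNReal.ofReal_add (by positivity) (by positivity),
        ENNReal.ofReal_add (by positivity) (by positivity)]
  rw [c3]
  calc ((n + k + 2 : ℕ) + 1 : ENNReal) * (pa + pb) + ((k + 1) * (pa + pc) +
        (((n + 1 : ℕ) : ENNReal) + 1) * (pa + pb))
      ≤ (N : ENNReal) * (pa + pb + pc) + ((k + 1) * (pa + pb + pc) + N * (pa + pb + pc)) := by
        gcongr
        · rw [hNd]; push_cast; rw [add_assoc _ (2:ENNReal) 1]; norm_num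
        · rw [hNd]; norm_cast; omega
    _ = _ := by ring

end GOEaux

namespace GOEaux

lemma mono_unique {n : ℕ} {f g : Fin n → ℝ} (hf : Monotone f) (hg : Monotone g)
    (h : Finset.univ.val.map f = Finset.univ.val.map g) : f = g := by
  rw [Fin.univ_val_map, Fin.univ_val_map, Multiset.coe_eq_coe] at h
  exact List.ofFn_injective (h.eq_of_sortedLE hf.sortedLE_ofFn hg.sortedLE_ofFn)

lemma prod_roots {n : ℕ} (f : Fin n → ℝ) :
    (∏ i, (Polynomial.X - Polynomial.C (f i))).roots = Finset.univ.val.map f := by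
  rw [Polynomial.roots_prod]
  · simp
  · simp [Finset.prod_ne_zero_iff, Polynomial.X_sub_C_ne_zero]

lemma lam_meas {n : ℕ} {Ω : Type*} [MeasurableSpace Ω] (c : ℝ)
    (J : Ω → Matrix (Fin n) (Fin n) ℝ) (hs : ∀ ω, (J ω).IsSymm)
    (hJ : ∀ i j, Measurable fun ω => J ω i j)
    (lam : Ω → Fin n → ℝ) (hm : ∀ ω, Monotone (lam ω))
    (hl : ∀ ω, (c • J ω).charpoly.roots = Finset.univ.val.map (lam ω)) : Measurable lam := by
  let f : (Fin n → ℝ) → (ℕ → ℝ) := fun l t => ∏ i, ((t : ℝ) - l i)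
  let s : Set (Fin n → ℝ) := {l | Monotone l}
  have hsc : IsClosed s := by
    have : s = ⋂ i, ⋂ j, ⋂ (_ : i ≤ j), {l : Fin n → ℝ | l i ≤ l j} := by
      ext l; simp [s, Monotone]
    rw [this]
    refine isClosed_iInter fun i => isClosed_iInter fun j => isClosed_iInter fun _ => ?_
    exact isClosed_le (by fun_prop) (by fun_prop)
  have hf : Continuous f := by
    refine continuous_pi fun t => ?_
    fun_prop
  have hinj : Set.InjOn f s := by
    intro l hl l' hl' h
    apply mono_unique hl hl'
    rw [← prod_roots l, ← prod_roots l']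
    congr 1
    apply Polynomial.eq_of_infinite_eval_eq
    refine Set.Infinite.mono ?_ (Set.infinite_range_of_injective (Nat.cast_injective (R := ℝ)))
    rintro _ ⟨t, rfl⟩
    have := congrFun h t
    simpa [f, Polynomial.eval_prod] using this
  have emb := ContinuousOn.measurableEmbedding hsc.measurableSet hf.continuousOn hinj
  let lam' : Ω → s := fun ω => ⟨lam ω, hm ω⟩
  have key : Measurable lam' := by
    rw [← emb.measurable_comp_iff]
    have e : s.domRestrict f ∘ lam' = fun ω (t : ℕ) =>
        (Matrix.scalar (Fin n) (t : ℝ) - c • J ω).det := by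
      ext ω t
      rw [← Matrix.eval_charpoly]
      have hH : (c • J ω).IsHermitian := by
        rw [Matrix.IsHermitian, Matrix.conjTranspose_eq_transpose_of_trivial]
        exact (hs ω).smul c
      have h1 := hH.charpoly_eq
      have h2 := hH.roots_charpoly_eq_eigenvalues
      rw [hl ω] at h2
      have h3 : (c • J ω).charpoly =
          ((Finset.univ.val.map (lam ω)).map (fun a => Polynomial.X - Polynomial.C a)).prod := by
        rw [h1, h2, Multiset.map_map]
        rfl
      rw [h3, Multiset.map_map]
      change (∏ i, ((t : ℝ) - lam ω i)) = Polynomial.eval (t:ℝ)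
        (∏ i, (Polynomial.X - Polynomial.C (lam ω i)))
      simp [Polynomial.eval_prod]
    rw [e]
    refine measurable_pi_lambda _ fun t => ?_
    simp only [Matrix.det_apply]
    refine Finset.measurable_sum _ fun σ _ => ?_
    refine Measurable.const_smul (Finset.measurable_prod _ fun i _ => ?_) _
    simp only [Matrix.sub_apply, Matrix.smul_apply, smul_eq_mul]
    exact measurable_const.sub ((hJ _ _).const_mul c)
  exact measurable_subtype_coe.comp key

lemma lam_decomp {n : ℕ} (A : Matrix (Fin n) (Fin n) ℝ) (hs : A.IsSymm)
    (l : Fin n → ℝ) (hm : Monotone l)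
    (hl : A.charpoly.roots = Finset.univ.val.map l) :
    ∃ O : Matrix (Fin n) (Fin n) ℝ, O * Oᵀ = 1 ∧ Oᵀ * O = 1 ∧ A = O * Matrix.diagonal l * Oᵀ := by
  have hH : A.IsHermitian := by
    rw [Matrix.IsHermitian, Matrix.conjTranspose_eq_transpose_of_trivial]
    exact hs
  have h2 := hH.roots_charpoly_eq_eigenvalues
  have e : (RCLike.ofReal ∘ hH.eigenvalues : Fin n → ℝ) = hH.eigenvalues := by ext i; simp
  rw [hl, e] at h2
  set σ := Tuple.sort hH.eigenvalues with hσ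
  have h3 : l = hH.eigenvalues ∘ σ := by
    apply mono_unique hm (Tuple.monotone_sort _)
    rw [h2, ← Multiset.map_map, Multiset.map_univ_val_equiv]
  set U : Matrix (Fin n) (Fin n) ℝ := (hH.eigenvectorUnitary).1 with hU
  have hUU : U * Uᵀ = 1 := by
    have := Unitary.coe_mul_star_self hH.eigenvectorUnitary
    rw [Unitary.coe_star, Matrix.star_eq_conjTranspose,
      Matrix.conjTranspose_eq_transpose_of_trivial] at this
    exact this
  have hA : A = U * Matrix.diagonal hH.eigenvalues * Uᵀ := by
    have := hH.spectral_theorem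
    rw [Unitary.conjStarAlgAut_apply, e, Matrix.star_eq_conjTranspose,
      Matrix.conjTranspose_eq_transpose_of_trivial] at this
    exact this
  have h4 : (U.submatrix id σ) * (U.submatrix id σ)ᵀ = 1 := by
    rw [Matrix.transpose_submatrix, Matrix.submatrix_mul_equiv, hUU, Matrix.submatrix_id_id]
  refine ⟨U.submatrix id σ, h4, mul_eq_one_comm.1 h4, ?_⟩
  have h5 : Matrix.diagonal l = (Matrix.diagonal hH.eigenvalues).submatrix σ σ := by
    rw [h3, Matrix.submatrix_diagonal_equiv]
  rw [h5, Matrix.transpose_submatrix, Matrix.submatrix_mul_equiv, Matrix.submatrix_mul_equiv,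
    Matrix.submatrix_id_id]
  exact hA

lemma transfer {n : ℕ} {Ω : Type*} [MeasurableSpace Ω] {P : Measure Ω} [IsProbabilityMeasure P]
    (G : Matrix (Fin n) (Fin n) ℝ → (Fin n → ℝ) → Prop)
    (hG : MeasurableSet {p : (Fin n → Fin n → ℝ) × (Fin n → ℝ) | G (Matrix.of p.1) p.2})
    (hT : ∀ O : Matrix (Fin n) (Fin n) ℝ, O * Oᵀ = 1 → ∀ M v,
      G (Oᵀ * M * O) (Oᵀ *ᵥ v) → G M v)
    (J : Ω → Matrix (Fin n) (Fin n) ℝ) (hJ : ∀ i j, Measurable fun ω => J ω i j)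
    (p : ENNReal) (hp : ∀ v, ∑ i, v i ^ 2 = 1 → P {ω | ¬ G (J ω) v} ≤ p)
    (q : ℝ) (lam : Ω → Fin n → ℝ) (hlam : Measurable lam)
    (u : Ω → Fin n → ℝ) (hu : IsUniformOnSphere P u) (hi : IndepFun lam u P)
    (hd : ∀ ω, ∃ O : Matrix (Fin n) (Fin n) ℝ, O * Oᵀ = 1 ∧ Oᵀ * O = 1 ∧
      J ω = O * (q • Matrix.diagonal (lam ω)) * Oᵀ) :
    P {ω | ¬ G (q • Matrix.diagonal (lam ω)) (u ω)} ≤ p := by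
  obtain ⟨hum, hu1, hu2⟩ := hu
  set μ := Measure.map u P with hμ
  have : IsProbabilityMeasure μ := Measure.isProbabilityMeasure_map hum.aemeasurable
  have : IsProbabilityMeasure (Measure.map lam P) :=
    Measure.isProbabilityMeasure_map hlam.aemeasurable
  -- measurable sets
  have hS : MeasurableSet {x : (Fin n → ℝ) × (Fin n → ℝ) | ¬ G (q • Matrix.diagonal x.1) x.2} := by
    have hm : Measurable (fun x : (Fin n → ℝ) × (Fin n → ℝ) =>
        ((fun i j => (q • Matrix.diagonal x.1) i j : Fin n → Fin n → ℝ), x.2)) := by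
      refine Measurable.prodMk ?_ measurable_snd
      refine measurable_pi_lambda _ fun i => measurable_pi_lambda _ fun j => ?_
      simp only [Matrix.smul_apply, Matrix.diagonal_apply]
      split_ifs
      · fun_prop
      · fun_prop
    exact (hm hG).compl
  have hS' : MeasurableSet {x : Ω × (Fin n → ℝ) | ¬ G (J x.1) x.2} := by
    have hm : Measurable (fun x : Ω × (Fin n → ℝ) =>
        ((fun i j => J x.1 i j : Fin n → Fin n → ℝ), x.2)) := by
      refine Measurable.prodMk ?_ measurable_snd
      refine measurable_pi_lambda _ fun i => measurable_pi_lambda _ fun j => ?_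
      exact (hJ i j).comp measurable_fst
    exact (hm hG).compl
  have hSv : ∀ M : Matrix (Fin n) (Fin n) ℝ, MeasurableSet {v : Fin n → ℝ | ¬ G M v} := by
    intro M
    have hm : Measurable (fun v : Fin n → ℝ => ((fun i j => M i j : Fin n → Fin n → ℝ), v)) := by
      fun_prop
    exact (hm hG).compl
  have hprod : Measure.map (fun ω => (lam ω, u ω)) P = (Measure.map lam P).prod μ :=
    (indepFun_iff_map_prod_eq_prod_map_map hlam.aemeasurable hum.aemeasurable).1 hi
  have e1 : P {ω | ¬ G (q • Matrix.diagonal (lam ω)) (u ω)}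
      = ∫⁻ ω, μ {v | ¬ G (q • Matrix.diagonal (lam ω)) v} ∂P := by
    have h1 : P {ω | ¬ G (q • Matrix.diagonal (lam ω)) (u ω)} =
      Measure.map (fun ω => (lam ω, u ω)) P
        {x : (Fin n → ℝ) × (Fin n → ℝ) | ¬ G (q • Matrix.diagonal x.1) x.2} := by
      rw [Measure.map_apply (hlam.prodMk hum) hS]; rfl
    rw [h1, hprod, Measure.prod_apply hS, lintegral_map (measurable_measure_prodMk_left hS) hlam]
    rfl
  rw [e1]
  have e2 : ∀ ω, μ {v | ¬ G (q • Matrix.diagonal (lam ω)) v} ≤ μ {v | ¬ G (J ω) v} := by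
    intro ω
    obtain ⟨O, hO, hO', hd⟩ := hd ω
    have hinv : Measure.map (fun v => O *ᵥ v) μ = μ := by
      have := hu2 ⟨O, (Matrix.mem_orthogonalGroup_iff (Fin n) ℝ).2 hO⟩
      rw [hμ, Measure.map_map (by fun_prop) hum]
      exact this
    have hmO : Measurable (fun v : Fin n → ℝ => O *ᵥ v) := by fun_prop
    conv_rhs => rw [← hinv, Measure.map_apply hmO (hSv _)]
    apply measure_mono
    intro v hv hc
    apply hv
    refine hT Oᵀ (by rwa [Matrix.transpose_transpose]) _ _ ?_
    rw [Matrix.transpose_transpose, ← hd]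
    exact hc
  refine (lintegral_mono e2).trans ?_
  have e3 : ∫⁻ ω, μ {v | ¬ G (J ω) v} ∂P = ∫⁻ v, P {ω | ¬ G (J ω) v} ∂μ := by
    have a := Measure.prod_apply (μ := P) (ν := μ) hS'
    have b := Measure.prod_apply_symm (μ := P) (ν := μ) hS'
    exact a.symm.trans b
  rw [e3]
  have e4 : ∀ᵐ v ∂μ, P {ω | ¬ G (J ω) v} ≤ p := by
    have hms : MeasurableSet {v : Fin n → ℝ | ∑ i, v i ^ 2 = 1} :=
      measurableSet_eq_fun (by fun_prop) measurable_const
    have : ∀ᵐ v ∂μ, ∑ i, v i ^ 2 = 1 := by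
      rw [hμ, ae_map_iff hum.aemeasurable hms]
      exact ae_of_all _ hu1
    filter_upwards [this] with v hv using hp v hv
  refine (lintegral_mono_ae e4).trans ?_
  simp

lemma conclude {n : ℕ} (q δ ε : ℝ) (hq : 0 < q) (hδ : 0 ≤ δ) (hδε : δ ≤ ε) (l v : Fin n → ℝ)
    (hU : Uc (δ * q) (q * √2 * (1 + δ)) (q • Matrix.diagonal l) v)
    (hL : Lc (fun α => q * (√2 * √(1 - α ^ 2) - ε)) (q • Matrix.diagonal l) v) :
    sSup ((fun α =>
          |sSup {y : ℝ | ∃ σ : Fin n → ℝ, ∑ i, σ i ^ 2 = 1 ∧ σ ⬝ᵥ v = α ∧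
              y = ∑ i, l i * σ i ^ 2} -
            Real.sqrt (2 * (1 - α ^ 2))|) '' Set.Icc (-1 : ℝ) 1) ≤ 3 * ε := by
  have hqf : ∀ σ : Fin n → ℝ, qf (q • Matrix.diagonal l) σ = q * ∑ i, l i * σ i ^ 2 := by
    intro σ
    rw [qf_eq, Matrix.smul_mulVec, dotProduct_smul, smul_eq_mul]
    congr 1
    simp only [dotProduct, Matrix.mulVec_diagonal]
    exact Finset.sum_congr rfl fun i _ => by ring
  apply csSup_le
  · exact Set.Nonempty.image _ ⟨0, by norm_num, by norm_num⟩
  rintro _ ⟨α, hα, rfl⟩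
  have hα2 : α ^ 2 ≤ 1 := by nlinarith [hα.1, hα.2]
  have e2 : √(2 * (1 - α ^ 2)) = √2 * √(1 - α ^ 2) := Real.sqrt_mul (by norm_num) _
  have hs1 : √(1 - α ^ 2) ≤ 1 := by apply Real.sqrt_le_one.2; nlinarith
  have hw : √(2:ℝ) ≤ 2 := by apply Real.sqrt_le_iff.2; norm_num
  have hs2 : √2 * √(1 - α ^ 2) ≤ 2 := by
    nlinarith [Real.sqrt_nonneg (2:ℝ), Real.sqrt_nonneg (1 - α ^ 2)]
  have hub : ∀ y ∈ {y : ℝ | ∃ σ : Fin n → ℝ, ∑ i, σ i ^ 2 = 1 ∧ σ ⬝ᵥ v = α ∧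
              y = ∑ i, l i * σ i ^ 2}, y ≤ √2 * √(1 - α ^ 2) + 3 * ε := by
    rintro y ⟨σ, h1, h2, rfl⟩
    have := hU σ
    rw [hqf, h1, h2] at this
    simp only [mul_one, Real.sqrt_one, one_mul] at this
    have h3 : q * ∑ i, l i * σ i ^ 2 ≤ q * (δ + √2 * (1 + δ) * √(1 - α ^ 2)) := by
      refine this.trans (le_of_eq (by ring))
    have h4 := le_of_mul_le_mul_left h3 hq
    nlinarith [mul_le_mul_of_nonneg_left hs2 hδ]
  obtain ⟨σ, h1, h2, h3⟩ := hL α hα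
  rw [hqf] at h3
  have h4 := le_of_mul_le_mul_left h3 hq
  have hmem : (∑ i, l i * σ i ^ 2) ∈ {y : ℝ | ∃ σ : Fin n → ℝ, ∑ i, σ i ^ 2 = 1 ∧ σ ⬝ᵥ v = α ∧
              y = ∑ i, l i * σ i ^ 2} := ⟨σ, h1, h2, rfl⟩
  have u1 := csSup_le ⟨_, hmem⟩ hub
  have u2 := le_csSup ⟨_, hub⟩ hmem
  simp only [e2]
  rw [abs_le]
  constructor <;> linarith

end GOEaux

/-- Proposition: uniform convergence of the constrained maximum:
`sup_{α ∈ [-1,1]} | sup_{|σ|=1, σ·u=α} Σ λ_i σ_i² − √(2(1-α²)) | → 0` in probability. -/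
theorem stmt_3
    (Ω : ℕ → Type*) [∀ N, MeasurableSpace (Ω N)]
    (P : ∀ N, Measure (Ω N)) (hP : ∀ N, IsProbabilityMeasure (P N))
    (J : ∀ N, Ω N → Matrix (Fin N) (Fin N) ℝ)
    (hJ : ∀ N, 1 ≤ N → IsGOE (P N) (J N))
    -- λ_1 ≤ … ≤ λ_N are the eigenvalues of J/√N
    (lam : ∀ N, Ω N → Fin N → ℝ)
    (hlam_mono : ∀ N ω, Monotone (lam N ω))
    (hlam_eig : ∀ N : ℕ, 1 ≤ N → ∀ ω,
      ((Real.sqrt (N : ℝ))⁻¹ • J N ω).charpoly.roots = Finset.univ.val.map (lam N ω))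
    -- u is uniform on the sphere and independent of the eigenvalues
    (u : ∀ N, Ω N → Fin N → ℝ)
    (hu : ∀ N, 1 ≤ N → IsUniformOnSphere (P N) (u N))
    (hindep : ∀ N, 1 ≤ N → IndepFun (lam N) (u N) (P N)) :
    ∀ ε > 0, Tendsto
      (fun N => P N {ω | ε ≤
        sSup ((fun α =>
          |sSup {y : ℝ | ∃ σ : Fin N → ℝ, ∑ i, σ i ^ 2 = 1 ∧ σ ⬝ᵥ u N ω = α ∧
              y = ∑ i, lam N ω i * σ i ^ 2} -
            Real.sqrt (2 * (1 - α ^ 2))|) '' Set.Icc (-1 : ℝ) 1)})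
      atTop (nhds 0) := by
  intro ε hε
  obtain ⟨δ, hδ0, hδε, p, hp, hev⟩ := GOEaux.main_prob (ε / 4) (by positivity)
  refine tendsto_of_tendsto_of_tendsto_of_le_of_le' tendsto_const_nhds hp
    (Eventually.of_forall fun _ => zero_le) ?_
  filter_upwards [hev, eventually_ge_atTop 1] with N hN hN1
  have := hP N
  have hG := hJ N hN1
  have hq : 0 < Real.sqrt (N : ℝ) := Real.sqrt_pos.2 (by exact_mod_cast hN1)
  have hlm : Measurable (lam N) := GOEaux.lam_meas ((Real.sqrt (N : ℝ))⁻¹) (J N) hG.1 hG.2.1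
    (lam N) (hlam_mono N) (hlam_eig N hN1)
  have hms : MeasurableSet {p : (Fin N → Fin N → ℝ) × (Fin N → ℝ) |
      GOEaux.Uc (δ * Real.sqrt N) (Real.sqrt N * Real.sqrt 2 * (1 + δ)) (Matrix.of p.1) p.2 ∧
      GOEaux.Lc (fun α => Real.sqrt N * (Real.sqrt 2 * Real.sqrt (1 - α ^ 2) - ε / 4))
        (Matrix.of p.1) p.2} := by
    have h1 := (GOEaux.Uc_closed N (δ * Real.sqrt N)
      (Real.sqrt N * Real.sqrt 2 * (1 + δ))).measurableSet
    have h2 := (GOEaux.Lc_closed N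
      (fun α => Real.sqrt N * (Real.sqrt 2 * Real.sqrt (1 - α ^ 2) - ε / 4))).measurableSet
    exact h1.inter h2
  have key := GOEaux.transfer (P := P N)
    (fun M v => GOEaux.Uc (δ * Real.sqrt N) (Real.sqrt N * Real.sqrt 2 * (1 + δ)) M v ∧
      GOEaux.Lc (fun α => Real.sqrt N * (Real.sqrt 2 * Real.sqrt (1 - α ^ 2) - ε / 4)) M v)
    hms
    (fun O hO M v h => ⟨GOEaux.Uc_conj _ _ O hO M v h.1, GOEaux.Lc_conj _ O hO M v h.2⟩)
    (J N) hG.2.1 (p N) (fun v hv => hN (Ω N) (P N) (J N) hG v hv)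
    (Real.sqrt N) (lam N) hlm (u N) (hu N hN1) (hindep N hN1) (fun ω => by
      obtain ⟨O, h1, h2, h3⟩ := GOEaux.lam_decomp _ ((hG.1 ω).smul _) (lam N ω) (hlam_mono N ω)
        (hlam_eig N hN1 ω)
      refine ⟨O, h1, h2, ?_⟩
      rw [Matrix.mul_smul, Matrix.smul_mul, ← h3, smul_smul, mul_inv_cancel₀ hq.ne', one_smul])
  refine (measure_mono ?_).trans key
  intro ω hω hc
  have := GOEaux.conclude (Real.sqrt N) δ (ε / 4) hq hδ0.le hδε (lam N ω) (u N ω) hc.1 hc.2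
  have h2 : ε ≤ 3 * (ε / 4) := le_trans hω this
  linarith
end

section
/- Let N ≥ 1, let λ_1 < λ_2 < … < λ_N be real numbers and let u_1, …, u_N ∈ ℝ with u_i² ∈ (0,1) for all i and Σ_{i=1}^N u_i² = 1. Define s_{λ,u}(l) = Σ_{i=1}^N u_i²/(l − λ_i) for l > λ_N. Then sup_{α ∈ [-1,1]} | sup_{σ ∈ ℝ^N, |σ|=1, σ·u = α} Σ_{i=1}^N λ_i σ_i² − inf_{l > λ_N} { l − α²/s_{λ,u}(l) } | ≤ 2 (λ_N − λ_1) u_N² / √(1 − u_N²). -/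
open Matrix

theorem aux_weak (n : ℕ) (lam u σ : Fin n → ℝ) (l α : ℝ) (hl : ∀ i, lam i < l)
    (h1 : ∑ i, σ i ^ 2 = 1) (h2 : σ ⬝ᵥ u = α) (hs : 0 < ∑ i, u i ^ 2 / (l - lam i)) :
    ∑ i, lam i * σ i ^ 2 ≤ l - α ^ 2 / ∑ i, u i ^ 2 / (l - lam i) := by
  have hcs : (∑ i, σ i * u i) ^ 2 ≤
      (∑ i, (l - lam i) * σ i ^ 2) * ∑ i, u i ^ 2 / (l - lam i) := by
    apply Finset.sum_sq_le_sum_mul_sum_of_sq_eq_mul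
    · intro i _
      exact mul_nonneg (sub_nonneg.2 (hl i).le) (sq_nonneg _)
    · intro i _
      exact div_nonneg (sq_nonneg _) (sub_nonneg.2 (hl i).le)
    · intro i _
      have : l - lam i ≠ 0 := (sub_pos.2 (hl i)).ne'
      field_simp
  have e : ∑ i, (l - lam i) * σ i ^ 2 = l - ∑ i, lam i * σ i ^ 2 := by
    simp only [sub_mul, Finset.sum_sub_distrib, ← Finset.mul_sum, h1, mul_one]
  have h2' : ∑ i, σ i * u i = α := h2
  rw [h2', e, ← div_le_iff₀ hs] at hcs
  linarith

theorem stmt_5 (N : ℕ) (lam : Fin (N + 1) → ℝ) (hlam : StrictMono lam)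
    (u : Fin (N + 1) → ℝ) (hu1 : ∀ i, u i ^ 2 ∈ Set.Ioo (0 : ℝ) 1)
    (hu2 : ∑ i, u i ^ 2 = 1) :
    ∀ α ∈ Set.Icc (-1 : ℝ) 1,
      |sSup {y : ℝ | ∃ σ : Fin (N + 1) → ℝ, ∑ i, σ i ^ 2 = 1 ∧ σ ⬝ᵥ u = α ∧
            y = ∑ i, lam i * σ i ^ 2} -
          sInf {y : ℝ | ∃ l : ℝ, lam (Fin.last N) < l ∧
            y = l - α ^ 2 / ∑ i, u i ^ 2 / (l - lam i)}| ≤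
        2 * (lam (Fin.last N) - lam 0) * u (Fin.last N) ^ 2 /
          Real.sqrt (1 - u (Fin.last N) ^ 2) := by
  intro α hα
  obtain ⟨hp0, hp1⟩ := hu1 (Fin.last N)
  set L := lam (Fin.last N) with hL
  set p := u (Fin.last N) ^ 2 with hp
  set B := 2 * (L - lam 0) * p / Real.sqrt (1 - p) with hB
  set S := {y : ℝ | ∃ σ : Fin (N + 1) → ℝ, ∑ i, σ i ^ 2 = 1 ∧ σ ⬝ᵥ u = α ∧
            y = ∑ i, lam i * σ i ^ 2} with hS
  set I := {y : ℝ | ∃ l : ℝ, L < l ∧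
            y = l - α ^ 2 / ∑ i, u i ^ 2 / (l - lam i)} with hI
  have hle : ∀ i, lam i ≤ L := fun i => hlam.monotone (Fin.le_last i)
  have hα2 : α ^ 2 ≤ 1 := by nlinarith [hα.1, hα.2]
  have hspos : ∀ l, L < l → 0 < ∑ i, u i ^ 2 / (l - lam i) := by
    intro l hl
    apply Finset.sum_pos
    · intro i _
      exact div_pos (hu1 i).1 (by linarith [hle i])
    · exact ⟨0, Finset.mem_univ _⟩
  have hweak : ∀ y ∈ S, ∀ z ∈ I, y ≤ z := by
    rintro y ⟨σ, h1, h2, rfl⟩ z ⟨l, hl, rfl⟩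
    exact aux_weak _ lam u σ l α (fun i => (hle i).trans_lt hl) h1 h2 (hspos l hl)
  have hIne : I.Nonempty := ⟨_, L + 1, by linarith, rfl⟩
  have hq0 : 0 < Real.sqrt (1 - p) := Real.sqrt_pos.2 (by linarith)
  have hqsq : Real.sqrt (1 - p) ^ 2 = 1 - p := Real.sq_sqrt (by linarith)
  have hq1 : Real.sqrt (1 - p) ≤ 1 := by nlinarith
  have hB2 : 2 * (L - lam 0) * p ≤ B := by
    rw [hB, le_div_iff₀ hq0]
    have : 0 ≤ 2 * (L - lam 0) * p := by
      have := hle 0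
      have : 0 ≤ L - lam 0 := by linarith
      positivity
    nlinarith
  have hB0 : 0 ≤ B := by
    refine le_trans ?_ hB2
    have := hle 0
    have : 0 ≤ L - lam 0 := by linarith
    positivity
  suffices H : ∃ y ∈ S, sInf I ≤ y + B by
    obtain ⟨y, hy, hyB⟩ := H
    have hbdd : BddAbove S := by
      obtain ⟨z, hz⟩ := hIne
      exact ⟨z, fun y hy => hweak y hy z hz⟩
    have h1 : y ≤ sSup S := le_csSup hbdd hy
    have h2 : sSup S ≤ sInf I :=
      csSup_le ⟨y, hy⟩ fun y hy => le_csInf hIne fun z hz => hweak y hy z hz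
    rw [abs_le]; constructor <;> linarith
  have hInf : ∀ y ∈ S, ∀ z ∈ I, sInf I ≤ z := fun y hy z hz =>
    csInf_le ⟨y, fun z hz => hweak y hy z hz⟩ hz
  -- reparametrisation
  have hd : ∀ i, 0 ≤ L - lam i := fun i => sub_nonneg.2 (hle i)
  have hden : ∀ x : ℝ, 0 ≤ x → ∀ i, 0 < 1 + x * (L - lam i) := by
    intro x hx i
    have := mul_nonneg hx (hd i)
    linarith
  have hsx : ∀ x : ℝ, 0 < x → ∀ i, 1 / (L + 1 / x - lam i) = x * (1 / (1 + x * (L - lam i))) := by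
    intro x hx i
    have h1 := hden x hx.le i
    have h2 : L + 1 / x - lam i = (1 + x * (L - lam i)) / x := by
      field_simp; ring
    rw [h2]; field_simp
  have hcont : ∀ i, ContinuousOn (fun x : ℝ => 1 / (1 + x * (L - lam i))) (Set.Ici 0) := by
    intro i
    apply ContinuousOn.div
    · fun_prop
    · fun_prop
    · intro x hx
      exact (hden x hx i).ne'
  rcases le_or_gt (α ^ 2) p with hsmall | hbig
  · -- small α
    set q := Real.sqrt (1 - p) with hq
    obtain ⟨r, hr2, hrs⟩ : ∃ r : ℝ, r ^ 2 = 1 - α ^ 2 ∧ 0 ≤ r * α * u (Fin.last N) := by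
      have hs := Real.sq_sqrt (show 0 ≤ 1 - α ^ 2 by linarith)
      have hs0 := Real.sqrt_nonneg (1 - α ^ 2)
      rcases le_total 0 (α * u (Fin.last N)) with h | h
      · exact ⟨_, hs, by rw [mul_assoc]; positivity⟩
      · refine ⟨-Real.sqrt (1 - α ^ 2), by rw [neg_sq, hs], ?_⟩
        rw [mul_assoc]; nlinarith
    set v := u (Fin.last N) with hv
    set X := α * v + r * q with hX
    set Y := α * q - r * v with hY
    have hXY : X ^ 2 + Y ^ 2 = 1 := by
      have : X ^ 2 + Y ^ 2 = (α ^ 2 + r ^ 2) * (p + q ^ 2) := by rw [hX, hY, hp]; ring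
      rw [this, hr2, hqsq]; ring
    have hXv : X * v + Y * q = α := by
      have : X * v + Y * q = α * (p + q ^ 2) := by rw [hX, hY, hp]; ring
      rw [this, hqsq]; ring
    have hY2 : Y ^ 2 ≤ 2 * p := by
      have : Y ^ 2 = α ^ 2 * q ^ 2 + r ^ 2 * p - 2 * q * (r * α * v) := by rw [hY, hp]; ring
      rw [this, hqsq, hr2]
      have := mul_nonneg hq0.le hrs
      nlinarith [sq_nonneg α]
    have hsum' : ∑ i : Fin N, u i.castSucc ^ 2 = q ^ 2 := by
      rw [Fin.sum_univ_castSucc] at hu2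
      rw [hqsq]; linarith
    set σ : Fin (N + 1) → ℝ := Fin.lastCases X (fun i => Y / q * u i.castSucc) with hσ
    have hσl : σ (Fin.last N) = X := by simp [hσ]
    have hσc : ∀ i : Fin N, σ i.castSucc = Y / q * u i.castSucc := by intro i; simp [hσ]
    have hσ1 : ∑ i, σ i ^ 2 = 1 := by
      rw [Fin.sum_univ_castSucc, hσl]
      simp only [hσc, mul_pow, ← Finset.mul_sum, hsum']
      rw [← hXY]; field_simp; ring
    have hσ2 : σ ⬝ᵥ u = α := by
      rw [dotProduct, Fin.sum_univ_castSucc, hσl]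
      have : ∀ i : Fin N, σ i.castSucc * u i.castSucc = Y / q * u i.castSucc ^ 2 := by
        intro i; rw [hσc]; ring
      simp only [this, ← Finset.mul_sum, hsum']
      rw [← hXv]; field_simp; ring
    have hmem : ∑ i, lam i * σ i ^ 2 ∈ S := ⟨σ, hσ1, hσ2, rfl⟩
    refine ⟨_, hmem, ?_⟩
    have hval : L - (L - lam 0) * Y ^ 2 ≤ ∑ i, lam i * σ i ^ 2 := by
      have hY2' : ∑ i : Fin N, σ i.castSucc ^ 2 = Y ^ 2 := by
        simp only [hσc, mul_pow, ← Finset.mul_sum, hsum']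
        field_simp
      have h3 : lam 0 * Y ^ 2 ≤ ∑ i : Fin N, lam i.castSucc * σ i.castSucc ^ 2 := by
        rw [← hY2', Finset.mul_sum]
        apply Finset.sum_le_sum
        intro i _
        exact mul_le_mul_of_nonneg_right (hlam.monotone (Fin.zero_le _)) (sq_nonneg _)
      rw [Fin.sum_univ_castSucc, hσl, ← hL]
      have : X ^ 2 = 1 - Y ^ 2 := by linarith
      rw [this]; linarith
    have hinfL : sInf I ≤ L := by
      apply le_of_forall_pos_le_add
      intro ε hε
      have := hInf _ hmem _ ⟨L + ε, by linarith, rfl⟩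
      refine this.trans ?_
      have := hspos (L + ε) (by linarith)
      have : 0 ≤ α ^ 2 / ∑ i, u i ^ 2 / (L + ε - lam i) := by positivity
      linarith
    have := mul_le_mul_of_nonneg_left hY2 (hd 0)
    linarith
  · rcases hα2.lt_or_eq with hlt | heq
    · -- interior critical point
      set G : ℝ → ℝ := fun x => (∑ i, u i ^ 2 * (1 / (1 + x * (L - lam i)))) ^ 2 -
        α ^ 2 * ∑ i, u i ^ 2 * (1 / (1 + x * (L - lam i))) ^ 2 with hG
      have hG0 : 0 < G 0 := by
        simp [hG, hu2]; exact (sq_lt_one_iff_abs_lt_one α).1 hlt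
      have hGc : ContinuousOn G (Set.Ici 0) := by
        apply ContinuousOn.sub
        · exact (continuousOn_finset_sum _ fun i _ => continuousOn_const.mul (hcont i)).pow 2
        · exact continuousOn_const.mul
            (continuousOn_finset_sum _ fun i _ => continuousOn_const.mul ((hcont i).pow 2))
      have hlim : ∀ i, Filter.Tendsto (fun x : ℝ => 1 / (1 + x * (L - lam i))) Filter.atTop
          (nhds (if i = Fin.last N then 1 else 0)) := by
        intro i
        split_ifs with h
        · subst h
          simp [← hL]
        · have hpos : 0 < L - lam i := sub_pos.2 (hlam (Fin.lt_last_iff_ne_last.2 h))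
          simp only [one_div]
          apply Filter.Tendsto.inv_tendsto_atTop
          exact Filter.tendsto_atTop_add_const_left _ _
            (Filter.tendsto_id.atTop_mul_const hpos)
      have hGlim : Filter.Tendsto G Filter.atTop (nhds (p ^ 2 - α ^ 2 * p)) := by
        have h1 := tendsto_finset_sum Finset.univ
          (fun i _ => (hlim i).const_mul (u i ^ 2))
        have h2 := tendsto_finset_sum Finset.univ
          (fun i _ => ((hlim i).pow 2).const_mul (u i ^ 2))
        have h3 := (h1.pow 2).sub (h2.const_mul (α ^ 2))
        simpa [ite_pow, hG, hp] using h3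
      have hneg : p ^ 2 - α ^ 2 * p < 0 := by nlinarith
      obtain ⟨x1, hx1n, hx1⟩ :=
        ((hGlim.eventually (gt_mem_nhds hneg)).and (Filter.eventually_gt_atTop 0)).exists
      obtain ⟨x, hx, hGx⟩ := intermediate_value_Icc' hx1.le
        (hGc.mono Set.Icc_subset_Ici_self) (show (0:ℝ) ∈ Set.Icc (G x1) (G 0) from ⟨hx1n.le, hG0.le⟩)
      have hx0 : 0 < x := by
        rcases hx.1.lt_or_eq with h | h
        · exact h
        · rw [← h] at hGx; linarith
      set l := L + 1 / x with hl
      have hlL : L < l := by have : 0 < 1 / x := by positivity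
                             linarith
      set s := ∑ i, u i ^ 2 / (l - lam i) with hs
      have hs0 : 0 < s := hspos l hlL
      have hne : ∀ i, l - lam i ≠ 0 := fun i => by linarith [hle i] |> fun (h : 0 < l - lam i) => h.ne'
      have hsE : s = x * ∑ i, u i ^ 2 * (1 / (1 + x * (L - lam i))) := by
        rw [hs, Finset.mul_sum]
        refine Finset.sum_congr rfl fun i _ => ?_
        rw [div_eq_mul_one_div, hsx x hx0 i]; ring
      have hs2E : ∑ i, u i ^ 2 * (1 / (l - lam i)) ^ 2 =
          x ^ 2 * ∑ i, u i ^ 2 * (1 / (1 + x * (L - lam i))) ^ 2 := by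
        rw [Finset.mul_sum]
        refine Finset.sum_congr rfl fun i _ => ?_
        rw [hsx x hx0 i]; ring
      have hcrit : α ^ 2 * ∑ i, u i ^ 2 * (1 / (l - lam i)) ^ 2 = s ^ 2 := by
        rw [hs2E, hsE]
        have : G x = 0 := hGx
        simp only [hG] at this
        linear_combination (-x ^ 2) * this
      set σ : Fin (N + 1) → ℝ := fun i => α / s * (u i / (l - lam i)) with hσ
      have hσ1 : ∑ i, σ i ^ 2 = 1 := by
        have : ∀ i, σ i ^ 2 = (α / s) ^ 2 * (u i ^ 2 * (1 / (l - lam i)) ^ 2) := by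
          intro i; simp only [hσ]; ring
        simp only [this, ← Finset.mul_sum]
        rw [div_pow, div_mul_eq_mul_div, hcrit]
        exact div_self (by positivity)
      have hσ2 : σ ⬝ᵥ u = α := by
        have : ∀ i, σ i * u i = (α / s) * (u i ^ 2 / (l - lam i)) := by
          intro i; simp only [hσ]; ring
        simp only [dotProduct, this, ← Finset.mul_sum]
        rw [← hs]; field_simp
      have hmem : ∑ i, lam i * σ i ^ 2 ∈ S := ⟨σ, hσ1, hσ2, rfl⟩
      refine ⟨_, hmem, ?_⟩
      have hv : ∑ i, lam i * σ i ^ 2 = l - α ^ 2 / s := by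
        have h1 : ∀ i, lam i * σ i ^ 2 = l * σ i ^ 2 - (α / s) ^ 2 * (u i ^ 2 / (l - lam i)) := by
          intro i; simp only [hσ]
          have := hne i
          field_simp; ring
        simp only [h1, Finset.sum_sub_distrib, ← Finset.mul_sum, hσ1]
        rw [← hs]; field_simp
      have := hInf _ hmem _ ⟨l, hlL, rfl⟩
      rw [hv]; linarith
    · -- α² = 1
      have hmem : ∑ i, lam i * (α * u i) ^ 2 ∈ S := by
        refine ⟨fun i => α * u i, ?_, ?_, rfl⟩
        · simp only [mul_pow, heq, one_mul, hu2]
        · have : ∀ i, α * u i * u i = α * u i ^ 2 := by intro i; ring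
          simp only [dotProduct, this, ← Finset.mul_sum, hu2, mul_one]
      refine ⟨_, hmem, ?_⟩
      set R : ℝ → ℝ := fun x => ∑ i, u i ^ 2 * (1 / (1 + x * (L - lam i))) with hR
      set D : ℝ → ℝ := fun x => ∑ i, u i ^ 2 * (L - lam i) * (1 / (1 + x * (L - lam i))) with hD
      have hRc : ContinuousOn R (Set.Ici 0) :=
        continuousOn_finset_sum _ fun i _ => continuousOn_const.mul (hcont i)
      have hDc : ContinuousOn D (Set.Ici 0) :=
        continuousOn_finset_sum _ fun i _ => continuousOn_const.mul (hcont i)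
      have hRpos : ∀ x, 0 ≤ x → 0 < R x := by
        intro x hx
        apply Finset.sum_pos
        · intro i _
          have := hden x hx i
          have := (hu1 i).1
          positivity
        · exact ⟨0, Finset.mem_univ _⟩
      have hFc : ContinuousOn (fun x => L - D x / R x) (Set.Ici 0) :=
        continuousOn_const.sub (hDc.div hRc fun x hx => (hRpos x hx).ne')
      have hF : ∀ x, 0 < x → sInf I ≤ L - D x / R x := by
        intro x hx
        have hlL : L < L + 1 / x := by
          have : 0 < 1 / x := by positivity
          linarith
        have h := hInf _ hmem _ ⟨L + 1 / x, hlL, rfl⟩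
        have hsE : ∑ i, u i ^ 2 / (L + 1 / x - lam i) = x * R x := by
          rw [hR, Finset.mul_sum]
          refine Finset.sum_congr rfl fun i _ => ?_
          rw [div_eq_mul_one_div, hsx x hx i]; ring
        have hRD : R x + x * D x = 1 := by
          rw [← hu2, hR, hD, Finset.mul_sum, ← Finset.sum_add_distrib]
          refine Finset.sum_congr rfl fun i _ => ?_
          have := (hden x hx.le i).ne'
          field_simp
        rw [hsE, heq] at h
        have hRp := (hRpos x hx.le).ne'
        have e : L + 1 / x - 1 / (x * R x) = L - D x / R x := by
          field_simp
          linear_combination hRD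
        rw [e] at h; exact h
      have ht : Filter.Tendsto (fun x => L - D x / R x) (nhdsWithin 0 (Set.Ioi 0))
          (nhds (L - D 0 / R 0)) :=
        (hFc 0 Set.self_mem_Ici).mono_left (nhdsWithin_mono _ Set.Ioi_subset_Ici_self)
      have hfin := ge_of_tendsto ht
        (Filter.eventually_of_mem self_mem_nhdsWithin fun x hx => hF x hx)
      have hR0 : R 0 = 1 := by simp [hR, hu2]
      have hD0 : D 0 = L - ∑ i, lam i * (α * u i) ^ 2 := by
        have : ∀ i, u i ^ 2 * (L - lam i) = L * u i ^ 2 - lam i * u i ^ 2 := by intro i; ring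
        simp [hD, mul_pow, heq, this, ← Finset.mul_sum, hu2]
      rw [hR0, hD0] at hfin
      linarith
end

section
/- Let λ ∈ ℝ and let μ be a finite nonzero measure on ℝ whose support is contained in (-∞, λ]. Define s_μ(l) = ∫ 1/(l − x) dμ(x) for l > λ. Then the map l ↦ −1/s_μ(l) is convex on (λ, ∞). If moreover the support of μ is not a single point, then this map is strictly convex on (λ, ∞). -/
open MeasureTheory

lemma aux_ae {lam : ℝ} {μ : Measure ℝ} (hsupp : μ (Set.Ioi lam) = 0) : ∀ᵐ x ∂μ, x ≤ lam := by
  rw [ae_iff]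
  convert hsupp using 2
  ext x; simp

lemma aux_int {lam : ℝ} {μ : Measure ℝ} [IsFiniteMeasure μ]
    (hsupp : μ (Set.Ioi lam) = 0) {l : ℝ} (hl : lam < l) :
    Integrable (fun x => (l - x)⁻¹) μ := by
  refine Integrable.of_bound (C := (l - lam)⁻¹) ?_ ?_
  · exact (Measurable.inv (measurable_const.sub measurable_id)).aestronglyMeasurable
  · filter_upwards [aux_ae hsupp] with x hx
    have h1 : 0 < l - lam := by linarith
    have h2 : 0 < l - x := by linarith
    rw [Real.norm_of_nonneg (by positivity)]
    gcongr

lemma aux_pos {lam : ℝ} {μ : Measure ℝ} [IsFiniteMeasure μ] (hμ : μ ≠ 0)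
    (hsupp : μ (Set.Ioi lam) = 0) {l : ℝ} (hl : lam < l) :
    0 < ∫ x, (l - x)⁻¹ ∂μ := by
  have h0 : 0 ≤ᵐ[μ] fun x => (l - x)⁻¹ := by
    filter_upwards [aux_ae hsupp] with x hx
    have h2 : 0 < l - x := by linarith
    simp only [Pi.zero_apply]
    positivity
  refine lt_of_le_of_ne (integral_nonneg_of_ae h0) fun h => hμ ?_
  have h3 := (integral_eq_zero_iff_of_nonneg_ae h0 (aux_int hsupp hl)).1 h.symm
  have h4 : ∀ᵐ x ∂μ, False := by
    filter_upwards [aux_ae hsupp, h3] with x hx hx'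
    have h2 : 0 < l - x := by linarith
    have : 0 < (l - x)⁻¹ := by positivity
    simp only [Pi.zero_apply] at hx'
    linarith
  simpa using h4

lemma aux_main {lam : ℝ} {μ : Measure ℝ} [IsFiniteMeasure μ] (hμ : μ ≠ 0)
    (hsupp : μ (Set.Ioi lam) = 0) {s : ℝ → ℝ} (hs : ∀ l, s l = ∫ x, (l - x)⁻¹ ∂μ)
    {p q a b : ℝ} (hp : lam < p) (hq : lam < q) (ha : 0 ≤ a) (hb : 0 ≤ b) (hab : a + b = 1) :
    a * (s p)⁻¹ + b * (s q)⁻¹ ≤ (s (a * p + b * q))⁻¹ ∧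
    (0 < a → 0 < b → p ≠ q → (∀ x : ℝ, μ {x}ᶜ ≠ 0) →
      a * (s p)⁻¹ + b * (s q)⁻¹ ≠ (s (a * p + b * q))⁻¹) := by
  set c := a * p + b * q with hc
  have hcl : lam < c := by
    have := (convex_Ioi lam) (Set.mem_Ioi.2 hp) (Set.mem_Ioi.2 hq) ha hb hab
    simpa using this
  have Sp : 0 < s p := by rw [hs]; exact aux_pos hμ hsupp hp
  have Sq : 0 < s q := by rw [hs]; exact aux_pos hμ hsupp hq
  have Sc : 0 < s c := by rw [hs]; exact aux_pos hμ hsupp hcl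
  have Ip := aux_int hsupp hp
  have Iq := aux_int hsupp hq
  have Ic := aux_int hsupp hcl
  set A : ℝ := ((s c)⁻¹)^2 - 2 * a * (s c)⁻¹ * (s p)⁻¹ - 2 * b * (s c)⁻¹ * (s q)⁻¹ with hA
  set F : ℝ → ℝ := fun x => A * (c - x)⁻¹ + a * ((s p)⁻¹)^2 * (p - x)⁻¹
      + b * ((s q)⁻¹)^2 * (q - x)⁻¹ with hF
  have IF : Integrable F μ := ((Ic.const_mul _).add (Ip.const_mul _)).add (Iq.const_mul _)
  have hint : ∫ x, F x ∂μ = (s c)⁻¹ - (a * (s p)⁻¹ + b * (s q)⁻¹) := by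
    simp only [hF]
    have I2 : Integrable (fun x => A * (c - x)⁻¹ + a * ((s p)⁻¹)^2 * (p - x)⁻¹) μ :=
      (Ic.const_mul _).add (Ip.const_mul _)
    rw [integral_add I2 (Iq.const_mul _),
      integral_add (Ic.const_mul _) (Ip.const_mul _), integral_const_mul, integral_const_mul,
      integral_const_mul, ← hs, ← hs, ← hs, hA]
    field_simp
    ring
  have hFeq : ∀ x ≤ lam, F x = a * (p - x) * ((s c)⁻¹ * (c - x)⁻¹ - (s p)⁻¹ * (p - x)⁻¹)^2
      + b * (q - x) * ((s c)⁻¹ * (c - x)⁻¹ - (s q)⁻¹ * (q - x)⁻¹)^2 := by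
    intro x hx
    have h1 : p - x ≠ 0 := by linarith
    have h2 : q - x ≠ 0 := by linarith
    have h3 : c - x ≠ 0 := by linarith
    have e1 : (p - x) * (p - x)⁻¹ = 1 := mul_inv_cancel₀ h1
    have e2 : (q - x) * (q - x)⁻¹ = 1 := mul_inv_cancel₀ h2
    have e3 : (a * (p - x) + b * (q - x)) * (c - x)⁻¹ = 1 := by
      rw [← mul_inv_cancel₀ h3]; congr 1; rw [hc]; linear_combination (-x) * hab
    simp only [hF, hA]
    generalize (p - x)⁻¹ = u at *
    generalize (q - x)⁻¹ = v at *
    generalize (c - x)⁻¹ = w at *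
    generalize (s p)⁻¹ = t at *
    generalize (s q)⁻¹ = r at *
    generalize (s c)⁻¹ = k at *
    linear_combination (-k^2*w) * e3 + (2*a*k*w*t - a*t^2*u) * e1 + (2*b*k*w*r - b*r^2*v) * e2
  have hF0 : 0 ≤ᵐ[μ] F := by
    filter_upwards [aux_ae hsupp] with x hx
    have h1 : 0 < p - x := by linarith
    have h2 : 0 < q - x := by linarith
    simp only [Pi.zero_apply]
    rw [hFeq x hx]
    positivity
  refine ⟨by have := integral_nonneg_of_ae hF0; linarith, ?_⟩
  intro ha' hb' hpq hns heq
  have hz : ∫ x, F x ∂μ = 0 := by rw [hint, heq]; ring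
  have h3 := (integral_eq_zero_iff_of_nonneg_ae hF0 IF).1 hz
  have hpc : p - c ≠ 0 := by
    have : p - c = b * (p - q) := by rw [hc]; linear_combination (-p) * hab
    rw [this]
    exact mul_ne_zero hb'.ne' (sub_ne_zero.2 hpq)
  apply hns ((s c * c - s p * p) / (s c - s p))
  rw [← mem_ae_iff]
  filter_upwards [aux_ae hsupp, h3] with x hx hx'
  have h1 : 0 < p - x := by linarith
  have h2 : 0 < q - x := by linarith
  have h4 : 0 < c - x := by linarith
  simp only [Pi.zero_apply] at hx'
  rw [hFeq x hx] at hx'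
  have g2 : 0 ≤ b * (q - x) * ((s c)⁻¹ * (c - x)⁻¹ - (s q)⁻¹ * (q - x)⁻¹)^2 := by positivity
  have g1 : 0 ≤ a * (p - x) * ((s c)⁻¹ * (c - x)⁻¹ - (s p)⁻¹ * (p - x)⁻¹)^2 := by positivity
  have g3 : a * (p - x) * ((s c)⁻¹ * (c - x)⁻¹ - (s p)⁻¹ * (p - x)⁻¹)^2 = 0 := by linarith
  have g4 : (s c)⁻¹ * (c - x)⁻¹ - (s p)⁻¹ * (p - x)⁻¹ = 0 := by
    have : a * (p - x) ≠ 0 := by positivity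
    simpa [this] using g3
  have g5 : s c * (c - x) = s p * (p - x) := by
    rw [← mul_inv, ← mul_inv, sub_eq_zero] at g4
    exact inv_injective g4
  have g6 : s c - s p ≠ 0 := by
    intro h
    have h5 : s c = s p := by linarith
    rw [h5] at g5
    have := mul_left_cancel₀ Sp.ne' g5
    apply hpc; linarith
  rw [Set.mem_singleton_iff, eq_div_iff g6]
  linarith

/-- Lemma: convexity of `l ↦ −1/s_μ(l)`.
The condition `μ (Set.Ioi lam) = 0` says that the support of `μ` is contained in `(-∞, lam]`,
and `∀ x, μ {x}ᶜ ≠ 0` says that the support of `μ` is not a single point. -/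
theorem stmt_6 (lam : ℝ) (μ : Measure ℝ) [IsFiniteMeasure μ] (hμ : μ ≠ 0)
    (hsupp : μ (Set.Ioi lam) = 0)
    (s : ℝ → ℝ) (hs : ∀ l, s l = ∫ x, (l - x)⁻¹ ∂μ) :
    ConvexOn ℝ (Set.Ioi lam) (fun l => -(s l)⁻¹) ∧
    ((∀ x : ℝ, μ {x}ᶜ ≠ 0) →
      StrictConvexOn ℝ (Set.Ioi lam) fun l => -(s l)⁻¹) := by
  refine ⟨⟨convex_Ioi lam, ?_⟩, fun hns => ⟨convex_Ioi lam, ?_⟩⟩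
  · intro p hp q hq a b ha hb hab
    have := (aux_main hμ hsupp hs hp hq ha hb hab).1
    simp only [smul_eq_mul]
    linarith
  · intro p hp q hq hpq a b ha hb hab
    have h := aux_main hμ hsupp hs hp hq ha.le hb.le hab
    have := lt_of_le_of_ne h.1 (h.2 ha hb hpq hns)
    simp only [smul_eq_mul]
    linarith
end

section
/- Let s(l) = l − √(l² − 2) for l > √2 (the Stieltjes transform of the semicircle law). Then for every α ∈ [-1,1], inf_{l > √2} { l − α²/s(l) } = √(2(1 − α²)). Moreover, if α ∈ (-1,1), the infimum (taken over the continuous extension to [√2, ∞)) is attained at the unique minimizer l̂(α) = (2 − α²)/√(2(1 − α²)), while for α = ±1 the infimum is attained in the limit l → ∞. -/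
open Filter

/-- Lemma: the limiting optimization problem.
Here `s l = l − √(l² − 2)` is the Stieltjes transform of the semicircle law and
`F l = l − α²/s l`. -/
theorem stmt_10 (s F : ℝ → ℝ) (hs : ∀ l, s l = l - Real.sqrt (l ^ 2 - 2))
    (α : ℝ) (hα : α ∈ Set.Icc (-1 : ℝ) 1)
    (hF : ∀ l, F l = l - α ^ 2 / s l) :
    sInf (F '' Set.Ioi (Real.sqrt 2)) = Real.sqrt (2 * (1 - α ^ 2)) ∧
    (α ∈ Set.Ioo (-1 : ℝ) 1 →
      IsMinOn F (Set.Ici (Real.sqrt 2)) ((2 - α ^ 2) / Real.sqrt (2 * (1 - α ^ 2))) ∧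
      ∀ l ∈ Set.Ici (Real.sqrt 2), IsMinOn F (Set.Ici (Real.sqrt 2)) l →
        l = (2 - α ^ 2) / Real.sqrt (2 * (1 - α ^ 2))) ∧
    ((α = 1 ∨ α = -1) → Tendsto F atTop (nhds (Real.sqrt (2 * (1 - α ^ 2))))) := by
  have h2 : 0 < Real.sqrt 2 := by positivity
  have h22 : Real.sqrt 2 ^ 2 = 2 := Real.sq_sqrt (by norm_num)
  have ha : α ^ 2 ≤ 1 := by nlinarith [hα.1, hα.2]
  have hc0 : 0 ≤ Real.sqrt (2 * (1 - α ^ 2)) := Real.sqrt_nonneg _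
  have hc2 : Real.sqrt (2 * (1 - α ^ 2)) ^ 2 = 2 * (1 - α ^ 2) :=
    Real.sq_sqrt (by linarith)
  have hcl : Real.sqrt (2 * (1 - α ^ 2)) ≤ Real.sqrt 2 :=
    Real.sqrt_le_sqrt (by nlinarith [sq_nonneg α])
  have hcpos : α ∈ Set.Ioo (-1 : ℝ) 1 → 0 < Real.sqrt (2 * (1 - α ^ 2)) := by
    intro h
    apply Real.sqrt_pos.2
    nlinarith [h.1, h.2]
  have hczero : (α = 1 ∨ α = -1) → Real.sqrt (2 * (1 - α ^ 2)) = 0 := by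
    rintro (h | h) <;> simp [h]
  generalize Real.sqrt (2 * (1 - α ^ 2)) = c at *
  have ha' : α ^ 2 = 1 - c ^ 2 / 2 := by linarith
  -- parametrization
  have back : ∀ t, Real.sqrt 2 ≤ t →
      F (t / 2 + 1 / t) = c + (c * t - 2) ^ 2 / (4 * t) := by
    intro t ht
    have htp : 0 < t := by linarith
    have hr : Real.sqrt ((t / 2 + 1 / t) ^ 2 - 2) = t / 2 - 1 / t := by
      have : (t / 2 + 1 / t) ^ 2 - 2 = (t / 2 - 1 / t) ^ 2 := by field_simp; ring
      rw [this, Real.sqrt_sq]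
      rw [sub_nonneg, div_le_div_iff₀ htp (by norm_num)]
      nlinarith
    rw [hF, hs, hr, ha']
    have : t / 2 + 1 / t - (t / 2 - 1 / t) = 2 / t := by ring
    rw [this]
    field_simp
    ring
  have fwd : ∀ l, Real.sqrt 2 ≤ l → ∃ t, l ≤ t ∧ l = t / 2 + 1 / t := by
    intro l hl
    have hr := Real.sqrt_nonneg (l ^ 2 - 2)
    have hr2 : Real.sqrt (l ^ 2 - 2) ^ 2 = l ^ 2 - 2 := Real.sq_sqrt (by nlinarith)
    refine ⟨l + Real.sqrt (l ^ 2 - 2), by linarith, ?_⟩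
    generalize Real.sqrt (l ^ 2 - 2) = r at *
    have : 0 < l + r := by linarith
    field_simp
    nlinarith
  have lb : ∀ l, Real.sqrt 2 ≤ l → c ≤ F l := by
    intro l hl
    obtain ⟨t, ht, rfl⟩ := fwd l hl
    have htp : 0 < t := by linarith
    rw [back t (hl.trans ht)]
    have : 0 ≤ (c * t - 2) ^ 2 / (4 * t) := by positivity
    linarith
  have gt : ∀ t, Real.sqrt 2 < t → Real.sqrt 2 < t / 2 + 1 / t := by
    intro t ht
    have htp : 0 < t := by linarith
    have : t / 2 + 1 / t - Real.sqrt 2 = (t - Real.sqrt 2) ^ 2 / (2 * t) := by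
      field_simp
      nlinarith
    have h3 : 0 < (t - Real.sqrt 2) ^ 2 / (2 * t) := by
      have : 0 < t - Real.sqrt 2 := by linarith
      positivity
    linarith
  refine ⟨?_, ?_, ?_⟩
  · apply IsGLB.csInf_eq _ ⟨_, Set.mem_image_of_mem F (show Real.sqrt 2 + 1 ∈ Set.Ioi _ by simp)⟩
    refine ⟨?_, ?_⟩
    · rintro _ ⟨l, hl, rfl⟩
      exact lb l (le_of_lt hl)
    · intro b hb
      have hb' : ∀ t, Real.sqrt 2 < t → b ≤ c + (c * t - 2) ^ 2 / (4 * t) := by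
        intro t ht
        rw [← back t ht.le]
        exact hb ⟨_, gt t ht, rfl⟩
      rcases hc0.eq_or_lt with h0 | h0
      · subst h0
        have ht : Tendsto (fun t : ℝ => t⁻¹) atTop (nhds 0) := tendsto_inv_atTop_zero
        refine ge_of_tendsto ht ?_
        filter_upwards [eventually_gt_atTop (Real.sqrt 2)] with t ht
        refine (hb' t ht).trans (le_of_eq ?_)
        have htp : 0 < t := by linarith
        field_simp
        ring
      · have hle : Real.sqrt 2 ≤ 2 / c := by
          rw [le_div_iff₀ h0]; nlinarith
        have hct : ContinuousAt (fun t : ℝ => c + (c * t - 2) ^ 2 / (4 * t)) (2 / c) := by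
          have : 4 * (2 / c) ≠ 0 := by positivity
          fun_prop (disch := assumption)
        have hlim : Tendsto (fun t : ℝ => c + (c * t - 2) ^ 2 / (4 * t))
            (nhdsWithin (2 / c) (Set.Ioi (2 / c))) (nhds c) := by
          have h := hct.tendsto.mono_left (nhdsWithin_le_nhds (s := Set.Ioi (2 / c)))
          have e : c + (c * (2 / c) - 2) ^ 2 / (4 * (2 / c)) = c := by
            field_simp
            ring
          rwa [e] at h
        refine ge_of_tendsto hlim ?_
        filter_upwards [self_mem_nhdsWithin] with t ht
        exact hb' t (lt_of_le_of_lt hle ht)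
  · intro hI
    have h0 := hcpos hI
    have hle : Real.sqrt 2 ≤ 2 / c := by
      rw [le_div_iff₀ h0]; nlinarith
    have el : (2 - α ^ 2) / c = (2 / c) / 2 + 1 / (2 / c) := by
      rw [ha']; field_simp; ring
    have hmin : F ((2 - α ^ 2) / c) = c := by
      rw [el, back _ hle]; field_simp; ring
    have hmem : Real.sqrt 2 ≤ (2 - α ^ 2) / c := by
      rw [ha', le_div_iff₀ h0]
      nlinarith [sq_nonneg (c - Real.sqrt 2)]
    refine ⟨?_, ?_⟩
    · intro l hl
      show F _ ≤ F l
      rw [hmin]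
      exact lb l hl
    · intro l hl hm
      have h1 : F l ≤ F ((2 - α ^ 2) / c) := hm hmem
      rw [hmin] at h1
      obtain ⟨t, ht, rfl⟩ := fwd l hl
      have hl' : Real.sqrt 2 ≤ t / 2 + 1 / t := hl
      have htp : 0 < t := by linarith
      rw [back t (hl'.trans ht)] at h1
      have h3 : (c * t - 2) ^ 2 / (4 * t) ≤ 0 := by linarith
      rw [div_le_iff₀ (by positivity), zero_mul] at h3
      have h4 : c * t - 2 = 0 := by
        have := sq_nonneg (c * t - 2)
        exact pow_eq_zero_iff (two_ne_zero) |>.1 (le_antisymm h3 this)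
      have h5 : t = 2 / c := by
        rw [eq_div_iff h0.ne']; linarith
      rw [el, h5]
  · intro h
    have h0 := hczero h
    subst h0
    refine tendsto_of_tendsto_of_tendsto_of_le_of_le' tendsto_const_nhds
      (tendsto_inv_atTop_zero (𝕜 := ℝ)) ?_ ?_
    · filter_upwards [eventually_ge_atTop (Real.sqrt 2)] with l hl
      exact lb l hl
    · filter_upwards [eventually_ge_atTop (Real.sqrt 2)] with l hl
      obtain ⟨t, ht, e⟩ := fwd l hl
      have hlp : 0 < l := by linarith
      have htp : 0 < t := by linarith
      have : F l = t⁻¹ := by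
        rw [e, back t (hl.trans ht)]
        field_simp
        ring
      rw [this]
      exact inv_anti₀ hlp ht
end

section
/- Let h > 0, β > 0, and define 𝓑(α) = h α² + β√(2(1 − α²)) for α ∈ [-1,1]. If β ≥ √2 h, then α = 0 is the unique local and global maximizer of 𝓑 on [-1,1]. If β < √2 h, then sup_{α ∈ [-1,1]} 𝓑(α) = h + β²/(2h), and the only local and global maximizers of 𝓑 are α = ±√(1 − β²/(2h²)). -/
theorem aux_B (h β : ℝ) (B : ℝ → ℝ)
    (hB : ∀ α, B α = h * α ^ 2 + β * Real.sqrt (2 * (1 - α ^ 2)))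
    (α s : ℝ) (hs : 0 ≤ s) (e : s ^ 2 = 1 - α ^ 2) :
    B α = h + β * Real.sqrt 2 * s - h * s ^ 2 := by
  rw [hB, ← e, Real.sqrt_mul (by norm_num), Real.sqrt_sq hs, e]
  ring

theorem aux_loc (h β : ℝ) (hh : 0 < h) (B : ℝ → ℝ)
    (hB : ∀ α, B α = h * α ^ 2 + β * Real.sqrt (2 * (1 - α ^ 2)))
    (α : ℝ) (hα : α ∈ Set.Icc (-1 : ℝ) 1) (hl : IsLocalMaxOn B (Set.Icc (-1) 1) α) :
    ∃ s : ℝ, 0 ≤ s ∧ s ≤ 1 ∧ s ^ 2 = 1 - α ^ 2 ∧ ∀ u ∈ Set.Icc (0 : ℝ) 1,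
      h + β * Real.sqrt 2 * u - h * u ^ 2 ≤ h + β * Real.sqrt 2 * s - h * s ^ 2 := by
  have h1 : 0 ≤ 1 - α ^ 2 := by nlinarith [hα.1, hα.2]
  have e : Real.sqrt (1 - α ^ 2) ^ 2 = 1 - α ^ 2 := Real.sq_sqrt h1
  have hs0 : 0 ≤ Real.sqrt (1 - α ^ 2) := Real.sqrt_nonneg _
  generalize Real.sqrt (1 - α ^ 2) = s at e hs0
  have hs1 : s ≤ 1 := by nlinarith [sq_nonneg α]
  refine ⟨s, hs0, hs1, e, ?_⟩
  obtain ⟨σ, hσ, hσα⟩ : ∃ σ : ℝ, σ ^ 2 = 1 ∧ σ * Real.sqrt (1 - s ^ 2) = α := by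
    have : 1 - s ^ 2 = α ^ 2 := by linarith
    rw [this, Real.sqrt_sq_eq_abs]
    rcases le_total 0 α with h0 | h0
    · exact ⟨1, by norm_num, by rw [abs_of_nonneg h0]; ring⟩
    · exact ⟨-1, by norm_num, by rw [abs_of_nonpos h0]; ring⟩
  have hsq : ∀ u ∈ Set.Icc (0 : ℝ) 1, (σ * Real.sqrt (1 - u ^ 2)) ^ 2 = 1 - u ^ 2 := by
    intro u hu
    rw [mul_pow, hσ, Real.sq_sqrt (by nlinarith [hu.1, hu.2]), one_mul]
  have hm : Set.MapsTo (fun u : ℝ => σ * Real.sqrt (1 - u ^ 2)) (Set.Icc 0 1)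
      (Set.Icc (-1) 1) := by
    intro u hu
    have := hsq u hu
    exact abs_le.mp ((sq_le_one_iff_abs_le_one _).mp (by nlinarith [sq_nonneg u]))
  have ht : Filter.Tendsto (fun u : ℝ => σ * Real.sqrt (1 - u ^ 2))
      (nhdsWithin s (Set.Icc 0 1)) (nhdsWithin α (Set.Icc (-1) 1)) := by
    have hc : Continuous (fun u : ℝ => σ * Real.sqrt (1 - u ^ 2)) := by fun_prop
    have := hc.continuousWithinAt.tendsto_nhdsWithin (x := s) hm
    simpa only [hσα] using this
  have hG : IsLocalMaxOn (fun u : ℝ => h + β * Real.sqrt 2 * u - h * u ^ 2)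
      (Set.Icc 0 1) s := by
    have h2 := ht.eventually hl
    filter_upwards [h2, self_mem_nhdsWithin] with u hu hu1
    rw [aux_B h β B hB _ u hu1.1 (by rw [hsq u hu1]; ring), aux_B h β B hB α s hs0 e] at hu
    exact hu
  have hcv : ConcaveOn ℝ (Set.Icc (0 : ℝ) 1)
      (fun u : ℝ => h + β * Real.sqrt 2 * u - h * u ^ 2) := by
    refine ⟨convex_Icc 0 1, ?_⟩
    intro x _ y _ a b ha hb hab
    obtain rfl : b = 1 - a := by linarith
    simp only [smul_eq_mul]
    have : 0 ≤ h * (a * (1 - a) * (x - y) ^ 2) := by positivity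
    nlinarith [this]
  exact IsMaxOn.of_isLocalMaxOn_of_concaveOn (Set.mem_Icc.mpr ⟨hs0, hs1⟩) hG hcv

theorem aux_s (α : ℝ) (hα : α ∈ Set.Icc (-1 : ℝ) 1) :
    ∃ s : ℝ, 0 ≤ s ∧ s ≤ 1 ∧ s ^ 2 = 1 - α ^ 2 := by
  have h1 : 0 ≤ 1 - α ^ 2 := by nlinarith [hα.1, hα.2]
  exact ⟨_, Real.sqrt_nonneg _, Real.sqrt_le_one.mpr (by nlinarith [sq_nonneg α]),
    Real.sq_sqrt h1⟩

/-- Lemma: maximizers of `𝓑(α) = hα² + β√(2(1−α²))` on `[-1,1]`,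
quadratic spike. -/
theorem stmt_12 (h β : ℝ) (hh : 0 < h) (hβ : 0 < β)
    (B : ℝ → ℝ) (hB : ∀ α, B α = h * α ^ 2 + β * Real.sqrt (2 * (1 - α ^ 2))) :
    (Real.sqrt 2 * h ≤ β →
      IsMaxOn B (Set.Icc (-1) 1) 0 ∧
      ∀ α ∈ Set.Icc (-1 : ℝ) 1, IsLocalMaxOn B (Set.Icc (-1) 1) α → α = 0) ∧
    (β < Real.sqrt 2 * h →
      sSup (B '' Set.Icc (-1) 1) = h + β ^ 2 / (2 * h) ∧
      IsMaxOn B (Set.Icc (-1) 1) (Real.sqrt (1 - β ^ 2 / (2 * h ^ 2))) ∧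
      IsMaxOn B (Set.Icc (-1) 1) (-Real.sqrt (1 - β ^ 2 / (2 * h ^ 2))) ∧
      ∀ α ∈ Set.Icc (-1 : ℝ) 1, IsLocalMaxOn B (Set.Icc (-1) 1) α →
        α = Real.sqrt (1 - β ^ 2 / (2 * h ^ 2)) ∨
        α = -Real.sqrt (1 - β ^ 2 / (2 * h ^ 2))) := by
  have h2 : Real.sqrt 2 ^ 2 = 2 := Real.sq_sqrt (by norm_num)
  have h20 : 0 < Real.sqrt 2 := Real.sqrt_pos.mpr (by norm_num)
  constructor
  · intro hb
    have hc : 2 * h ≤ β * Real.sqrt 2 := by nlinarith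
    constructor
    · intro α hα
      obtain ⟨s, hs0, hs1, e⟩ := aux_s α hα
      show B α ≤ B 0
      rw [aux_B h β B hB α s hs0 e, aux_B h β B hB 0 1 (by norm_num) (by norm_num)]
      nlinarith [mul_nonneg (sub_nonneg.2 hs1) (sub_nonneg.2 hc),
        mul_nonneg hh.le (sq_nonneg (1 - s))]
    · intro α hα hl
      obtain ⟨s, hs0, hs1, e, H⟩ := aux_loc h β hh B hB α hα hl
      have H1 := H 1 (by simp)
      have : h * (1 - s) ^ 2 ≤ 0 := by
        nlinarith [mul_nonneg (sub_nonneg.2 hs1) (sub_nonneg.2 hc)]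
      have h3 : (1 - s) ^ 2 = 0 := by nlinarith [sq_nonneg (1 - s)]
      have h4 : 1 - s = 0 := by simpa using h3
      have h5 : s = 1 := by linarith
      have : α ^ 2 = 0 := by rw [h5] at e; linarith
      simpa using this
  · intro hb
    obtain ⟨u, hu⟩ : ∃ u : ℝ, u = β * Real.sqrt 2 / (2 * h) := ⟨_, rfl⟩
    have hu0 : 0 ≤ u := by rw [hu]; positivity
    have hc : β * Real.sqrt 2 = 2 * h * u := by rw [hu]; field_simp
    have hu1 : u ≤ 1 := by
      rw [hu, div_le_one (by positivity)]
      nlinarith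
    have husq : u ^ 2 = β ^ 2 / (2 * h ^ 2) := by
      rw [hu, div_pow, mul_pow, h2]; field_simp
    have hval : h + β ^ 2 / (2 * h) = h + h * u ^ 2 := by
      rw [husq]; field_simp
    rw [← husq]
    have hr : Real.sqrt (1 - u ^ 2) ^ 2 = 1 - u ^ 2 := Real.sq_sqrt (by nlinarith)
    have hrn : 0 ≤ Real.sqrt (1 - u ^ 2) := Real.sqrt_nonneg _
    generalize Real.sqrt (1 - u ^ 2) = r at hr hrn
    have hr1 : r ≤ 1 := by nlinarith
    have hBr : B r = h + h * u ^ 2 := by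
      rw [aux_B h β B hB r u hu0 (by linarith), hc]; ring
    have hBr' : B (-r) = h + h * u ^ 2 := by
      rw [aux_B h β B hB (-r) u hu0 (by linarith [neg_sq r]), hc]; ring
    have hle : ∀ α ∈ Set.Icc (-1 : ℝ) 1, B α ≤ h + h * u ^ 2 := by
      intro α hα
      obtain ⟨s, hs0, hs1, e⟩ := aux_s α hα
      rw [aux_B h β B hB α s hs0 e, hc]
      nlinarith [mul_nonneg hh.le (sq_nonneg (u - s))]
    refine ⟨?_, ?_, ?_, ?_⟩
    · rw [hval]
      refine IsGreatest.csSup_eq ⟨⟨r, ⟨by linarith, hr1⟩, hBr⟩, ?_⟩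
      rintro _ ⟨α, hα, rfl⟩
      exact hle α hα
    · intro α hα
      show B α ≤ B r
      rw [hBr]; exact hle α hα
    · intro α hα
      show B α ≤ B (-r)
      rw [hBr']; exact hle α hα
    · intro α hα hl
      obtain ⟨s, hs0, hs1, e, H⟩ := aux_loc h β hh B hB α hα hl
      have H1 := H u ⟨hu0, hu1⟩
      rw [hc] at H1
      have : h * (u - s) ^ 2 ≤ 0 := by nlinarith
      have h3 : (u - s) ^ 2 = 0 := by nlinarith [sq_nonneg (u - s)]
      have h4 : u - s = 0 := by simpa using h3
      have h5 : s = u := by linarith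
      rw [h5] at e
      exact sq_eq_sq_iff_eq_or_eq_neg.mp (by linarith)
end

section
/- Let k ≥ 3 be an integer, h > 0, β > 0, and define 𝓑(α) = h α^k + β√(2(1 − α²)) for α ∈ [-1,1]. Set β̃_c(k,h) = (hk/√2) · (k−2)^{(k−2)/2} / (k−1)^{(k−1)/2} and β_c(k,h) = (h/√2) · ((k−1)/(k−2)) · (1 − 1/(k−1)²)^{k/2}, so that β̃_c(k,h) > β_c(k,h). If β ≥ β̃_c(k,h), then α = 0 is the unique local and global maximizer of 𝓑. If β < β̃_c(k,h), then the equation α^{2(k−2)}(1 − α²) = 2(β/(hk))² has a unique solution α̂ in (√((k−2)/(k−1)), 1), which is its largest solution in (0,1); the only local maximizers of 𝓑 in [0,1] are α = 0 and α = α̂; when β > β_c(k,h) the global maximizer is α = 0; when β = β_c(k,h) both α = 0 and α = α̂ are global maximizers; and when β < β_c(k,h) the unique global maximizer in [0,1] is α̂. Moreover, if k is even then −α̂ is also a local (resp. global) maximizer and the only one in [-1,0), while if k is odd there are no local maximizers in [-1,0). -/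
def gg (n : ℕ) (x : ℝ) : ℝ := x ^ (2 * n) * (1 - x ^ 2)

lemma gg_deriv (n : ℕ) (hn : 1 ≤ n) (x : ℝ) :
    HasDerivAt (gg n) (2 * x ^ (2 * n - 1) * (n - (n + 1) * x ^ 2)) x := by
  have h1 : HasDerivAt (fun x : ℝ => x ^ (2 * n) * (1 - x ^ 2)) _ x :=
    (hasDerivAt_pow (2 * n) x).mul ((hasDerivAt_pow 2 x).const_sub 1)
  refine h1.congr_deriv ?_
  obtain ⟨m, rfl⟩ : ∃ m, n = m + 1 := ⟨n - 1, by omega⟩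
  have : 2 * (m + 1) - 1 = 2 * m + 1 := by omega
  rw [this]
  push_cast
  ring

lemma gg_cont (n : ℕ) : Continuous (gg n) := by
  unfold gg; fun_prop

lemma gg_mono (n : ℕ) (hn : 1 ≤ n) (m : ℝ) (hm : m ^ 2 * (n + 1) = n) (hm0 : 0 < m) :
    StrictMonoOn (gg n) (Set.Icc 0 m) := by
  apply strictMonoOn_of_deriv_pos (convex_Icc _ _) (gg_cont n).continuousOn
  intro x hx
  rw [interior_Icc] at hx
  rw [(gg_deriv n hn x).deriv]
  have h0 : 0 < x := hx.1
  have h2 : x ^ 2 < m ^ 2 := by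
    have := hx.2
    gcongr
  have : 0 < (n : ℝ) - (n + 1) * x ^ 2 := by
    have : (0 : ℝ) < n + 1 := by positivity
    nlinarith
  positivity

lemma gg_anti (n : ℕ) (hn : 1 ≤ n) (m : ℝ) (hm : m ^ 2 * (n + 1) = n) (hm0 : 0 < m) :
    StrictAntiOn (gg n) (Set.Icc m 1) := by
  apply strictAntiOn_of_deriv_neg (convex_Icc _ _) (gg_cont n).continuousOn
  intro x hx
  rw [interior_Icc] at hx
  rw [(gg_deriv n hn x).deriv]
  have h0 : 0 < x := hm0.trans hx.1
  have h2 : m ^ 2 < x ^ 2 := by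
    have := hx.1
    gcongr
  have h3 : (n : ℝ) - (n + 1) * x ^ 2 < 0 := by
    have : (0 : ℝ) < n + 1 := by positivity
    nlinarith
  have : 0 < 2 * x ^ (2 * n - 1) := by positivity
  exact mul_neg_of_pos_of_neg this h3

section
variable {n : ℕ} {h β : ℝ} {B : ℝ → ℝ}

lemma B_cont (hB : ∀ α, B α = h * α ^ (n + 2) + β * Real.sqrt (2 * (1 - α ^ 2))) :
    Continuous B := by
  have : B = fun α => h * α ^ (n + 2) + β * Real.sqrt (2 * (1 - α ^ 2)) := funext hB
  rw [this]; fun_prop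

lemma B_deriv (hB : ∀ α, B α = h * α ^ (n + 2) + β * Real.sqrt (2 * (1 - α ^ 2)))
    (x : ℝ) (hx : 0 < x) (hx1 : x < 1) :
    deriv B x = x / √(1 - x ^ 2) * (h * (n + 2) * (x ^ n * √(1 - x ^ 2)) - β * √2) := by
  have hfun : B = fun α => h * α ^ (n + 2) + β * Real.sqrt (2 * (1 - α ^ 2)) := funext hB
  have hp : 0 < 1 - x ^ 2 := by nlinarith
  have hs : 0 < √(1 - x ^ 2) := Real.sqrt_pos.mpr hp
  have h2 : 0 < √(2 : ℝ) := by positivity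
  have hd : HasDerivAt (fun α => h * α ^ (n + 2) + β * Real.sqrt (2 * (1 - α ^ 2))) _ x :=
    ((hasDerivAt_pow (n + 2) x).const_mul h).add
      (((((hasDerivAt_pow 2 x).const_sub 1).const_mul 2).sqrt (by positivity)).const_mul β)
  rw [hfun, hd.deriv, Real.sqrt_mul (by norm_num)]
  have e2 : √(2 : ℝ) ^ 2 = 2 := Real.sq_sqrt (by norm_num)
  have e : n + 2 - 1 = n + 1 := by omega
  rw [e]
  set s := √(1 - x ^ 2)
  set t := √(2 : ℝ)
  push_cast
  field_simp
  ring_nf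
  try simp only [e2]
  try ring

lemma cmp_c (hh : 0 < h) (hβ : 0 < β) (x : ℝ) (hx : 0 < x) (hx1 : x < 1) :
    (2 * (β / (h * (n + 2))) ^ 2 < gg n x ↔ β * √2 < h * (n + 2) * (x ^ n * √(1 - x ^ 2))) ∧
    (gg n x < 2 * (β / (h * (n + 2))) ^ 2 ↔ h * (n + 2) * (x ^ n * √(1 - x ^ 2)) < β * √2) := by
  have hp : 0 < 1 - x ^ 2 := by nlinarith
  have hN : 0 < h * (n + 2 : ℝ) := by positivity
  have hs : 0 < √(1 - x ^ 2) := Real.sqrt_pos.mpr hp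
  have e1 : (β * √2) ^ 2 = (h * (n + 2)) ^ 2 * (2 * (β / (h * (n + 2))) ^ 2) := by
    rw [mul_pow, Real.sq_sqrt (by norm_num)]; field_simp
  have e2 : (h * (n + 2) * (x ^ n * √(1 - x ^ 2))) ^ 2 = (h * (n + 2)) ^ 2 * gg n x := by
    rw [mul_pow, mul_pow (x ^ n), Real.sq_sqrt hp.le, gg, ← pow_mul, mul_comm n 2]
  have hN2 : 0 < (h * (n + 2 : ℝ)) ^ 2 := by positivity
  constructor
  · rw [← pow_lt_pow_iff_left₀ (by positivity : 0 ≤ β * √2) (by positivity) two_ne_zero, e1, e2]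
    exact (mul_lt_mul_iff_right₀ hN2).symm
  · rw [← pow_lt_pow_iff_left₀ (b := β * √2) (by positivity) (by positivity) two_ne_zero, e1, e2]
    exact (mul_lt_mul_iff_right₀ hN2).symm

lemma B_mono (hB : ∀ α, B α = h * α ^ (n + 2) + β * Real.sqrt (2 * (1 - α ^ 2)))
    (hh : 0 < h) (hβ : 0 < β) (a b : ℝ) (ha : 0 ≤ a) (hb : b ≤ 1)
    (hg : ∀ x ∈ Set.Ioo a b, 2 * (β / (h * (n + 2))) ^ 2 < gg n x) :
    StrictMonoOn B (Set.Icc a b) := by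
  apply strictMonoOn_of_deriv_pos (convex_Icc _ _) (B_cont hB).continuousOn
  intro x hx
  rw [interior_Icc] at hx
  have h0 : 0 < x := ha.trans_lt hx.1
  have h1 : x < 1 := hx.2.trans_le hb
  rw [B_deriv hB x h0 h1]
  have := ((cmp_c hh hβ x h0 h1).1).1 (hg x hx)
  have hs : 0 < √(1 - x ^ 2) := Real.sqrt_pos.mpr (by nlinarith)
  exact mul_pos (by positivity) (by linarith)

lemma B_anti (hB : ∀ α, B α = h * α ^ (n + 2) + β * Real.sqrt (2 * (1 - α ^ 2)))
    (hh : 0 < h) (hβ : 0 < β) (a b : ℝ) (ha : 0 ≤ a) (hb : b ≤ 1)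
    (hg : ∀ x ∈ Set.Ioo a b, gg n x < 2 * (β / (h * (n + 2))) ^ 2) :
    StrictAntiOn B (Set.Icc a b) := by
  apply strictAntiOn_of_deriv_neg (convex_Icc _ _) (B_cont hB).continuousOn
  intro x hx
  rw [interior_Icc] at hx
  have h0 : 0 < x := ha.trans_lt hx.1
  have h1 : x < 1 := hx.2.trans_le hb
  rw [B_deriv hB x h0 h1]
  have := ((cmp_c hh hβ x h0 h1).2).1 (hg x hx)
  have hs : 0 < √(1 - x ^ 2) := Real.sqrt_pos.mpr (by nlinarith)
  exact mul_neg_of_pos_of_neg (by positivity) (by linarith)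

lemma lm_iff (x : ℝ) : IsLocalMaxOn B (Set.Icc (-1) 1) x ↔
    ∃ ε > 0, ∀ y, -1 ≤ y → y ≤ 1 → |y - x| < ε → B y ≤ B x := by
  unfold IsLocalMaxOn IsMaxFilter
  rw [Filter.Eventually, Metric.mem_nhdsWithin_iff]
  constructor
  · rintro ⟨ε, h0, H⟩
    exact ⟨ε, h0, fun y h1 h2 h3 => H ⟨by simpa [Real.dist_eq] using h3, h1, h2⟩⟩
  · rintro ⟨ε, h0, H⟩
    exact ⟨ε, h0, fun y hy => H y hy.2.1 hy.2.2 (by simpa [Real.dist_eq] using hy.1)⟩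

lemma not_lm_anti {a b x : ℝ} (ha : -1 ≤ a) (hb : b ≤ 1) (H : StrictAntiOn B (Set.Icc a b))
    (hx : a < x) (hx' : x ≤ b) : ¬ IsLocalMaxOn B (Set.Icc (-1) 1) x := by
  rw [lm_iff]
  rintro ⟨ε, h0, h1⟩
  have hy : max a (x - ε / 2) < x := max_lt hx (by linarith)
  have h3 := le_max_left a (x - ε / 2)
  have h4 := le_max_right a (x - ε / 2)
  have := h1 (max a (x - ε / 2)) (by linarith) (by linarith) (by rw [abs_lt]; constructor <;> linarith)
  have := H ⟨h3, by linarith⟩ ⟨hx.le, hx'⟩ hy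
  linarith

lemma not_lm_mono {a b x : ℝ} (ha : -1 ≤ a) (hb : b ≤ 1) (H : StrictMonoOn B (Set.Icc a b))
    (hx : a ≤ x) (hx' : x < b) : ¬ IsLocalMaxOn B (Set.Icc (-1) 1) x := by
  rw [lm_iff]
  rintro ⟨ε, h0, h1⟩
  have hy : x < min b (x + ε / 2) := lt_min hx' (by linarith)
  have h3 := min_le_left b (x + ε / 2)
  have h4 := min_le_right b (x + ε / 2)
  have := h1 (min b (x + ε / 2)) (by linarith) (by linarith) (by rw [abs_lt]; constructor <;> linarith)
  have := H ⟨hx, hx'.le⟩ ⟨by linarith, h3⟩ hy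
  linarith

lemma B_abs (hB : ∀ α, B α = h * α ^ (n + 2) + β * Real.sqrt (2 * (1 - α ^ 2)))
    (hh : 0 < h) (y : ℝ) : B y ≤ B |y| := by
  rw [hB, hB, sq_abs, ← abs_pow]
  have := le_abs_self (y ^ (n + 2))
  gcongr

lemma B_even (hB : ∀ α, B α = h * α ^ (n + 2) + β * Real.sqrt (2 * (1 - α ^ 2)))
    (he : Even (n + 2)) (y : ℝ) : B (-y) = B y := by
  rw [hB, hB, he.neg_pow, neg_sq]

lemma B_odd_mono (hB : ∀ α, B α = h * α ^ (n + 2) + β * Real.sqrt (2 * (1 - α ^ 2)))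
    (hh : 0 < h) (hβ : 0 < β) (he : Odd (n + 2)) : StrictMonoOn B (Set.Icc (-1) 0) := by
  intro x hx y hy hxy
  rw [hB, hB]
  have h1 : x ^ (n + 2) < y ^ (n + 2) := he.strictMono_pow hxy
  have h2 : y ^ 2 ≤ x ^ 2 := by nlinarith [hx.1, hx.2, hy.1, hy.2]
  have h3 : √(2 * (1 - x ^ 2)) ≤ √(2 * (1 - y ^ 2)) := Real.sqrt_le_sqrt (by linarith)
  have := mul_lt_mul_of_pos_left h1 hh
  have := mul_le_mul_of_nonneg_left h3 hβ.le
  linarith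

lemma lm_neg (hB : ∀ α, B α = h * α ^ (n + 2) + β * Real.sqrt (2 * (1 - α ^ 2)))
    (he : Even (n + 2)) (x : ℝ) (hx : IsLocalMaxOn B (Set.Icc (-1) 1) x) :
    IsLocalMaxOn B (Set.Icc (-1) 1) (-x) := by
  rw [lm_iff] at *
  obtain ⟨ε, h0, H⟩ := hx
  refine ⟨ε, h0, fun y h1 h2 h3 => ?_⟩
  rw [B_even hB he, ← B_even hB he y]
  refine H _ (by linarith) (by linarith) ?_
  rw [← abs_neg]
  convert h3 using 2
  ring

/-- sign of `B a - B 0` at a critical point -/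
lemma B_diff (hB : ∀ α, B α = h * α ^ (n + 2) + β * Real.sqrt (2 * (1 - α ^ 2)))
    (hh : 0 < h) (hβ : 0 < β) (x : ℝ) (hx : 0 < x) (hx1 : x < 1)
    (hc : gg n x = 2 * (β / (h * (n + 2))) ^ 2) :
    B x - B 0 = h * x ^ n * (1 - √(1 - x ^ 2)) * (1 - (n + 1) * √(1 - x ^ 2)) := by
  have hp : 0 < 1 - x ^ 2 := by nlinarith
  have h1 := cmp_c (n := n) hh hβ x hx hx1
  have e : h * (n + 2) * (x ^ n * √(1 - x ^ 2)) = β * √2 := by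
    apply le_antisymm
    · by_contra hcon
      exact absurd (h1.1.2 (not_le.1 hcon)) (by rw [hc]; exact lt_irrefl _)
    · by_contra hcon
      exact absurd (h1.2.2 (not_le.1 hcon)) (by rw [hc]; exact lt_irrefl _)
  rw [hB, hB, Real.sqrt_mul (by norm_num)]
  have es : √(1 - x ^ 2) ^ 2 = 1 - x ^ 2 := Real.sq_sqrt hp.le
  have e0 : √(2 * (1 - (0 : ℝ) ^ 2)) = √2 := by norm_num
  rw [e0]
  have : β * (√2 * √(1 - x ^ 2)) = (h * (n + 2) * (x ^ n * √(1 - x ^ 2))) * √(1 - x ^ 2) := by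
    rw [e]; ring
  rw [this, ← e]
  set s := √(1 - x ^ 2)
  have ex : x ^ (n + 2) = x ^ n * (1 - s ^ 2) := by rw [es]; ring
  rw [ex]
  simp
  ring

end

lemma bt_eq (n : ℕ) (hn : 1 ≤ n) (h : ℝ) (hh : 0 < h) (m : ℝ) (hm : m ^ 2 * (n + 1) = n) :
    2 * ((h * (n + 2) / √2 * (√(n : ℝ) ^ n / √((n : ℝ) + 1) ^ (n + 1))) / (h * (n + 2))) ^ 2
      = gg n m := by
  have e2 : √(2 : ℝ) ^ 2 = 2 := Real.sq_sqrt (by norm_num)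
  have en : √(n : ℝ) ^ 2 = n := Real.sq_sqrt (by positivity)
  have en1 : √((n : ℝ) + 1) ^ 2 = n + 1 := Real.sq_sqrt (by positivity)
  have hm2 : m ^ 2 = n / (n + 1) := by
    rw [eq_div_iff (by positivity)]; exact hm
  have e : (h * (n + 2) / √2 * (√(n : ℝ) ^ n / √((n : ℝ) + 1) ^ (n + 1))) / (h * (n + 2))
     = (√(n : ℝ) ^ n / √((n : ℝ) + 1) ^ (n + 1)) / √2 := by
    field_simp
  rw [e, div_pow, e2, gg, pow_mul, hm2, div_pow, ← pow_mul, ← pow_mul, mul_comm n, mul_comm (n + 1),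
    pow_mul, pow_mul, en, en1, div_pow]
  have : (n : ℝ) + 1 ≠ 0 := by positivity
  field_simp
  ring

lemma bc_eq (n : ℕ) (hn : 1 ≤ n) (h : ℝ) (hh : 0 < h) :
    2 * ((h / √2 * (((n : ℝ) + 1) / n) * √(1 - 1 / ((n : ℝ) + 1) ^ 2) ^ (n + 2)) / (h * (n + 2))) ^ 2
      = gg n √(1 - 1 / ((n : ℝ) + 1) ^ 2) := by
  have hn0 : (0 : ℝ) < n := by exact_mod_cast hn
  have e2 : √(2 : ℝ) ^ 2 = 2 := Real.sq_sqrt (by norm_num)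
  have hu : 1 - 1 / ((n : ℝ) + 1) ^ 2 = n * (n + 2) / (n + 1) ^ 2 := by
    field_simp; ring
  have eu : √(1 - 1 / ((n : ℝ) + 1) ^ 2) ^ 2 = n * (n + 2) / (n + 1) ^ 2 := by
    rw [Real.sq_sqrt, hu]
    rw [hu]; positivity
  set u := √(1 - 1 / ((n : ℝ) + 1) ^ 2)
  rw [gg, div_pow, mul_pow, mul_pow, div_pow h, e2, ← pow_mul,
    show (n + 2) * 2 = 2 * n + 2 * 2 by ring, pow_add, pow_mul u 2 2, eu]
  field_simp
  ring

set_option maxHeartbeats 4000000 in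

/-- Lemma: maximizers of `𝓑(α) = hα^k + β√(2(1−α²))` on `[-1,1]` for a
monomial spike of degree `k ≥ 3`.  Here `(k−2)^{(k−2)/2}` is written `√(k−2) ^ (k−2)`,
`(k−1)^{(k−1)/2}` is written `√(k−1) ^ (k−1)` and `(1 − 1/(k−1)²)^{k/2}` is written
`√(1 − 1/(k−1)²) ^ k`.  Local/global maximizers are with respect to the domain `[-1,1]`. -/
theorem stmt_13 (k : ℕ) (hk : 3 ≤ k) (h β : ℝ) (hh : 0 < h) (hβ : 0 < β)
    (B : ℝ → ℝ) (hB : ∀ α, B α = h * α ^ k + β * Real.sqrt (2 * (1 - α ^ 2)))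
    (βt βc : ℝ)
    (hβt : βt = h * k / Real.sqrt 2 *
      (Real.sqrt ((k : ℝ) - 2) ^ (k - 2) / Real.sqrt ((k : ℝ) - 1) ^ (k - 1)))
    (hβc : βc = h / Real.sqrt 2 * (((k : ℝ) - 1) / ((k : ℝ) - 2)) *
      Real.sqrt (1 - 1 / ((k : ℝ) - 1) ^ 2) ^ k) :
    βc < βt ∧
    (βt ≤ β →
      IsMaxOn B (Set.Icc (-1) 1) 0 ∧
      ∀ α ∈ Set.Icc (-1 : ℝ) 1, IsLocalMaxOn B (Set.Icc (-1) 1) α → α = 0) ∧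
    (β < βt → ∃ αh : ℝ,
      αh ∈ Set.Ioo (Real.sqrt (((k : ℝ) - 2) / ((k : ℝ) - 1))) 1 ∧
      αh ^ (2 * (k - 2)) * (1 - αh ^ 2) = 2 * (β / (h * k)) ^ 2 ∧
      (∀ x ∈ Set.Ioo (Real.sqrt (((k : ℝ) - 2) / ((k : ℝ) - 1))) 1,
        x ^ (2 * (k - 2)) * (1 - x ^ 2) = 2 * (β / (h * k)) ^ 2 → x = αh) ∧
      (∀ x ∈ Set.Ioo (0 : ℝ) 1,
        x ^ (2 * (k - 2)) * (1 - x ^ 2) = 2 * (β / (h * k)) ^ 2 → x ≤ αh) ∧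
      IsLocalMaxOn B (Set.Icc (-1) 1) 0 ∧
      IsLocalMaxOn B (Set.Icc (-1) 1) αh ∧
      (∀ α ∈ Set.Icc (0 : ℝ) 1, IsLocalMaxOn B (Set.Icc (-1) 1) α → α = 0 ∨ α = αh) ∧
      (βc < β →
        IsMaxOn B (Set.Icc (-1) 1) 0 ∧
        ∀ α ∈ Set.Icc (0 : ℝ) 1, IsMaxOn B (Set.Icc (-1) 1) α → α = 0) ∧
      (β = βc → IsMaxOn B (Set.Icc (-1) 1) 0 ∧ IsMaxOn B (Set.Icc (-1) 1) αh) ∧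
      (β < βc →
        IsMaxOn B (Set.Icc (-1) 1) αh ∧
        ∀ α ∈ Set.Icc (0 : ℝ) 1, IsMaxOn B (Set.Icc (-1) 1) α → α = αh) ∧
      (Even k →
        IsLocalMaxOn B (Set.Icc (-1) 1) (-αh) ∧
        (∀ α ∈ Set.Ico (-1 : ℝ) 0, IsLocalMaxOn B (Set.Icc (-1) 1) α → α = -αh) ∧
        (β < βc → IsMaxOn B (Set.Icc (-1) 1) (-αh)) ∧
        (β = βc → IsMaxOn B (Set.Icc (-1) 1) (-αh))) ∧
      (Odd k → ∀ α ∈ Set.Ico (-1 : ℝ) 0, ¬ IsLocalMaxOn B (Set.Icc (-1) 1) α)) := by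
  obtain ⟨n, rfl⟩ : ∃ n, k = n + 2 := ⟨k - 2, by omega⟩
  have hn : 1 ≤ n := by omega
  have hn0 : (0 : ℝ) < n := by exact_mod_cast hn
  have c1 : (((n + 2 : ℕ) : ℝ)) - 2 = n := by push_cast; ring
  have c2 : (((n + 2 : ℕ) : ℝ)) - 1 = n + 1 := by push_cast; ring
  have c3 : (((n + 2 : ℕ) : ℝ)) = n + 2 := by push_cast; ring
  have c4 : n + 2 - 2 = n := by omega
  have c5 : n + 2 - 1 = n + 1 := by omega
  rw [c1, c2, c3, c4, c5] at hβt
  rw [c1, c2] at hβc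
  rw [c1, c2]
  simp only [c3, c4]
  have hgg : ∀ x : ℝ, x ^ (2 * n) * (1 - x ^ 2) = gg n x := fun x => rfl
  simp only [hgg]
  have hm : √((n : ℝ) / (n + 1)) ^ 2 * (n + 1) = n := by
    rw [Real.sq_sqrt (by positivity)]; field_simp
  have hm0 : 0 < √((n : ℝ) / (n + 1)) := by positivity
  have hm1 : √((n : ℝ) / (n + 1)) < 1 := by
    rw [Real.sqrt_lt' one_pos, div_lt_iff₀ (by positivity)]; linarith
  have hT := bt_eq n hn h hh _ hm
  rw [← hβt] at hT
  have hC := bc_eq n hn h hh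
  rw [← hβc] at hC
  set m := √((n : ℝ) / (n + 1)) with hmdef
  have hn2 : (1 : ℝ) / (n + 1) ^ 2 < 1 / (n + 1) := by
    apply one_div_lt_one_div_of_lt (by positivity); nlinarith
  have hn3 : 1 / ((n : ℝ) + 1) < 1 := by
    rw [div_lt_one (by positivity)]; linarith
  have hn4 : 0 < (1 : ℝ) / (n + 1) ^ 2 := by positivity
  have hac2 : √(1 - 1 / ((n : ℝ) + 1) ^ 2) ^ 2 = 1 - 1 / ((n : ℝ) + 1) ^ 2 :=
    Real.sq_sqrt (by linarith)
  have hmac : m < √(1 - 1 / ((n : ℝ) + 1) ^ 2) := by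
    apply Real.sqrt_lt_sqrt (by positivity)
    have : (n : ℝ) / (n + 1) = 1 - 1 / (n + 1) := by field_simp; ring
    rw [this]; linarith
  have hac1 : √(1 - 1 / ((n : ℝ) + 1) ^ 2) < 1 := by
    rw [Real.sqrt_lt' one_pos]; linarith
  have hβt0 : 0 < βt := by rw [hβt]; positivity
  have hβc0 : 0 < βc := by
    rw [hβc]
    have := hm0.trans hmac
    positivity
  set ac := √(1 - 1 / ((n : ℝ) + 1) ^ 2) with hacdef
  have hN : 0 < h * ((n : ℝ) + 2) := by positivity
  have cmp : ∀ a b : ℝ, 0 < a → 0 < b →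
      (2 * (a / (h * (n + 2))) ^ 2 < 2 * (b / (h * (n + 2))) ^ 2 ↔ a < b) := by
    intro a b ha hb
    rw [mul_lt_mul_iff_right₀ two_pos, pow_lt_pow_iff_left₀ (by positivity) (by positivity)
      two_ne_zero, div_lt_div_iff_of_pos_right hN]
  have hMono := gg_mono n hn m hm hm0
  have hAnti := gg_anti n hn m hm hm0
  have hlt : βc < βt := by
    rw [← cmp _ _ hβc0 hβt0, hT, hC]
    exact hAnti ⟨le_rfl, hm1.le⟩ ⟨hmac.le, hac1.le⟩ hmac
  have g0 : gg n 0 = 0 := by simp [gg]; omega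
  have g1 : gg n 1 = 0 := by simp [gg]
  have habs1 : ∀ y ∈ Set.Icc (-1 : ℝ) 1, |y| ≤ 1 := fun y hy => abs_le.2 hy
  refine ⟨hlt, ?_, ?_⟩
  · intro hle
    have hcle : gg n m ≤ 2 * (β / (h * (n + 2))) ^ 2 := by
      rw [← hT]
      by_contra hcon
      rw [not_le, cmp _ _ hβ hβt0] at hcon
      linarith
    have A1 := B_anti hB hh hβ 0 m le_rfl hm1.le (fun x hx =>
      (hMono ⟨hx.1.le, hx.2.le⟩ ⟨hm0.le, le_rfl⟩ hx.2).trans_le hcle)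
    have A2 := B_anti hB hh hβ m 1 hm0.le le_rfl (fun x hx =>
      (hAnti ⟨le_rfl, hm1.le⟩ ⟨hx.1.le, hx.2.le⟩ hx.1).trans_le hcle)
    have A : ∀ x, 0 < x → x ≤ 1 → ¬ IsLocalMaxOn B (Set.Icc (-1) 1) x := by
      intro x h0 h1
      rcases le_or_gt x m with hxm | hxm
      · exact not_lm_anti (by norm_num) hm1.le A1 h0 hxm
      · exact not_lm_anti (by linarith) le_rfl A2 hxm h1
    refine ⟨?_, ?_⟩
    · intro y hy
      refine (B_abs hB hh y).trans ?_
      have h1 := habs1 y hy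
      have h0 := abs_nonneg y
      rcases le_or_gt |y| m with hxm | hxm
      · exact A1.antitoneOn ⟨le_rfl, hm0.le⟩ ⟨h0, hxm⟩ h0
      · exact (A2.antitoneOn ⟨le_rfl, hm1.le⟩ ⟨hxm.le, h1⟩ hxm.le).trans
          (A1.antitoneOn ⟨le_rfl, hm0.le⟩ ⟨hm0.le, le_rfl⟩ hm0.le)
    · intro x hx hlm
      by_contra hne
      rcases lt_or_gt_of_ne hne with hx0 | hx0
      · rcases Nat.even_or_odd (n + 2) with he | ho
        · exact A (-x) (by linarith) (by linarith [hx.1]) (lm_neg hB he x hlm)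
        · exact not_lm_mono le_rfl zero_le_one (B_odd_mono hB hh hβ ho) hx.1 hx0 hlm
      · exact A x hx0 hx.2 hlm
  · intro hltβ
    set c := 2 * (β / (h * (n + 2))) ^ 2 with hc
    have hc0 : 0 < c := by positivity
    have hcm : c < gg n m := by rw [← hT]; exact (cmp _ _ hβ hβt0).2 hltβ
    obtain ⟨a0, ⟨ha00, ha0m⟩, hga0⟩ : ∃ a0 ∈ Set.Ioo 0 m, gg n a0 = c := by
      have := intermediate_value_Ioo hm0.le (gg_cont n).continuousOn
      exact this ⟨by rw [g0]; exact hc0, hcm⟩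
    obtain ⟨a1, ⟨ha1m, ha11⟩, hga1⟩ : ∃ a1 ∈ Set.Ioo m 1, gg n a1 = c := by
      have := intermediate_value_Ioo' hm1.le (gg_cont n).continuousOn
      exact this ⟨by rw [g1]; exact hc0, hcm⟩
    have ha01 : a0 < a1 := ha0m.trans ha1m
    have ha10 : 0 < a1 := ha00.trans ha01
    have A1 : StrictAntiOn B (Set.Icc 0 a0) := by
      refine B_anti hB hh hβ 0 a0 le_rfl (by linarith) (fun x hx => ?_)
      rw [← hc, ← hga0]
      exact hMono ⟨hx.1.le, by linarith [hx.2]⟩ ⟨ha00.le, ha0m.le⟩ hx.2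
    have A2 : StrictMonoOn B (Set.Icc a0 a1) := by
      refine B_mono hB hh hβ a0 a1 ha00.le ha11.le (fun x hx => ?_)
      rw [← hc]
      rcases le_or_gt x m with hxm | hxm
      · rw [← hga0]
        exact hMono ⟨ha00.le, ha0m.le⟩ ⟨by linarith [hx.1], hxm⟩ hx.1
      · rw [← hga1]
        exact hAnti ⟨hxm.le, by linarith [hx.2]⟩ ⟨ha1m.le, ha11.le⟩ hx.2
    have A3 : StrictAntiOn B (Set.Icc a1 1) := by
      refine B_anti hB hh hβ a1 1 ha10.le le_rfl (fun x hx => ?_)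
      rw [← hc, ← hga1]
      exact hAnti ⟨ha1m.le, ha11.le⟩ ⟨by linarith [hx.1], hx.2.le⟩ hx.1
    have huniq : ∀ x ∈ Set.Ioo m 1, gg n x = c → x = a1 := fun x hx hxc =>
      hAnti.injOn ⟨hx.1.le, hx.2.le⟩ ⟨ha1m.le, ha11.le⟩ (hxc.trans hga1.symm)
    have L : ∀ x, 0 < x → x ≤ 1 → IsLocalMaxOn B (Set.Icc (-1) 1) x → x = a1 := by
      intro x h0 h1 hlm
      by_contra hne
      rcases le_or_gt x a0 with hx | hx
      · exact not_lm_anti (by norm_num) (by linarith) A1 h0 hx hlm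
      · rcases lt_or_gt_of_ne hne with hx' | hx'
        · exact not_lm_mono (by linarith) (by linarith) A2 hx.le hx' hlm
        · exact not_lm_anti (by linarith) le_rfl A3 hx' h1 hlm
    have L' : ∀ x ∈ Set.Icc (0 : ℝ) 1, IsLocalMaxOn B (Set.Icc (-1) 1) x → x = 0 ∨ x = a1 := by
      intro x hx hlm
      rcases hx.1.eq_or_lt with h0 | h0
      · exact Or.inl h0.symm
      · exact Or.inr (L x h0 hx.2 hlm)
    have LM1 : IsLocalMaxOn B (Set.Icc (-1) 1) a1 := by
      rw [lm_iff]
      refine ⟨a1 - a0, by linarith, fun y _ hy1 hy => ?_⟩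
      rw [abs_lt] at hy
      rcases le_or_gt y a1 with hya | hya
      · exact A2.monotoneOn ⟨by linarith, hya⟩ ⟨ha01.le, le_rfl⟩ hya
      · exact A3.antitoneOn ⟨le_rfl, ha11.le⟩ ⟨hya.le, hy1⟩ hya.le
    have Lle0 : ∀ y, 0 ≤ y → y ≤ a0 → B y ≤ B 0 := fun y h0 h1 =>
      A1.antitoneOn ⟨le_rfl, ha00.le⟩ ⟨h0, h1⟩ h0
    have Lle1 : ∀ y, a0 < y → y ≤ 1 → B y ≤ B a1 := by
      intro y h0 h1
      rcases le_or_gt y a1 with hya | hya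
      · exact A2.monotoneOn ⟨h0.le, hya⟩ ⟨ha01.le, le_rfl⟩ hya
      · exact A3.antitoneOn ⟨le_rfl, ha11.le⟩ ⟨hya.le, h1⟩ hya.le
    have M0 : B a1 ≤ B 0 → IsMaxOn B (Set.Icc (-1) 1) 0 := by
      intro H y hy
      refine (B_abs hB hh y).trans ?_
      rcases le_or_gt |y| a0 with hya | hya
      · exact Lle0 _ (abs_nonneg y) hya
      · exact (Lle1 _ hya (habs1 y hy)).trans H
    have M1 : B 0 ≤ B a1 → IsMaxOn B (Set.Icc (-1) 1) a1 := by
      intro H y hy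
      refine (B_abs hB hh y).trans ?_
      rcases le_or_gt |y| a0 with hya | hya
      · exact (Lle0 _ (abs_nonneg y) hya).trans H
      · exact Lle1 _ hya (habs1 y hy)
    have m0 : (0 : ℝ) ∈ Set.Icc (-1 : ℝ) 1 := by norm_num
    have m1 : a1 ∈ Set.Icc (-1 : ℝ) 1 := ⟨by linarith, ha11.le⟩
    have hD := B_diff hB hh hβ a1 ha10 ha11 (by rw [hga1])
    have hs1 : √(1 - a1 ^ 2) < 1 := by
      rw [Real.sqrt_lt' one_pos, one_pow]; linarith only [pow_pos ha10 2]
    have hpos : 0 < h * a1 ^ n * (1 - √(1 - a1 ^ 2)) := by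
      have : 0 < 1 - √(1 - a1 ^ 2) := by linarith
      positivity
    have hsc : √(1 - ac ^ 2) = 1 / (n + 1) := by
      rw [hac2, Real.sqrt_eq_iff_mul_self_eq (by linarith) (by positivity)]
      field_simp
      try ring
    have hsc' : (n + 1) * √(1 - ac ^ 2) = 1 := by rw [hsc]; field_simp
    have hn1 : (0 : ℝ) < n + 1 := by positivity
    have hac0 : 0 < ac := hm0.trans hmac
    have Cgt : βc < β → B a1 < B 0 := by
      intro hb
      have h1 : a1 < ac := by
        have : gg n ac < gg n a1 := by rw [← hC, hga1]; exact (cmp _ _ hβc0 hβ).2 hb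
        exact (hAnti.lt_iff_gt ⟨hmac.le, hac1.le⟩ ⟨ha1m.le, ha11.le⟩).1 this
      have h2 : √(1 - ac ^ 2) < √(1 - a1 ^ 2) :=
        Real.sqrt_lt_sqrt (by rw [hac2]; linarith only [hn4])
          (sub_lt_sub_left (pow_lt_pow_left₀ h1 ha10.le two_ne_zero) 1)
      have h3 := mul_lt_mul_of_pos_left h2 hn1
      have h4 := mul_neg_of_pos_of_neg hpos (by linarith : 1 - ((n : ℝ) + 1) * √(1 - a1 ^ 2) < 0)
      linarith
    have Clt : β < βc → B 0 < B a1 := by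
      intro hb
      have h1 : ac < a1 := by
        have : gg n a1 < gg n ac := by rw [← hC, hga1]; exact (cmp _ _ hβ hβc0).2 hb
        exact (hAnti.lt_iff_gt ⟨ha1m.le, ha11.le⟩ ⟨hmac.le, hac1.le⟩).1 this
      have h2 : √(1 - a1 ^ 2) < √(1 - ac ^ 2) :=
        Real.sqrt_lt_sqrt (sub_nonneg.2 (pow_le_one₀ ha10.le ha11.le))
          (sub_lt_sub_left (pow_lt_pow_left₀ h1 hac0.le two_ne_zero) 1)
      have h3 := mul_lt_mul_of_pos_left h2 hn1
      have h4 := mul_pos hpos (by linarith : 0 < 1 - ((n : ℝ) + 1) * √(1 - a1 ^ 2))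
      linarith
    have Ceq : β = βc → B a1 = B 0 := by
      intro hb
      have h1 : ac = a1 := huniq ac ⟨hmac, hac1⟩ (by rw [← hC, hc, hb])
      rw [← h1, hsc', sub_self, mul_zero, h1] at hD
      linarith
    have Meven : Even (n + 2) → IsMaxOn B (Set.Icc (-1) 1) a1 →
        IsMaxOn B (Set.Icc (-1) 1) (-a1) := by
      intro he H y hy
      have := H hy
      simp only [Set.mem_setOf_eq] at this ⊢
      rwa [B_even hB he]
    refine ⟨a1, ⟨ha1m, ha11⟩, hga1, huniq, ?_, ?_, LM1, L', ?_, ?_, ?_, ?_, ?_⟩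
    · intro x hx hxc
      rcases le_or_gt x m with hxm | hxm
      · linarith
      · exact (huniq x ⟨hxm, hx.2⟩ hxc).le
    · rw [lm_iff]
      refine ⟨a0, ha00, fun y _ _ hy => ?_⟩
      rw [sub_zero] at hy
      exact (B_abs hB hh y).trans (Lle0 _ (abs_nonneg y) hy.le)
    · intro hb
      have H := Cgt hb
      refine ⟨M0 H.le, fun x hx hmax => ?_⟩
      rcases L' x hx hmax.localize with h1 | h1
      · exact h1
      · subst h1
        have : B 0 ≤ B x := hmax m0
        linarith
    · intro hb
      have H := Ceq hb
      exact ⟨M0 H.le, M1 H.ge⟩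
    · intro hb
      have H := Clt hb
      refine ⟨M1 H.le, fun x hx hmax => ?_⟩
      rcases L' x hx hmax.localize with h1 | h1
      · subst h1
        have : B a1 ≤ B 0 := hmax m1
        linarith
      · exact h1
    · intro he
      refine ⟨lm_neg hB he _ LM1, fun x hx hlm => ?_, fun hb => Meven he (M1 (Clt hb).le),
        fun hb => Meven he (M1 (Ceq hb).ge)⟩
      have := L (-x) (by linarith [hx.2]) (by linarith [hx.1]) (lm_neg hB he x hlm)
      linarith
    · intro ho x hx
      exact not_lm_mono le_rfl zero_le_one (B_odd_mono hB hh hβ ho) hx.1 hx.2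
end

section
/- Let h > 0, β > 0, let g(r) = (1/2)log(1 − r²) + (β²/2)(1 − r²)² for r ∈ [0,1), let q_P = max(1 − 1/(√2 β), 0), let Plef(β) = [√q_P, 1], and define 𝓑̃(α,r) = h r α + β r² √(2(1 − α²)) + g(r). Then sup_{r ∈ Plef(β), α ∈ [-1,1]} 𝓑̃(α,r) = sup_{q ∈ [q_P, 1)} ℬ(q), where ℬ(q) = √(h² q + 2β² q²) + (1/2)log(1 − q) + (β²/2)(1 − q)². The function ℬ is strictly concave on [q_P, 1) and its unique maximizer q̂ is the unique solution in (q_P, 1) of q/(h² + 2qβ²) = (1 − q)². Moreover, the unique maximizer of 𝓑̃ on Plef(β) × [-1,1] is (α̂, r̂) with r̂ = √q̂ and α̂ = h/√(h² + 2β² q̂). -/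
lemma phi_lt (β x y : ℝ) (hx : 0 < x) (hx2 : 2 * β ^ 2 ≤ x ^ 2) (hxy : x < y) :
    x / 2 + β ^ 2 / x < y / 2 + β ^ 2 / y := by
  have hy : 0 < y := hx.trans hxy
  have h1 : 2 * β ^ 2 < x * y := by nlinarith
  have h2 : y / 2 + β ^ 2 / y - (x / 2 + β ^ 2 / x) = (y - x) * (x * y - 2 * β ^ 2) / (2 * x * y) := by
    field_simp
    ring
  have h3 : 0 < (y - x) * (x * y - 2 * β ^ 2) / (2 * x * y) := by
    have := sub_pos.2 hxy
    have := sub_pos.2 h1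
    positivity
  linarith

lemma plef_inv (β qP q : ℝ) (hβ : 0 < β) (hqP : qP = max (1 - 1 / (Real.sqrt 2 * β)) 0)
    (hq : qP ≤ q) (hq1 : q < 1) : 2 * β ^ 2 ≤ (1 / (1 - q)) ^ 2 := by
  have h1 : 1 - 1 / (Real.sqrt 2 * β) ≤ q := le_trans (by rw [hqP]; exact le_max_left _ _) hq
  have hs : 0 < Real.sqrt 2 * β := by positivity
  have h2 : Real.sqrt 2 * β ≤ 1 / (1 - q) := by
    rw [le_div_iff₀ (by linarith)]
    have : 1 - q ≤ 1 / (Real.sqrt 2 * β) := by linarith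
    rw [le_div_iff₀ hs] at this
    linarith
  have h3 := pow_le_pow_left₀ hs.le h2 2
  rwa [mul_pow, Real.sq_sqrt (by norm_num)] at h3

noncomputable def Dq (h β q : ℝ) : ℝ :=
  (Real.sqrt (h ^ 2 / q + 2 * β ^ 2) / 2 + β ^ 2 / Real.sqrt (h ^ 2 / q + 2 * β ^ 2))
    - ((1 / (1 - q)) / 2 + β ^ 2 / (1 / (1 - q)))

lemma Dq_anti (h β qP : ℝ) (hh : 0 < h) (hβ : 0 < β)
    (hqP : qP = max (1 - 1 / (Real.sqrt 2 * β)) 0) : StrictAntiOn (Dq h β) (Set.Ioo qP 1) := by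
  intro a ha b hb hab
  have h0 : 0 ≤ qP := by rw [hqP]; exact le_max_right _ _
  have ha0 : 0 < a := h0.trans_lt ha.1
  have hb0 : 0 < b := h0.trans_lt hb.1
  have h1 := phi_lt β (1 / (1 - a)) (1 / (1 - b)) (one_div_pos.2 (by linarith [ha.2]))
    (plef_inv β qP a hβ hqP ha.1.le ha.2)
    (one_div_lt_one_div_of_lt (by linarith [hb.2]) (by linarith))
  have h2 := phi_lt β (Real.sqrt (h ^ 2 / b + 2 * β ^ 2)) (Real.sqrt (h ^ 2 / a + 2 * β ^ 2))
    (by positivity) (by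
      rw [Real.sq_sqrt (by positivity)]
      have : 0 < h ^ 2 / b := by positivity
      linarith)
    (by
      apply Real.sqrt_lt_sqrt (by positivity)
      have : h ^ 2 / b < h ^ 2 / a := by gcongr
      linarith)
  unfold Dq
  linarith

lemma Dq_zero (h β q : ℝ) (hh : 0 < h) (hβ : 0 < β) (hq : 0 < q) (hq1 : q < 1)
    (he : q / (h ^ 2 + 2 * q * β ^ 2) = (1 - q) ^ 2) : Dq h β q = 0 := by
  have h1 : 0 < 1 - q := by linarith
  have : Real.sqrt (h ^ 2 / q + 2 * β ^ 2) = 1 / (1 - q) := by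
    have e : h ^ 2 / q + 2 * β ^ 2 = (1 / (1 - q)) ^ 2 := by
      rw [div_pow, ← he]
      field_simp
    rw [e, Real.sqrt_sq (by positivity)]
  unfold Dq
  rw [this]
  ring

lemma B_deriv_s14 (h β q : ℝ) (hh : 0 < h) (hβ : 0 < β) (hq : 0 < q) (hq1 : q < 1) :
    HasDerivAt (fun q => Real.sqrt (h ^ 2 * q + 2 * β ^ 2 * q ^ 2) +
      (1 / 2) * Real.log (1 - q) + (β ^ 2 / 2) * (1 - q) ^ 2) (Dq h β q) q := by
  have h1 : 0 < 1 - q := by linarith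
  have hQ : 0 < h ^ 2 * q + 2 * β ^ 2 * q ^ 2 := by positivity
  have d1 : HasDerivAt (fun q : ℝ => h ^ 2 * q + 2 * β ^ 2 * q ^ 2) (h ^ 2 + 4 * β ^ 2 * q) q := by
    have := ((hasDerivAt_id q).const_mul (h ^ 2)).add (((hasDerivAt_id q).pow 2).const_mul (2 * β ^ 2))
    refine this.congr_deriv ?_
    simp only [id]
    norm_num
    ring
  have d2 : HasDerivAt (fun q : ℝ => 1 - q) (-1) q := by
    simpa using (hasDerivAt_id q).const_sub 1
  have d := ((d1.sqrt hQ.ne').add ((d2.log h1.ne').const_mul (1 / 2))).add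
    ((d2.pow 2).const_mul (β ^ 2 / 2))
  refine d.congr_deriv ?_
  have hs : Real.sqrt (h ^ 2 * q + 2 * β ^ 2 * q ^ 2) = q * Real.sqrt (h ^ 2 / q + 2 * β ^ 2) := by
    have e : h ^ 2 * q + 2 * β ^ 2 * q ^ 2 = q ^ 2 * (h ^ 2 / q + 2 * β ^ 2) := by
      field_simp
    rw [e, Real.sqrt_mul (by positivity), Real.sqrt_sq hq.le]
  have hsp : 0 < Real.sqrt (h ^ 2 / q + 2 * β ^ 2) := by positivity
  have hs2 : Real.sqrt (h ^ 2 / q + 2 * β ^ 2) ^ 2 = h ^ 2 / q + 2 * β ^ 2 :=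
    Real.sq_sqrt (by positivity)
  rw [hs]
  unfold Dq
  norm_num
  generalize Real.sqrt (h ^ 2 / q + 2 * β ^ 2) = s at *
  have hh2 : h ^ 2 = q * s ^ 2 - 2 * β ^ 2 * q := by rw [hs2]; field_simp; ring
  rw [hh2]
  field_simp
  ring

lemma cs_le (h u α : ℝ) (hα : α ∈ Set.Icc (-1 : ℝ) 1) :
    h * α + u * Real.sqrt (2 * (1 - α ^ 2)) ≤ Real.sqrt (h ^ 2 + 2 * u ^ 2) := by
  have h0 : 0 ≤ 2 * (1 - α ^ 2) := by nlinarith [hα.1, hα.2]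
  have hc := Real.sq_sqrt h0
  generalize Real.sqrt (2 * (1 - α ^ 2)) = c at *
  apply Real.le_sqrt_of_sq_le
  nlinarith [sq_nonneg (h * c - 2 * u * α)]

lemma cs_eq (h u α : ℝ) (hh : 0 < h) (hα : α ∈ Set.Icc (-1 : ℝ) 1)
    (he : h * α + u * Real.sqrt (2 * (1 - α ^ 2)) = Real.sqrt (h ^ 2 + 2 * u ^ 2)) :
    α = h / Real.sqrt (h ^ 2 + 2 * u ^ 2) := by
  have h0 : 0 ≤ 2 * (1 - α ^ 2) := by nlinarith [hα.1, hα.2]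
  have hc := Real.sq_sqrt h0
  have hS := Real.sq_sqrt (show 0 ≤ h ^ 2 + 2 * u ^ 2 by positivity)
  have hSp : 0 < Real.sqrt (h ^ 2 + 2 * u ^ 2) := by positivity
  generalize Real.sqrt (2 * (1 - α ^ 2)) = c at *
  generalize Real.sqrt (h ^ 2 + 2 * u ^ 2) = S at *
  have hz : (h * c - 2 * u * α) ^ 2 = 0 := by
    have : (h * α + u * c) ^ 2 = h ^ 2 + 2 * u ^ 2 := by rw [he, hS]
    linear_combination (h ^ 2 + 2 * u ^ 2) * hc - 2 * this
  have hz2 : h * c - 2 * u * α = 0 := by simpa using hz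
  have : α * S * S = h * S := by
    linear_combination α * hS - u * hz2 + h * he
  rw [eq_div_iff hSp.ne']
  exact mul_right_cancel₀ hSp.ne' this

lemma cs_val (h u : ℝ) (hh : 0 < h) (hu : 0 ≤ u) :
    h * (h / Real.sqrt (h ^ 2 + 2 * u ^ 2)) +
      u * Real.sqrt (2 * (1 - (h / Real.sqrt (h ^ 2 + 2 * u ^ 2)) ^ 2)) =
      Real.sqrt (h ^ 2 + 2 * u ^ 2) := by
  have hS := Real.sq_sqrt (show 0 ≤ h ^ 2 + 2 * u ^ 2 by positivity)
  have hSp : 0 < Real.sqrt (h ^ 2 + 2 * u ^ 2) := by positivity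
  generalize Real.sqrt (h ^ 2 + 2 * u ^ 2) = S at *
  have : 2 * (1 - (h / S) ^ 2) = (2 * u / S) ^ 2 := by
    field_simp
    linear_combination hS
  rw [this, Real.sqrt_sq (by positivity)]
  field_simp
  linear_combination - hS

/-- Lemma: TAP maximizer with linear external field `f(x) = hx`.
Since `g` is only defined for `r ∈ [0,1)` (it involves `log(1−r²)`), suprema and maximizers
over the Plefka region `Plef(β) = [√q_P, 1]` are taken over `[√q_P, 1)`. -/
theorem stmt_14 (h β : ℝ) (hh : 0 < h) (hβ : 0 < β)
    (g : ℝ → ℝ)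
    (hg : ∀ r, g r = (1 / 2) * Real.log (1 - r ^ 2) + (β ^ 2 / 2) * (1 - r ^ 2) ^ 2)
    (qP : ℝ) (hqP : qP = max (1 - 1 / (Real.sqrt 2 * β)) 0)
    (Bt : ℝ → ℝ → ℝ)
    (hBt : ∀ α r, Bt α r = h * (r * α) + β * r ^ 2 * Real.sqrt (2 * (1 - α ^ 2)) + g r)
    (scrB : ℝ → ℝ)
    (hscrB : ∀ q, scrB q = Real.sqrt (h ^ 2 * q + 2 * β ^ 2 * q ^ 2) +
      (1 / 2) * Real.log (1 - q) + (β ^ 2 / 2) * (1 - q) ^ 2) :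
    sSup {y : ℝ | ∃ r ∈ Set.Ico (Real.sqrt qP) 1, ∃ α ∈ Set.Icc (-1 : ℝ) 1, y = Bt α r} =
      sSup (scrB '' Set.Ico qP 1) ∧
    StrictConcaveOn ℝ (Set.Ico qP 1) scrB ∧
    ∃ qh : ℝ, qh ∈ Set.Ioo qP 1 ∧
      qh / (h ^ 2 + 2 * qh * β ^ 2) = (1 - qh) ^ 2 ∧
      (∀ q ∈ Set.Ioo qP 1, q / (h ^ 2 + 2 * q * β ^ 2) = (1 - q) ^ 2 → q = qh) ∧
      IsMaxOn scrB (Set.Ico qP 1) qh ∧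
      (∀ q ∈ Set.Ico qP 1, IsMaxOn scrB (Set.Ico qP 1) q → q = qh) ∧
      IsMaxOn (fun p : ℝ × ℝ => Bt p.1 p.2)
        (Set.Icc (-1 : ℝ) 1 ×ˢ Set.Ico (Real.sqrt qP) 1)
        (h / Real.sqrt (h ^ 2 + 2 * β ^ 2 * qh), Real.sqrt qh) ∧
      ∀ p ∈ Set.Icc (-1 : ℝ) 1 ×ˢ Set.Ico (Real.sqrt qP) 1,
        IsMaxOn (fun p : ℝ × ℝ => Bt p.1 p.2)
            (Set.Icc (-1 : ℝ) 1 ×ˢ Set.Ico (Real.sqrt qP) 1) p →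
          p = (h / Real.sqrt (h ^ 2 + 2 * β ^ 2 * qh), Real.sqrt qh) := by
  have h0 : 0 ≤ qP := by rw [hqP]; exact le_max_right _ _
  have hP1 : qP < 1 := by
    rw [hqP]
    apply max_lt _ one_pos
    have : 0 < 1 / (Real.sqrt 2 * β) := by positivity
    linarith
  have hfun : scrB = fun q => Real.sqrt (h ^ 2 * q + 2 * β ^ 2 * q ^ 2) +
      (1 / 2) * Real.log (1 - q) + (β ^ 2 / 2) * (1 - q) ^ 2 := funext hscrB
  have hd : ∀ q ∈ Set.Ioo qP 1, HasDerivAt scrB (Dq h β q) q := by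
    intro q hq
    rw [hfun]
    exact B_deriv_s14 h β q hh hβ (h0.trans_lt hq.1) hq.2
  have hanti := Dq_anti h β qP hh hβ hqP
  have hcont : ContinuousOn scrB (Set.Ico qP 1) := by
    rw [hfun]
    have : ContinuousOn (fun q : ℝ => Real.log (1 - q)) (Set.Ico qP 1) := by
      apply ContinuousOn.log (by fun_prop)
      intro x hx
      linarith [hx.2]
    fun_prop
  have hconc : StrictConcaveOn ℝ (Set.Ico qP 1) scrB := by
    apply StrictAntiOn.strictConcaveOn_of_deriv (convex_Ico _ _) hcont
    rw [interior_Ico]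
    intro a ha b hb hab
    rw [(hd a ha).deriv, (hd b hb).deriv]
    exact hanti ha hb hab
  obtain ⟨qh, hqh, hroot⟩ : ∃ qh ∈ Set.Ioo qP 1, qh / (h ^ 2 + 2 * qh * β ^ 2) = (1 - qh) ^ 2 := by
    have hc : ContinuousOn (fun q : ℝ => (1 - q) ^ 2 * (h ^ 2 + 2 * q * β ^ 2) - q)
      (Set.Icc qP 1) := by fun_prop
    have hpos : 0 < (1 - qP) ^ 2 * (h ^ 2 + 2 * qP * β ^ 2) - qP := by
      rcases max_choice (1 - 1 / (Real.sqrt 2 * β)) 0 with hm | hm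
      · rw [hm] at hqP
        have e : (1 - qP) ^ 2 * (2 * β ^ 2) = 1 := by
          rw [hqP]
          have := Real.sq_sqrt (show (0 : ℝ) ≤ 2 by norm_num)
          field_simp
          rw [sub_sub_cancel, one_pow, this]
          ring
        have : 0 < (1 - qP) ^ 2 * h ^ 2 := by
          have := sub_pos.2 hP1
          positivity
        nlinarith [congrArg (fun z => qP * z) e]
      · rw [hm] at hqP
        rw [hqP]
        simp
        positivity
    obtain ⟨q, hq, hq0⟩ := intermediate_value_Ioo' hP1.le hc
      (show (0 : ℝ) ∈ Set.Ioo _ _ from ⟨by norm_num, hpos⟩)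
    refine ⟨q, hq, ?_⟩
    have : 0 < q := h0.trans_lt hq.1
    rw [div_eq_iff (by positivity)]
    simp only at hq0
    linarith
  have hqh0 : 0 < qh := h0.trans_lt hqh.1
  have hDz := Dq_zero h β qh hh hβ hqh0 hqh.2 hroot
  have hmem : qh ∈ Set.Ico qP 1 := ⟨hqh.1.le, hqh.2⟩
  have hmax : IsMaxOn scrB (Set.Ico qP 1) qh := by
    have hA : AntitoneOn scrB (Set.Ico qh 1) := by
      apply antitoneOn_of_deriv_nonpos (convex_Ico _ _)
        (hcont.mono (Set.Ico_subset_Ico_left hqh.1.le))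
      · rw [interior_Ico]
        intro x hx
        exact (hd x ⟨hqh.1.trans hx.1, hx.2⟩).differentiableAt.differentiableWithinAt
      · rw [interior_Ico]
        intro x hx
        have hx' : x ∈ Set.Ioo qP 1 := ⟨hqh.1.trans hx.1, hx.2⟩
        rw [(hd x hx').deriv, ← hDz]
        exact (hanti hqh hx' hx.1).le
    have hM : MonotoneOn scrB (Set.Icc qP qh) := by
      apply monotoneOn_of_deriv_nonneg (convex_Icc _ _)
        (hcont.mono (fun x hx => ⟨hx.1, hx.2.trans_lt hqh.2⟩))
      · rw [interior_Icc]
        intro x hx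
        exact (hd x ⟨hx.1, hx.2.trans hqh.2⟩).differentiableAt.differentiableWithinAt
      · rw [interior_Icc]
        intro x hx
        have hx' : x ∈ Set.Ioo qP 1 := ⟨hx.1, hx.2.trans hqh.2⟩
        rw [(hd x hx').deriv, ← hDz]
        exact (hanti hx' hqh hx.2).le
    intro x hx
    show scrB x ≤ scrB qh
    rcases le_total x qh with hle | hle
    · exact hM ⟨hx.1, hle⟩ ⟨hqh.1.le, le_rfl⟩ hle
    · exact hA ⟨le_rfl, hqh.2⟩ ⟨hle, hx.2⟩ hle
  have huniq : ∀ q ∈ Set.Ico qP 1, IsMaxOn scrB (Set.Ico qP 1) q → q = qh := fun q hq hm =>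
    hconc.eq_of_isMaxOn hm hmax hq hmem
  -- relation between the two functions
  have hsB : ∀ r, 0 ≤ r → scrB (r ^ 2) = r * Real.sqrt (h ^ 2 + 2 * (β * r) ^ 2) + g r := by
    intro r hr
    rw [hscrB, hg]
    have : h ^ 2 * r ^ 2 + 2 * β ^ 2 * (r ^ 2) ^ 2 = r ^ 2 * (h ^ 2 + 2 * (β * r) ^ 2) := by ring
    rw [this, Real.sqrt_mul (by positivity), Real.sqrt_sq hr]
    ring
  have hBt' : ∀ α r, Bt α r = r * (h * α + β * r * Real.sqrt (2 * (1 - α ^ 2))) + g r := by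
    intro α r
    rw [hBt]
    ring
  have hle : ∀ α ∈ Set.Icc (-1 : ℝ) 1, ∀ r, 0 ≤ r → Bt α r ≤ scrB (r ^ 2) := by
    intro α hα r hr
    rw [hsB r hr, hBt']
    have := mul_le_mul_of_nonneg_left (cs_le h (β * r) α hα) hr
    linarith
  have hr0 : 0 < Real.sqrt qh := Real.sqrt_pos.2 hqh0
  have hrsq : Real.sqrt qh ^ 2 = qh := Real.sq_sqrt hqh0.le
  have hS : h ^ 2 + 2 * (β * Real.sqrt qh) ^ 2 = h ^ 2 + 2 * β ^ 2 * qh := by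
    rw [mul_pow, hrsq]; ring
  have hval : Bt (h / Real.sqrt (h ^ 2 + 2 * β ^ 2 * qh)) (Real.sqrt qh) = scrB qh := by
    have := cs_val h (β * Real.sqrt qh) hh (by positivity)
    have h2 := hsB _ hr0.le
    rw [hrsq] at h2
    rw [h2, hBt', ← hS, this]
  have hrm : Real.sqrt qh ∈ Set.Ico (Real.sqrt qP) 1 :=
    ⟨Real.sqrt_le_sqrt hqh.1.le, by
      rw [Real.sqrt_lt' one_pos]; simpa using hqh.2⟩
  have ham : h / Real.sqrt (h ^ 2 + 2 * β ^ 2 * qh) ∈ Set.Icc (-1 : ℝ) 1 := by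
    have hp : 0 < h / Real.sqrt (h ^ 2 + 2 * β ^ 2 * qh) := by positivity
    refine ⟨by linarith, ?_⟩
    rw [div_le_one (by positivity)]
    apply Real.le_sqrt_of_sq_le
    have : 0 < 2 * β ^ 2 * qh := by positivity
    linarith
  have hsqm : ∀ r ∈ Set.Ico (Real.sqrt qP) 1, 0 ≤ r ∧ r ^ 2 ∈ Set.Ico qP 1 := by
    intro r hr
    have hr0 : 0 ≤ r := (Real.sqrt_nonneg _).trans hr.1
    refine ⟨hr0, ?_, ?_⟩
    · exact (Real.sqrt_le_left hr0).1 hr.1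
    · nlinarith [hr.2]
  have hbound : ∀ α ∈ Set.Icc (-1 : ℝ) 1, ∀ r ∈ Set.Ico (Real.sqrt qP) 1, Bt α r ≤ scrB qh := by
    intro α hα r hr
    exact (hle α hα r (hsqm r hr).1).trans (hmax (hsqm r hr).2)
  refine ⟨?_, hconc, qh, hqh, hroot, ?_, hmax, huniq, ?_, ?_⟩
  · have g1 : IsGreatest {y : ℝ | ∃ r ∈ Set.Ico (Real.sqrt qP) 1, ∃ α ∈ Set.Icc (-1 : ℝ) 1,
        y = Bt α r} (scrB qh) := by
      refine ⟨⟨_, hrm, _, ham, hval.symm⟩, ?_⟩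
      rintro y ⟨r, hr, α, hα, rfl⟩
      exact hbound α hα r hr
    have g2 : IsGreatest (scrB '' Set.Ico qP 1) (scrB qh) := by
      refine ⟨⟨qh, hmem, rfl⟩, ?_⟩
      rintro y ⟨q, hq, rfl⟩
      exact hmax hq
    rw [g1.csSup_eq, g2.csSup_eq]
  · intro q hq he
    apply hanti.injOn hq hqh
    rw [hDz, Dq_zero h β q hh hβ (h0.trans_lt hq.1) hq.2 he]
  · rintro ⟨α, r⟩ ⟨hα, hr⟩
    show Bt α r ≤ Bt _ _
    rw [hval]
    exact hbound α hα r hr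
  · rintro ⟨α, r⟩ ⟨hα, hr⟩ hm
    simp only at hα hr
    have h1 : Bt (h / Real.sqrt (h ^ 2 + 2 * β ^ 2 * qh)) (Real.sqrt qh) ≤ Bt α r :=
      hm (show (_, _) ∈ _ from ⟨ham, hrm⟩)
    rw [hval] at h1
    obtain ⟨hr0', hrI⟩ := hsqm r hr
    have h2 := hle α hα r hr0'
    have hrq : r ^ 2 = qh := by
      apply huniq _ hrI
      intro x hx
      exact (hmax hx : scrB x ≤ scrB qh).trans (h1.trans h2)
    have hre : r = Real.sqrt qh := by rw [← hrq, Real.sqrt_sq hr0']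
    have h3 : Bt α r = scrB (r ^ 2) := le_antisymm h2 (by rw [hrq]; exact h1)
    rw [hsB r hr0', hBt'] at h3
    have h4 := mul_left_cancel₀ (by rw [hre]; positivity) (add_right_cancel h3)
    have h5 := cs_eq h (β * r) α hh hα h4
    rw [hre, hS] at h5
    rw [h5, hre]
end
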